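/- arXiv:2109.10705 — 2 statements merged into one kernel-verified Lean document; each statement's English description precedes it below -/
import Mathlib

section
/- For every n with 10 ≤ n ≤ 14, cf(n) = 3; that is, every set of n points in general position contains a 3-crossing family, and there exists a set of n points in general position containing no 4-crossing family. -/
/-- A finite set of points in the plane is in *general position* if no three of
its points are collinear. -/
def GenPos (S : Finset (ℝ × ℝ)) : Prop :=
  ∀ p ∈ S, ∀ q ∈ S, ∀ r ∈ S, p ≠ q → p ≠ r → q ≠ r →
    ¬Collinear ℝ ({p, q, r} : Set (ℝ × ℝ))

/-- Two closed segments `pq` and `rs` *cross* if they intersect in exactly one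
point, which lies in the interior of both segments. -/
def Crosses (p q r s : ℝ × ℝ) : Prop :=
  ∃ x : ℝ × ℝ, x ∈ openSegment ℝ p q ∧ x ∈ openSegment ℝ r s ∧
    segment ℝ p q ∩ segment ℝ r s = {x}

/-- `F` is a *crossing family* in `S`: a finite set of segments (given by their
pairs of distinct endpoints, which belong to `S`) that pairwise cross. -/
def IsCrossingFamily (S : Finset (ℝ × ℝ)) (F : Finset ((ℝ × ℝ) × (ℝ × ℝ))) : Prop :=
  (∀ e ∈ F, e.1 ∈ S ∧ e.2 ∈ S ∧ e.1 ≠ e.2) ∧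
  (∀ e ∈ F, ∀ f ∈ F, e ≠ f → Crosses e.1 e.2 f.1 f.2)

/-- `S` contains a `k`-crossing family. -/
def HasCrossingFamily (S : Finset (ℝ × ℝ)) (k : ℕ) : Prop :=
  ∃ F : Finset ((ℝ × ℝ) × (ℝ × ℝ)), IsCrossingFamily S F ∧ F.card = k

/-- `cf S`: the maximum size of a crossing family in `S`. -/
noncomputable def cf (S : Finset (ℝ × ℝ)) : ℕ :=
  sSup {k : ℕ | HasCrossingFamily S k}

/-- `cfNat n`: the minimum of `cf S` over all sets `S` of `n` points in
general position. -/
noncomputable def cfNat (n : ℕ) : ℕ :=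
  sInf {m : ℕ | ∃ S : Finset (ℝ × ℝ), S.card = n ∧ GenPos S ∧ cf S = m}

/-- Twice the signed area of the triangle `pqr`. -/
def orient (p q r : ℝ × ℝ) : ℝ :=
  (q.1 - p.1) * (r.2 - p.2) - (q.2 - p.2) * (r.1 - p.1)

theorem orient_rotate (p q r : ℝ × ℝ) : orient q r p = orient p q r := by
  unfold orient; ring

theorem orient_swap (p q r : ℝ × ℝ) : orient p r q = -orient p q r := by
  unfold orient; ring

theorem orient_combo (p q r s : ℝ × ℝ) (a b : ℝ) (h : a + b = 1) :
    orient p q (a • r + b • s) = a * orient p q r + b * orient p q s := by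
  obtain rfl : a = 1 - b := by linarith
  simp only [orient, Prod.fst_add, Prod.snd_add, Prod.smul_fst, Prod.smul_snd, smul_eq_mul]
  ring

theorem orient_left (p q : ℝ × ℝ) : orient p q p = 0 := by
  simp [orient]

theorem orient_right (p q : ℝ × ℝ) : orient p q q = 0 := by
  unfold orient; ring

theorem collinear_of_orient_eq_zero {p q r : ℝ × ℝ} (hpq : p ≠ q) (h : orient p q r = 0) :
    Collinear ℝ ({p, q, r} : Set (ℝ × ℝ)) := by
  rw [collinear_iff_of_mem (p₀ := p) (by simp)]
  refine ⟨q - p, ?_⟩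
  have hr : ∃ t : ℝ, r = t • (q - p) +ᵥ p := by
    unfold orient at h
    by_cases hx : q.1 - p.1 = 0
    · have hy : q.2 - p.2 ≠ 0 := fun hy =>
        hpq (Prod.ext (by linarith) (by linarith))
      have hr : r.1 - p.1 = 0 := by
        rw [hx] at h
        have : (q.2 - p.2) * (r.1 - p.1) = 0 := by linarith
        exact (mul_eq_zero.mp this).resolve_left hy
      refine ⟨(r.2 - p.2) / (q.2 - p.2), Prod.ext ?_ ?_⟩
      · simp [hx]; linarith
      · simp; field_simp; ring
    · refine ⟨(r.1 - p.1) / (q.1 - p.1), Prod.ext ?_ ?_⟩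
      · simp; field_simp; ring
      · simp; field_simp; linarith
  intro x hx
  simp only [Set.mem_insert_iff, Set.mem_singleton_iff] at hx
  rcases hx with rfl | rfl | rfl
  · exact ⟨0, by simp⟩
  · exact ⟨1, by simp⟩
  · exact hr

theorem orient_eq_zero_of_collinear {p q r : ℝ × ℝ}
    (h : Collinear ℝ ({p, q, r} : Set (ℝ × ℝ))) : orient p q r = 0 := by
  rw [collinear_iff_of_mem (p₀ := p) (by simp)] at h
  obtain ⟨v, hv⟩ := h
  obtain ⟨a, rfl⟩ := hv q (by simp)
  obtain ⟨b, rfl⟩ := hv r (by simp)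
  simp [orient]
  ring

theorem GenPos.orient_ne_zero {S : Finset (ℝ × ℝ)} (hS : GenPos S) {p q r : ℝ × ℝ}
    (hp : p ∈ S) (hq : q ∈ S) (hr : r ∈ S) (hpq : p ≠ q) (hpr : p ≠ r) (hqr : q ≠ r) :
    orient p q r ≠ 0 := fun h =>
  hS p hp q hq r hr hpq hpr hqr (collinear_of_orient_eq_zero hpq h)

theorem Crosses.symm {p q r s : ℝ × ℝ} (h : Crosses p q r s) : Crosses r s p q := by
  obtain ⟨x, h₁, h₂, h₃⟩ := h
  exact ⟨x, h₂, h₁, by rwa [Set.inter_comm]⟩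

theorem Crosses.swap {p q r s : ℝ × ℝ} (h : Crosses p q r s) : Crosses q p r s := by
  obtain ⟨x, h₁, h₂, h₃⟩ := h
  exact ⟨x, by rwa [openSegment_symm], h₂, by rwa [segment_symm ℝ q p]⟩

theorem not_crosses_self {p q : ℝ × ℝ} (hpq : p ≠ q) : ¬ Crosses p q p q := by
  rintro ⟨x, -, -, h⟩
  rw [Set.inter_self] at h
  have hp : p ∈ ({x} : Set (ℝ × ℝ)) := h ▸ left_mem_segment ℝ p q
  have hq : q ∈ ({x} : Set (ℝ × ℝ)) := h ▸ right_mem_segment ℝ p q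
  exact hpq (hp.trans hq.symm)

/-- Segments whose endpoints strictly separate each other cross. -/
theorem crosses_of_orient {p q r s : ℝ × ℝ} (h₁ : orient p q r * orient p q s < 0)
    (h₂ : orient r s p * orient r s q < 0) : Crosses p q r s := by
  have weights : ∀ {a b : ℝ}, a * b < 0 →
      0 < a / (a - b) ∧ 0 < -b / (a - b) ∧ -b / (a - b) + a / (a - b) = 1 := by
    intro a b hab
    rcases mul_neg_iff.mp hab with ⟨ha, hb⟩ | ⟨ha, hb⟩
    · have : 0 < a - b := by linarith
      exact ⟨by positivity, div_pos (by linarith) this, by field_simp; ring⟩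
    · have : a - b < 0 := by linarith
      have h0 : a - b ≠ 0 := this.ne
      exact ⟨div_pos_of_neg_of_neg ha this, div_pos_of_neg_of_neg (by linarith) this,
        by field_simp; ring⟩
  obtain ⟨u₁, u₂, u₃⟩ := weights h₁
  obtain ⟨v₁, v₂, v₃⟩ := weights h₂
  have hD : orient r s p - orient r s q ≠ 0 := fun h => by
    rw [h] at v₁; simp at v₁
  have hD' : orient p q r - orient p q s = -(orient r s p - orient r s q) := by
    unfold orient; ring
  set t := orient r s p / (orient r s p - orient r s q) with ht
  set t' := -orient r s q / (orient r s p - orient r s q) with ht'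
  refine ⟨t' • p + t • q, ⟨t', t, v₂, v₁, v₃, rfl⟩, ⟨_, _, u₂, u₁, u₃, ?_⟩, ?_⟩
  · rw [ht, ht', hD']
    apply Prod.ext <;>
    · simp only [Prod.fst_add, Prod.snd_add, Prod.smul_fst, Prod.smul_snd, smul_eq_mul]
      field_simp
      unfold orient
      ring
  · apply Set.eq_singleton_iff_unique_mem.mpr
    refine ⟨⟨⟨t', t, v₂.le, v₁.le, v₃, rfl⟩, ⟨_, _, u₂.le, u₁.le, u₃, ?_⟩⟩, ?_⟩
    · rw [ht, ht', hD']
      apply Prod.ext <;>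
      · simp only [Prod.fst_add, Prod.snd_add, Prod.smul_fst, Prod.smul_snd, smul_eq_mul]
        field_simp
        unfold orient
        ring
    · rintro y ⟨⟨a, b, -, -, hab, rfl⟩, ⟨c, d, -, -, hcd, hy⟩⟩
      have h0 : orient r s (a • p + b • q) = 0 := by
        rw [← hy, orient_combo _ _ _ _ _ _ hcd, orient_left, orient_right]; ring
      rw [orient_combo _ _ _ _ _ _ hab] at h0
      obtain rfl : a = 1 - b := by linarith
      have hb : b = t := by rw [ht, eq_div_iff hD]; linarith
      have ht1 : 1 - t = t' := by linarith
      rw [hb, ht1]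

theorem Crosses.orient_mul_neg {p q r s : ℝ × ℝ} (h : Crosses p q r s) :
    orient p q r * orient p q s < 0 ∨ (orient p q r = 0 ∧ orient p q s = 0) := by
  obtain ⟨x, ⟨a, b, -, -, hab, hx⟩, ⟨c, d, hc, hd, hcd, hx'⟩, -⟩ := h
  have h0 : orient p q x = 0 := by
    rw [← hx, orient_combo _ _ _ _ _ _ hab, orient_left, orient_right]; ring
  rw [← hx', orient_combo _ _ _ _ _ _ hcd] at h0
  rcases lt_trichotomy (orient p q r) 0 with h | h | h
  · left
    exact mul_neg_of_neg_of_pos h (by nlinarith)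
  · right
    rw [h] at h0
    exact ⟨h, by simpa [hd.ne'] using h0⟩
  · left
    exact mul_neg_of_pos_of_neg h (by nlinarith)

theorem HasCrossingFamily.mono {S T : Finset (ℝ × ℝ)} (hST : S ⊆ T) {k l : ℕ} (hkl : l ≤ k)
    (h : HasCrossingFamily S k) : HasCrossingFamily T l := by
  obtain ⟨F, ⟨h₁, h₂⟩, rfl⟩ := h
  obtain ⟨G, hG, hcard⟩ := Finset.exists_subset_card_eq hkl
  exact ⟨G, ⟨fun e he => ⟨hST (h₁ e (hG he)).1, hST (h₁ e (hG he)).2.1, (h₁ e (hG he)).2.2⟩,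
    fun e he f hf => h₂ e (hG he) f (hG hf)⟩, hcard⟩

theorem GenPos.mono {S T : Finset (ℝ × ℝ)} (hST : S ⊆ T) (hT : GenPos T) : GenPos S :=
  fun p hp q hq r hr => hT p (hST hp) q (hST hq) r (hST hr)

theorem bddAbove_hasCrossingFamily (S : Finset (ℝ × ℝ)) :
    BddAbove {k : ℕ | HasCrossingFamily S k} := by
  refine ⟨(S ×ˢ S).card, ?_⟩
  rintro k ⟨F, ⟨h, -⟩, rfl⟩
  exact Finset.card_le_card fun e he => Finset.mem_product.mpr ⟨(h e he).1, (h e he).2.1⟩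

theorem le_cf {S : Finset (ℝ × ℝ)} {k : ℕ} (h : HasCrossingFamily S k) : k ≤ cf S :=
  le_csSup (bddAbove_hasCrossingFamily S) h

theorem cf_le {S : Finset (ℝ × ℝ)} {k : ℕ} (h : ¬ HasCrossingFamily S (k + 1)) : cf S ≤ k := by
  refine csSup_le' fun l hl => ?_
  by_contra! hkl
  exact h (hl.mono subset_rfl hkl)

/-! ### Fourteen points without four pairwise crossing segments -/

/-- The coordinates of fourteen points in general position without a 4-crossing family. -/
def coords : List (ℕ × ℕ) :=
  [(0, 89), (1, 89), (30, 88), (39, 84), (49, 69), (62, 70), (66, 85), (69, 43), (73, 80),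
    (80, 37), (102, 0), (106, 97), (115, 103), (125, 110)]

/-- The `i`-th of the fourteen points. -/
def pt (i : ℕ) : ℝ × ℝ :=
  (((coords.getD i (0, 0)).1 : ℝ), ((coords.getD i (0, 0)).2 : ℝ))

/-- The triangle on the points with coordinates `p`, `q`, `r` is positively oriented. -/
def ccw (p q r : ℕ × ℕ) : Bool :=
  Nat.blt (p.1 * r.2 + q.1 * p.2 + r.1 * q.2) (p.1 * q.2 + q.1 * r.2 + r.1 * p.2)

/-- The points with coordinates `r` and `s` lie strictly on opposite sides of the line `pq`. -/
def separates (p q r s : ℕ × ℕ) : Bool :=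
  (ccw p q r && ccw q p s) || (ccw q p r && ccw p q s)

/-- The segments `e` and `f`, given by the indices of their endpoints, cross. -/
def crossesIdx (e f : ℕ × ℕ) : Bool :=
  let p := coords.getD e.1 (0, 0)
  let q := coords.getD e.2 (0, 0)
  let r := coords.getD f.1 (0, 0)
  let s := coords.getD f.2 (0, 0)
  separates p q r s && separates r s p q

/-- No `k` members of the list are pairwise related by `r`. -/
def noClique {α : Type*} (r : α → α → Bool) : ℕ → List α → Bool
  | 0, _ => false
  | k + 1, L => L.tails.all fun
    | [] => true
    | e :: t => noClique r k (t.filter (r e))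

theorem noClique_sound {α : Type*} [DecidableEq α] {r : α → α → Bool} (k : ℕ) :
    ∀ L : List α, noClique r k L = true → ∀ F : Finset α, (∀ e ∈ F, e ∈ L) →
      (∀ e ∈ F, ∀ f ∈ F, e ≠ f → r e f = true) → F.card ≠ k := by
  induction k with
  | zero => intro L h; simp [noClique] at h
  | succ k ihk =>
    intro L
    induction L with
    | nil =>
      intro _ F hF _
      rw [Finset.eq_empty_of_forall_notMem fun e he => List.not_mem_nil (hF e he)]
      simp
    | cons e t iht =>
      intro h F hF hr hcard
      simp only [noClique, List.tails_cons, List.all_cons, Bool.and_eq_true] at h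
      obtain ⟨h₁, h₂⟩ := h
      by_cases he : e ∈ F
      · refine ihk _ h₁ (F.erase e) (fun f hf => ?_) (fun f hf g hg =>
          hr f (Finset.mem_of_mem_erase hf) g (Finset.mem_of_mem_erase hg)) ?_
        · obtain ⟨hfe, hf⟩ := Finset.mem_erase.mp hf
          exact List.mem_filter.mpr ⟨(List.mem_cons.mp (hF f hf)).resolve_left hfe,
            hr e he f hf hfe.symm⟩
        · rw [Finset.card_erase_of_mem he, hcard]; simp
      · exact iht h₂ F (fun f hf => (List.mem_cons.mp (hF f hf)).resolve_left
          fun h => he (h ▸ hf)) hr hcard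

/-- The index pairs of the segments of the fourteen points. -/
def segments : List (ℕ × ℕ) :=
  (List.range 14).flatMap fun j => (List.range j).map fun i => (i, j)

theorem mem_segments {i j : ℕ} : (i, j) ∈ segments ↔ i < j ∧ j < 14 := by
  simp [segments, and_comm]

theorem noClique_segments : noClique crossesIdx 4 segments = true := by
  decide +kernel

theorem coords_ccw : ((List.range 14).all fun k => (List.range k).all fun j =>
    (List.range j).all fun i =>
      let p := coords.getD i (0, 0)
      let q := coords.getD j (0, 0)
      let r := coords.getD k (0, 0)
      ccw p q r || ccw p r q) = true := by
  decide +kernel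

theorem ccw_iff (i j k : ℕ) :
    ccw (coords.getD i (0, 0)) (coords.getD j (0, 0)) (coords.getD k (0, 0)) = true ↔
      0 < orient (pt i) (pt j) (pt k) := by
  generalize hp : coords.getD i (0, 0) = p
  generalize hq : coords.getD j (0, 0) = q
  generalize hr : coords.getD k (0, 0) = r
  simp only [ccw, Nat.blt_eq, pt, orient, hp, hq, hr]
  rw [← Nat.cast_lt (α := ℝ), ← sub_pos]
  push_cast
  ring_nf

theorem orient_pt_ne_zero_of_lt {i j k : ℕ} (hij : i < j) (hjk : j < k) (hk : k < 14) :
    orient (pt i) (pt j) (pt k) ≠ 0 := by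
  have h := coords_ccw
  simp only [List.all_eq_true, List.mem_range, Bool.or_eq_true] at h
  rcases h k hk j hjk i hij with h | h
  · exact ((ccw_iff i j k).mp h).ne'
  · have := (ccw_iff i k j).mp h
    rw [orient_swap] at this
    linarith

theorem orient_pt_ne_zero {i j k : ℕ} (hi : i < 14) (hj : j < 14) (hk : k < 14)
    (hij : i ≠ j) (hik : i ≠ k) (hjk : j ≠ k) : orient (pt i) (pt j) (pt k) ≠ 0 := by
  have rot : ∀ a b c : ℕ, orient (pt a) (pt b) (pt c) ≠ 0 →
      orient (pt b) (pt c) (pt a) ≠ 0 := fun a b c h => by rwa [orient_rotate]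
  have swap : ∀ a b c : ℕ, orient (pt a) (pt b) (pt c) ≠ 0 →
      orient (pt a) (pt c) (pt b) ≠ 0 := fun a b c h => by rwa [orient_swap, neg_ne_zero]
  rcases hij.lt_or_gt with h₁ | h₁ <;> rcases hik.lt_or_gt with h₂ | h₂ <;>
    rcases hjk.lt_or_gt with h₃ | h₃
  · exact orient_pt_ne_zero_of_lt h₁ h₃ hk
  · exact swap _ _ _ (orient_pt_ne_zero_of_lt h₂ h₃ hj)
  · omega
  · exact rot _ _ _ (orient_pt_ne_zero_of_lt h₂ h₁ hj)
  · exact swap _ _ _ (rot _ _ _ (orient_pt_ne_zero_of_lt h₁ h₂ hk))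
  · omega
  · exact rot _ _ _ (rot _ _ _ (orient_pt_ne_zero_of_lt h₃ h₂ hi))
  · exact rot _ _ _ (swap _ _ _ (orient_pt_ne_zero_of_lt h₃ h₁ hi))

theorem pt_ne {i j : ℕ} (hi : i < 14) (hj : j < 14) (hij : i ≠ j) : pt i ≠ pt j := by
  obtain ⟨k, hk, hki, hkj⟩ : ∃ k < 14, k ≠ i ∧ k ≠ j := by
    by_contra! h
    have h₀ := h 0 (by norm_num)
    have h₁ := h 1 (by norm_num)
    have h₂ := h 2 (by norm_num)
    omega
  intro h
  apply orient_pt_ne_zero hk hi hj hki hkj hij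
  rw [h, orient_right]

/-- The first `n` of the fourteen points. -/
noncomputable def firstPts (n : ℕ) : Finset (ℝ × ℝ) := (Finset.range n).image pt

theorem card_firstPts {n : ℕ} (hn : n ≤ 14) : (firstPts n).card = n := by
  rw [firstPts, Finset.card_image_of_injOn, Finset.card_range]
  intro i hi j hj h
  simp only [Finset.coe_range, Set.mem_Iio] at hi hj
  by_contra hij
  exact pt_ne (by omega) (by omega) hij h

theorem genPos_firstPts {n : ℕ} (hn : n ≤ 14) : GenPos (firstPts n) := by
  intro p hp q hq r hr hpq hpr hqr hcol
  simp only [firstPts, Finset.mem_image, Finset.mem_range] at hp hq hr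
  obtain ⟨i, hi, rfl⟩ := hp
  obtain ⟨j, hj, rfl⟩ := hq
  obtain ⟨k, hk, rfl⟩ := hr
  exact orient_pt_ne_zero (by omega) (by omega) (by omega) (fun h => hpq (congrArg pt h))
    (fun h => hpr (congrArg pt h)) (fun h => hqr (congrArg pt h)) (orient_eq_zero_of_collinear hcol)

theorem separates_of_crosses {a b c d : ℕ} (ha : a < 14) (hb : b < 14) (hc : c < 14)
    (hd : d < 14) (hab : a ≠ b) (hcd : c ≠ d) (h : Crosses (pt a) (pt b) (pt c) (pt d)) :
    separates (coords.getD a (0, 0)) (coords.getD b (0, 0)) (coords.getD c (0, 0))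
      (coords.getD d (0, 0)) = true := by
  have flip : ∀ r, orient (pt b) (pt a) r = -orient (pt a) (pt b) r := fun r => by
    rw [orient_swap, orient_rotate, orient_rotate]
  simp only [separates, Bool.or_eq_true, Bool.and_eq_true, ccw_iff, flip, Left.neg_pos_iff]
  rcases h.orient_mul_neg with h' | ⟨h₁, h₂⟩
  · rcases mul_neg_iff.mp h' with h' | h'
    · exact Or.inl h'
    · exact Or.inr h'
  · exfalso
    have hc' : c = a ∨ c = b := by
      by_contra! h
      exact orient_pt_ne_zero ha hb hc hab h.1.symm h.2.symm h₁
    have hd' : d = a ∨ d = b := by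
      by_contra! h
      exact orient_pt_ne_zero ha hb hd hab h.1.symm h.2.symm h₂
    have hne := pt_ne ha hb hab
    rcases hc' with rfl | rfl <;> rcases hd' with rfl | rfl
    · exact hcd rfl
    · exact not_crosses_self hne h
    · exact not_crosses_self hne h.symm.swap.symm
    · exact hcd rfl

theorem crossesIdx_of_crosses {e f : ℕ × ℕ} (he : e ∈ segments) (hf : f ∈ segments)
    (h : Crosses (pt e.1) (pt e.2) (pt f.1) (pt f.2)) : crossesIdx e f = true := by
  obtain ⟨he₁, he₂⟩ := mem_segments.mp he
  obtain ⟨hf₁, hf₂⟩ := mem_segments.mp hf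
  rw [crossesIdx, Bool.and_eq_true]
  exact ⟨separates_of_crosses (by omega) he₂ (by omega) hf₂ he₁.ne hf₁.ne h,
    separates_of_crosses (by omega) hf₂ (by omega) he₂ hf₁.ne he₁.ne h.symm⟩

theorem not_hasCrossingFamily_firstPts : ¬ HasCrossingFamily (firstPts 14) 4 := by
  classical
  rintro ⟨F, ⟨hF, hcross⟩, hcard⟩
  have hidx : ∀ e ∈ F, ∃ s ∈ segments,
      e = (pt s.1, pt s.2) ∨ e = (pt s.2, pt s.1) := by
    intro e he
    obtain ⟨h₁, h₂, hne⟩ := hF e he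
    simp only [firstPts, Finset.mem_image, Finset.mem_range] at h₁ h₂
    obtain ⟨i, hi, hi'⟩ := h₁
    obtain ⟨j, hj, hj'⟩ := h₂
    have hij : i ≠ j := fun h => hne (by rw [← hi', ← hj', h])
    rcases hij.lt_or_gt with h | h
    · exact ⟨(i, j), mem_segments.mpr ⟨h, hj⟩, Or.inl (Prod.ext hi'.symm hj'.symm)⟩
    · exact ⟨(j, i), mem_segments.mpr ⟨h, hi⟩, Or.inr (Prod.ext hi'.symm hj'.symm)⟩
  choose! g hg hge using hidx
  have hgcross : ∀ e ∈ F, ∀ f ∈ F, e ≠ f →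
      Crosses (pt (g e).1) (pt (g e).2) (pt (g f).1) (pt (g f).2) := by
    intro e he f hf hef
    have h := hcross e he f hf hef
    rcases hge e he with h₁ | h₁ <;> rcases hge f hf with h₂ | h₂ <;>
      simp only [congrArg Prod.fst h₁, congrArg Prod.snd h₁, congrArg Prod.fst h₂,
        congrArg Prod.snd h₂] at h
    · exact h
    · exact h.symm.swap.symm
    · exact h.swap
    · exact h.swap.symm.swap.symm
  have hinj : Set.InjOn g F := by
    intro e he f hf hef
    by_contra hne
    have h := hgcross e he f hf hne
    rw [← hef] at h
    obtain ⟨h₁, h₂⟩ := mem_segments.mp (hg e he)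
    exact not_crosses_self (pt_ne (by omega) h₂ h₁.ne) h
  refine noClique_sound 4 segments noClique_segments (F.image g) ?_ ?_
    (by rw [Finset.card_image_of_injOn hinj, hcard])
  · intro s hs
    obtain ⟨e, he, rfl⟩ := Finset.mem_image.mp hs
    exact hg e he
  · intro s hs t ht hst
    obtain ⟨e, he, rfl⟩ := Finset.mem_image.mp hs
    obtain ⟨f, hf, rfl⟩ := Finset.mem_image.mp ht
    exact crossesIdx_of_crosses (hg e he) (hg f hf)
      (hgcross e he f hf fun h => hst (h ▸ rfl))

/-! ### Sign vectors without three pairwise crossing segments -/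

/-- The code of the triple `i`, `j`, `k` of decimal digits. -/
def code (i j k : ℕ) : ℕ := 100 * i + 10 * j + k

/-- Read off the orientations `χ` of the triples of four points `i < j < k < l`, in
lexicographic order: every subsequence of length three changes sign at most once. -/
def IsMonotoneAt (χ : ℕ → Bool) (i j k l : ℕ) : Prop :=
  let a := χ (code i j k)
  let b := χ (code i j l)
  let c := χ (code i k l)
  let d := χ (code j k l)
  ¬(a ≠ b ∧ b ≠ c) ∧ ¬(a ≠ b ∧ b ≠ d) ∧ ¬(a ≠ c ∧ c ≠ d) ∧ ¬(b ≠ c ∧ c ≠ d)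

/-- The orientations `χ` make the segments `ab` and `cd` cross, where `a` is the least
and `a < b`, `c < d`. -/
def SignCross (χ : ℕ → Bool) (a b c d : ℕ) : Prop :=
  (a < c ∧ c < b ∧ b < d ∧ χ (code a c b) = χ (code c b d)) ∨
    (a < c ∧ c < d ∧ d < b ∧ χ (code a c b) ≠ χ (code a d b))

/-- A binary tree refuting the existence of ten points without a 3-crossing family.
Nodes `s n` branch on the orientation of the triple with code `n`. Leaves `q n` name a
quadruple of points at which monotonicity fails, and leaves `f n` name three pairwise
crossing segments, each by its larger endpoint followed by its smaller one. -/
inductive Refutation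
  | q (n : ℕ)
  | f (n : ℕ)
  | s (n : ℕ) (pos neg : Refutation)

/-- The `i`-th decimal digit of `n`. -/
def digit (n i : ℕ) : ℕ := n / 10 ^ i % 10

/-- The orientations with codes `m` and `n` are known and equal. Here and below `T` and `F`
are the bit sets of the codes of the triples known to be positive and negative. -/
def knownEq (T F m n : ℕ) : Bool :=
  (T.testBit m && T.testBit n) || (F.testBit m && F.testBit n)

/-- The orientations with codes `m` and `n` are known and different. -/
def knownNe (T F m n : ℕ) : Bool :=
  (T.testBit m && F.testBit n) || (F.testBit m && T.testBit n)

/-- Monotonicity is known to fail at `i`, `j`, `k`, `l`. -/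
def knownNonMonotone (T F i j k l : ℕ) : Bool :=
  let a := code i j k
  let b := code i j l
  let c := code i k l
  let d := code j k l
  Nat.blt i j && Nat.blt j k && Nat.blt k l &&
    ((knownNe T F a b && (knownNe T F b c || knownNe T F b d)) ||
      (knownNe T F c d && (knownNe T F a c || knownNe T F b c)))

/-- The segments `ab` and `cd` are known to cross. -/
def knownCross (T F a b c d : ℕ) : Bool :=
  Nat.blt a c &&
    ((Nat.blt c b && Nat.blt b d && knownEq T F (code a c b) (code c b d)) ||
      (Nat.blt c d && Nat.blt d b && knownNe T F (code a c b) (code a d b)))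

/-- The tree refutes all sign vectors that are positive on `T` and negative on `F`. -/
def Refutation.check : Refutation → ℕ → ℕ → Bool
  | q n, T, F => knownNonMonotone T F (digit n 3) (digit n 2) (digit n 1) (digit n 0)
  | f n, T, F =>
    Nat.blt (digit n 0) (digit n 1) &&
      knownCross T F (digit n 4) (digit n 5) (digit n 2) (digit n 3) &&
      knownCross T F (digit n 4) (digit n 5) (digit n 0) (digit n 1) &&
      knownCross T F (digit n 2) (digit n 3) (digit n 0) (digit n 1)
  | s n l r, T, F => l.check (T ||| 1 <<< n) F && r.check T (F ||| 1 <<< n)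

/-- The sign vector `χ` is positive on `T` and negative on `F`. -/
def Extends (χ : ℕ → Bool) (T F : ℕ) : Prop :=
  ∀ n, (T.testBit n = true → χ n = true) ∧ (F.testBit n = true → χ n = false)

theorem Extends.eq_of_knownEq {χ : ℕ → Bool} {T F m n : ℕ} (h : Extends χ T F)
    (hk : knownEq T F m n = true) : χ m = χ n := by
  simp only [knownEq, Bool.or_eq_true, Bool.and_eq_true] at hk
  rcases hk with ⟨h₁, h₂⟩ | ⟨h₁, h₂⟩
  · rw [(h m).1 h₁, (h n).1 h₂]
  · rw [(h m).2 h₁, (h n).2 h₂]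

theorem Extends.ne_of_knownNe {χ : ℕ → Bool} {T F m n : ℕ} (h : Extends χ T F)
    (hk : knownNe T F m n = true) : χ m ≠ χ n := by
  simp only [knownNe, Bool.or_eq_true, Bool.and_eq_true] at hk
  rcases hk with ⟨h₁, h₂⟩ | ⟨h₁, h₂⟩
  · rw [(h m).1 h₁, (h n).2 h₂]; simp
  · rw [(h m).2 h₁, (h n).1 h₂]; simp

theorem Extends.signCross {χ : ℕ → Bool} {T F a b c d : ℕ} (h : Extends χ T F)
    (hk : knownCross T F a b c d = true) : SignCross χ a b c d := by
  simp only [knownCross, Bool.or_eq_true, Bool.and_eq_true, Nat.blt_eq] at hk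
  obtain ⟨hac, ⟨⟨hcb, hbd⟩, hk⟩ | ⟨⟨hcd, hdb⟩, hk⟩⟩ := hk
  · exact Or.inl ⟨hac, hcb, hbd, h.eq_of_knownEq hk⟩
  · exact Or.inr ⟨hac, hcd, hdb, h.ne_of_knownNe hk⟩

theorem testBit_or_one_shiftLeft (T n m : ℕ) :
    (T ||| 1 <<< n).testBit m = true ↔ T.testBit m = true ∨ m = n := by
  rw [Nat.testBit_or, Nat.one_shiftLeft, Nat.testBit_two_pow, Bool.or_eq_true,
    decide_eq_true_iff, eq_comm (a := n)]

theorem digit_lt (n i : ℕ) : digit n i < 10 := Nat.mod_lt _ (by norm_num)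

theorem Refutation.check_sound {χ : ℕ → Bool}
    (hmono : ∀ i j k l, i < j → j < k → k < l → l < 10 → IsMonotoneAt χ i j k l)
    (hcross : ∀ a b c d e f, b < 10 → d < 10 → f < 10 → e < f →
      SignCross χ a b c d → SignCross χ a b e f → SignCross χ c d e f → False) :
    ∀ (t : Refutation) (T F : ℕ), t.check T F = true → ¬ Extends χ T F := by
  intro t
  induction t with
  | q n =>
    intro T F h hχ
    simp only [check, knownNonMonotone, Bool.or_eq_true, Bool.and_eq_true, Nat.blt_eq] at h
    obtain ⟨⟨⟨hij, hjk⟩, hkl⟩, h⟩ := h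
    obtain ⟨h₁, h₂, h₃, h₄⟩ := hmono _ _ _ _ hij hjk hkl (digit_lt n 0)
    rcases h with ⟨hab, h | h⟩ | ⟨hcd, h | h⟩
    · exact h₁ ⟨hχ.ne_of_knownNe hab, hχ.ne_of_knownNe h⟩
    · exact h₂ ⟨hχ.ne_of_knownNe hab, hχ.ne_of_knownNe h⟩
    · exact h₃ ⟨hχ.ne_of_knownNe h, hχ.ne_of_knownNe hcd⟩
    · exact h₄ ⟨hχ.ne_of_knownNe h, hχ.ne_of_knownNe hcd⟩
  | f n =>
    intro T F h hχ
    simp only [check, Bool.and_eq_true, Nat.blt_eq] at h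
    obtain ⟨⟨⟨hef, h₁⟩, h₂⟩, h₃⟩ := h
    exact hcross _ _ _ _ _ _ (digit_lt n 5) (digit_lt n 3) (digit_lt n 1) hef
      (hχ.signCross h₁) (hχ.signCross h₂) (hχ.signCross h₃)
  | s n l r ihl ihr =>
    intro T F h hχ
    simp only [check, Bool.and_eq_true] at h
    cases hn : χ n
    · refine ihr _ _ h.2 fun m => ⟨(hχ m).1, fun hm => ?_⟩
      rcases (testBit_or_one_shiftLeft F n m).mp hm with hm | rfl
      · exact (hχ m).2 hm
      · exact hn
    · refine ihl _ _ h.1 fun m => ⟨fun hm => ?_, (hχ m).2⟩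
      rcases (testBit_or_one_shiftLeft T n m).mp hm with hm | rfl
      · exact (hχ m).1 hm
      · exact hn

/-- A part of the tree `refutation`. -/
def refutation₁ : Refutation :=
  .s 358 (.s 158 (.s 348 (.s 148 (.s 237 (.s 238 (.s 247 (.f 407283) (.s 257 (.f 507283) (.s 267
  (.f 607283) (.s 248 (.s 234 (.s 235 (.s 236 (.s 245 (.f 405283) (.s 246 (.f 406283) (.s 256 (.f
  506283) (.s 345 (.q 2345) (.s 134 (.s 124 (.f 304182) (.f 304152)) (.s 124 (.q 1234) (.f
  416253))))))) (.q 2367)) (.q 2357)) (.q 2347)) (.q 2348))))) (.q 2378)) (.s 379 (.s 389 (.f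
  708193) (.s 489 (.q 3489) (.s 589 (.q 3589) (.s 689 (.q 3689) (.s 167 (.s 137 (.f 607183) (.s
  367 (.s 369 (.s 678 (.f 709386) (.s 679 (.q 6789) (.s 469 (.s 467 (.s 468 (.s 349 (.f 609384)
  (.f 609374)) (.q 4689)) (.q 4679)) (.s 346 (.s 349 (.s 147 (.f 407163) (.s 478 (.f 709384) (.q
  1478))) (.q 3469)) (.q 3469))))) (.q 3679)) (.q 1367))) (.s 678 (.s 369 (.f 709386) (.s 367 (.q
  3679) (.s 679 (.s 156 (.s 567 (.q 1567) (.s 136 (.f 506183) (.s 359 (.f 506193) (.s 135 (.q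
  1356) (.s 357 (.f 506173) (.s 578 (.s 568 (.s 125 (.s 123 (.s 236 (.q 1236) (.s 256 (.f 516273)
  (.f 629375))) (.q 1235)) (.s 256 (.s 258 (.s 268 (.s 236 (.f 506283) (.s 126 (.f 506182) (.s 235
  (.q 2356) (.f 615273)))) (.q 2568)) (.q 1258)) (.q 1256))) (.f 708596)) (.q 3578))))))) (.s 157
  (.q 1567) (.s 578 (.s 359 (.f 709385) (.s 579 (.s 569 (.f 709586) (.s 567 (.q 5679) (.s 136 (.s
  146 (.f 406183) (.s 134 (.s 147 (.q 1467) (.s 347 (.q 1347) (.s 479 (.s 459 (.f 709485) (.s 469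
  (.f 709486) (.f 619475))) (.q 3479)))) (.q 1346))) (.f 619375)))) (.q 3579))) (.q 1578)))) (.q
  3679)))) (.q 1678))))))) (.s 389 (.q 3789) (.s 589 (.q 3589) (.s 689 (.q 3689) (.s 167 (.s 137
  (.f 607183) (.s 369 (.f 607193) (.s 136 (.q 1367) (.s 367 (.s 236 (.q 2367) (.s 127 (.s 128 (.s
  268 (.s 278 (.f 607182) (.s 238 (.f 608273) (.s 126 (.f 618293) (.s 235 (.q 2358) (.s 125 (.s
  156 (.q 1256) (.s 567 (.s 258 (.f 608275) (.s 569 (.f 608295) (.s 356 (.s 359 (.f 829365) (.s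
  157 (.f 507163) (.f 715293))) (.f 826395)))) (.q 1567))) (.s 157 (.s 258 (.s 356 (.f 507163) (.s
  567 (.f 608275) (.f 826375))) (.q 1258)) (.q 1257))))))) (.s 126 (.s 238 (.q 2368) (.s 235 (.q
  2358) (.s 356 (.s 157 (.f 507163) (.s 359 (.f 719365) (.f 715293))) (.s 156 (.q 1356) (.s 359
  (.q 3569) (.f 615293)))))) (.q 1268))) (.q 1278)) (.f 716293))) (.q 1367))))) (.s 678 (.s 136
  (.s 146 (.f 406183) (.s 156 (.f 506183) (.s 134 (.s 135 (.s 145 (.f 405183) (.s 345 (.q 1345)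
  (.s 235 (.s 234 (.s 238 (.s 245 (.f 405283) (.s 124 (.s 248 (.f 304182) (.q 2348)) (.f 415283)))
  (.q 2358)) (.q 2345)) (.s 123 (.s 125 (.s 126 (.s 234 (.f 305142) (.f 614253)) (.q 1236)) (.q
  1235)) (.q 1235))))) (.q 1356)) (.q 1346)))) (.s 137 (.q 1367) (.s 127 (.s 123 (.s 236 (.q 1236)
  (.s 369 (.s 367 (.s 679 (.q 3679) (.s 569 (.s 567 (.s 568 (.s 579 (.f 709586) (.s 357 (.s 578
  (.f 607385) (.q 5678)) (.f 739586))) (.q 5689)) (.q 5679)) (.s 359 (.s 157 (.f 507193) (.s 568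
  (.f 609385) (.s 578 (.f 938576) (.f 719385)))) (.q 3569)))) (.q 3679)) (.f 716293))) (.q 1237))
  (.s 278 (.s 247 (.s 124 (.q 1247) (.s 234 (.q 2347) (.s 347 (.s 248 (.s 349 (.f 407293) (.s 134
  (.q 1234) (.s 147 (.f 714293) (.s 238 (.s 478 (.s 268 (.s 146 (.s 346 (.s 126 (.f 406182) (.s
  369 (.q 3469) (.f 614293))) (.q 1346)) (.s 126 (.q 1246) (.s 468 (.s 267 (.f 607284) (.s 369 (.f
  729364) (.f 617293))) (.q 1468)))) (.q 2368)) (.q 1478)) (.f 408273))))) (.q 2478)) (.q 2347))))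
  (.s 478 (.s 257 (.s 125 (.q 1257) (.s 235 (.q 2357) (.s 357 (.s 258 (.s 359 (.f 507293) (.s 135
  (.q 1235) (.s 157 (.f 715293) (.s 238 (.s 578 (.s 268 (.s 156 (.s 356 (.s 126 (.f 506182) (.s
  369 (.q 3569) (.f 615293))) (.q 1356)) (.s 126 (.q 1256) (.s 568 (.s 267 (.f 607285) (.s 369 (.f
  729365) (.f 617293))) (.q 1568)))) (.q 2368)) (.q 1578)) (.f 508273))))) (.q 2578)) (.q 2357))))
  (.s 157 (.q 1257) (.s 578 (.s 367 (.s 679 (.q 3679) (.s 567 (.s 156 (.q 1567) (.s 568 (.s 357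
  (.f 607385) (.s 356 (.q 3567) (.s 359 (.q 3579) (.s 145 (.s 456 (.q 1456) (.s 135 (.f 405183)
  (.s 349 (.f 405193) (.s 134 (.q 1345) (.s 346 (.f 405163) (.s 347 (.f 405173) (.s 125 (.s 124
  (.s 235 (.q 1235) (.s 245 (.f 415263) (.f 527364))) (.f 417293)) (.f 517293)))))))) (.s 146 (.q
  1456) (.s 468 (.s 347 (.f 607384) (.s 467 (.s 457 (.f 607485) (.s 456 (.q 4567) (.s 135 (.s 134
  (.s 125 (.s 245 (.q 1245) (.s 234 (.f 305142) (.s 235 (.q 2345) (.f 527364)))) (.s 123 (.q 1235)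
  (.s 235 (.s 234 (.s 238 (.s 245 (.f 405283) (.s 124 (.s 248 (.f 304182) (.q 2348)) (.f 415283)))
  (.q 1238)) (.q 1234)) (.q 1235)))) (.q 1345)) (.f 517364)))) (.q 3467))) (.q 1468))))))) (.q
  5678))) (.s 356 (.s 357 (.s 346 (.s 347 (.s 458 (.f 507384) (.s 468 (.f 607384) (.f 847596)))
  (.q 3467)) (.s 456 (.s 468 (.s 347 (.f 607384) (.f 507364)) (.q 3468)) (.q 3456))) (.q 3567))
  (.q 3567)))) (.s 267 (.q 2367) (.s 369 (.q 3679) (.s 126 (.s 123 (.s 236 (.q 1236) (.s 268 (.s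
  238 (.s 248 (.s 258 (.s 146 (.f 406182) (.s 156 (.f 506182) (.s 124 (.s 125 (.s 134 (.f 304182)
  (.s 135 (.f 305182) (.s 145 (.f 405182) (.s 234 (.q 1234) (.s 235 (.q 1235) (.s 458 (.s 347 (.s
  357 (.f 507384) (.f 615273)) (.f 614273)) (.q 1458))))))) (.q 1256)) (.q 1246)))) (.q 2358)) (.q
  2348)) (.f 618273)) (.s 238 (.q 2368) (.s 679 (.f 708296) (.f 827396))))) (.q 1236)) (.f
  617293))))) (.q 2578)))) (.q 2478))) (.q 1278))))) (.q 1678)))))))) (.q 1348)) (.s 134 (.s 345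
  (.q 3458) (.s 458 (.s 346 (.q 3468) (.s 456 (.f 508364) (.s 457 (.f 508374) (.s 467 (.f 608374)
  (.s 356 (.q 3456) (.s 245 (.s 234 (.s 248 (.s 258 (.s 238 (.s 135 (.s 125 (.f 305182) (.s 145
  (.f 305142) (.f 518364))) (.s 145 (.q 1345) (.f 516374))) (.q 2348)) (.q 2458)) (.q 2458)) (.q
  2345)) (.s 235 (.f 528364) (.f 526374)))))))) (.q 3458))) (.q 1348))) (.q 1358)) (.s 135 (.s 356
  (.q 3568) (.s 568 (.s 357 (.q 3578) (.s 578 (.s 567 (.f 608375) (.s 367 (.q 3567) (.s 458 (.s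
  345 (.q 3458) (.s 348 (.q 3458) (.s 468 (.s 134 (.s 346 (.q 3456) (.s 467 (.f 608374) (.s 456
  (.s 457 (.f 837465) (.s 258 (.s 235 (.s 238 (.s 268 (.s 248 (.s 124 (.f 304182) (.s 245 (.s 246
  (.s 256 (.f 506284) (.q 2456)) (.q 2456)) (.f 304152))) (.f 508264)) (.q 2568)) (.q 2358)) (.q
  2358)) (.s 245 (.q 2458) (.s 256 (.q 2568) (.s 246 (.q 2456) (.s 235 (.s 234 (.s 124 (.s 125 (.s
  145 (.s 146 (.s 156 (.f 506184) (.q 1456)) (.q 1456)) (.f 305142)) (.s 145 (.q 1245) (.f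
  516274))) (.f 304152)) (.q 2345)) (.f 526374))))))) (.f 836475)))) (.q 1345)) (.q 4568)))) (.s
  456 (.q 4568) (.s 457 (.q 4578) (.s 467 (.q 4567) (.s 348 (.s 148 (.s 345 (.s 145 (.s 158 (.s
  238 (.s 248 (.s 235 (.s 258 (.s 245 (.s 125 (.f 405182) (.s 123 (.q 1235) (.s 128 (.s 124 (.q
  1245) (.s 189 (.s 129 (.s 239 (.s 249 (.s 289 (.f 308192) (.f 409283)) (.q 1249)) (.q 1239)) (.q
  1289)) (.s 589 (.q 1589) (.s 689 (.q 1689) (.s 569 (.f 608395) (.s 579 (.f 708395) (.s 346 (.s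
  347 (.f 736495) (.s 468 (.f 638495) (.s 478 (.s 679 (.f 708496) (.f 847596)) (.f 738495)))) (.f
  637495)))))))) (.f 308152)))) (.q 2458)) (.f 408253)) (.q 2358)) (.q 2348)) (.s 128 (.s 234 (.q
  2348) (.s 258 (.q 2358) (.s 146 (.s 136 (.f 406183) (.s 156 (.q 1356) (.s 347 (.f 406173) (.s
  126 (.s 235 (.s 245 (.f 406152) (.f 615243)) (.f 615273)) (.f 614273))))) (.s 156 (.q 1456) (.s
  147 (.q 1467) (.s 167 (.q 1467) (.s 468 (.s 136 (.f 618375) (.s 478 (.s 346 (.f 638475) (.s 347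
  (.q 3467) (.s 126 (.f 614273) (.s 127 (.q 1267) (.s 268 (.s 278 (.f 826375) (.q 1278)) (.q
  1268)))))) (.q 1478))) (.q 1468)))))))) (.q 1238))) (.f 408153)) (.q 1458)) (.q 3458)) (.q
  1348)) (.f 836475)))))))) (.q 3578))) (.q 3568))) (.q 1358))

/-- A part of the tree `refutation`. -/
def refutation₂ : Refutation :=
  .s 238 (.s 234 (.s 235 (.s 236 (.s 126 (.s 146 (.s 156 (.s 268 (.f 306182) (.s 157 (.s 137 (.s
  127 (.s 147 (.s 167 (.s 278 (.f 307182) (.s 237 (.s 267 (.f 306172) (.s 367 (.q 2367) (.s 457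
  (.s 467 (.f 506174) (.s 456 (.s 567 (.q 4567) (.s 258 (.s 356 (.f 508263) (.f 826375)) (.s 125
  (.s 256 (.f 305162) (.s 257 (.f 305172) (.s 356 (.q 2356) (.s 246 (.q 2456) (.s 579 (.s 569 (.f
  607195) (.f 627495)) (.s 569 (.q 5679) (.f 726395))))))) (.f 305182)))) (.q 4567))) (.s 145 (.s
  125 (.s 256 (.f 305162) (.s 257 (.f 305172) (.s 356 (.q 2356) (.s 578 (.s 178 (.s 568 (.f
  607185) (.s 168 (.s 678 (.s 689 (.s 679 (.f 708196) (.q 6789)) (.s 679 (.f 708596) (.f 827396)))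
  (.q 5678)) (.q 1678))) (.q 1578)) (.s 568 (.s 158 (.s 168 (.s 567 (.s 678 (.q 5678) (.s 178 (.s
  689 (.s 679 (.f 708196) (.f 728596)) (.s 679 (.q 6789) (.f 827396))) (.f 608175))) (.q 5678))
  (.q 1568)) (.q 1568)) (.f 726385)))))) (.f 305142)) (.q 1457))))) (.q 2378))) (.f 307162)) (.f
  307142)) (.f 307152)) (.q 1357)) (.s 167 (.q 1567) (.s 567 (.q 1567) (.s 267 (.q 1267) (.s 467
  (.q 1467) (.s 246 (.s 468 (.q 2468) (.s 124 (.f 304162) (.s 123 (.q 1234) (.s 245 (.s 248 (.s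
  346 (.f 408263) (.s 278 (.s 678 (.s 179 (.s 579 (.s 259 (.s 239 (.s 249 (.s 279 (.s 269 (.f
  506192) (.s 289 (.f 709286) (.f 926384))) (.q 2579)) (.q 2459)) (.q 2359)) (.s 459 (.q 2459) (.s
  457 (.q 4579) (.s 139 (.s 239 (.s 249 (.s 269 (.f 306192) (.s 345 (.f 409253) (.s 356 (.f
  926354) (.s 279 (.f 926375) (.f 925374))))) (.f 304192)) (.q 1239)) (.s 149 (.q 1349) (.s 137
  (.q 1379) (.s 469 (.q 1469) (.s 479 (.s 378 (.s 489 (.f 709486) (.f 839476)) (.q 1378)) (.q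
  1479))))))))) (.q 1579)) (.s 169 (.q 1679) (.s 469 (.q 1469) (.s 489 (.f 826394) (.s 378 (.s 178
  (.s 479 (.f 708394) (.s 128 (.s 168 (.s 689 (.q 1689) (.s 679 (.f 708296) (.f 837496))) (.f
  308162)) (.s 148 (.f 308142) (.s 237 (.f 308172) (.s 247 (.f 817243) (.f 817294)))))) (.q 1378))
  (.s 137 (.s 237 (.s 127 (.f 307152) (.s 247 (.s 478 (.f 726384) (.s 147 (.f 307142) (.f
  716384))) (.f 304172))) (.q 2378)) (.q 1378))))))) (.q 2678)) (.f 826374))) (.f 304182)) (.f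
  304152))))) (.s 346 (.q 2346) (.s 248 (.q 2468) (.s 278 (.f 826374) (.s 237 (.s 378 (.q 2378)
  (.s 137 (.s 127 (.f 307152) (.f 307182)) (.q 1378))) (.q 2378)))))))))))) (.f 306152)) (.f
  306142)) (.s 123 (.q 1236) (.s 146 (.f 306142) (.s 156 (.f 306152) (.s 268 (.s 356 (.q 1356) (.s
  258 (.s 125 (.f 305182) (.s 145 (.f 305142) (.s 256 (.s 345 (.q 1345) (.s 378 (.s 278 (.s 357
  (.q 3578) (.s 578 (.s 367 (.q 3678) (.s 678 (.s 689 (.s 679 (.f 708296) (.q 6789)) (.s 679 (.f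
  708396) (.s 567 (.s 257 (.s 267 (.s 568 (.f 607285) (.q 5678)) (.q 2567)) (.q 2567)) (.f
  837596)))) (.q 3678))) (.q 3578))) (.q 2378)) (.s 137 (.s 237 (.s 257 (.s 267 (.s 568 (.s 578
  (.f 607285) (.s 567 (.s 678 (.q 5678) (.s 278 (.s 127 (.f 307182) (.s 157 (.f 307152) (.s 158
  (.q 1578) (.s 128 (.q 1258) (.s 468 (.s 467 (.s 248 (.s 457 (.s 124 (.q 1248) (.s 246 (.f
  506274) (.f 304162))) (.f 607485)) (.f 608274)) (.q 4678)) (.s 458 (.q 4568) (.f 615384)))))))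
  (.f 608275))) (.q 5678))) (.s 158 (.q 1568) (.s 168 (.q 1568) (.s 147 (.s 157 (.s 127 (.s 567
  (.s 278 (.f 507182) (.f 608275)) (.q 1567)) (.f 307142)) (.q 1457)) (.s 127 (.f 307142) (.s 157
  (.f 307152) (.s 167 (.f 307162) (.s 578 (.s 567 (.q 5678) (.s 678 (.s 569 (.s 579 (.f 607295)
  (.q 5679)) (.s 579 (.s 589 (.f 729586) (.f 816395)) (.f 716395))) (.q 5678))) (.f
  716385))))))))) (.f 306172)) (.f 305172)) (.q 2378)) (.q 1378)))) (.f 305162)))) (.s 256 (.q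
  2568) (.s 568 (.s 125 (.s 145 (.s 456 (.q 1456) (.s 127 (.s 137 (.s 237 (.s 167 (.s 267 (.s 157
  (.s 257 (.f 305172) (.s 578 (.f 607185) (.f 607285))) (.f 307152)) (.q 1267)) (.q 1267)) (.q
  1237)) (.q 1237)) (.s 157 (.q 1257) (.s 457 (.q 1457) (.s 467 (.s 567 (.s 278 (.f 608275) (.s
  178 (.q 1278) (.s 137 (.f 307182) (.q 1378)))) (.q 4567)) (.s 345 (.s 245 (.s 246 (.f 406253)
  (.s 124 (.f 304152) (.f 416253))) (.q 2345)) (.f 615374))))))) (.f 305142)) (.f 305182)) (.q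
  2568))))) (.f 306182)))))) (.q 2368)) (.q 2358)) (.q 2348)) (.s 123 (.s 128 (.s 258 (.q 2358)
  (.s 124 (.s 125 (.s 126 (.s 389 (.s 189 (.s 489 (.s 589 (.s 178 (.s 179 (.s 379 (.f 708193) (.s
  137 (.s 127 (.s 147 (.s 148 (.s 349 (.f 408193) (.s 479 (.f 708194) (.s 478 (.q 4789) (.s 457
  (.s 157 (.s 158 (.s 159 (.s 359 (.f 508193) (.s 459 (.f 508194) (.s 145 (.s 458 (.q 4589) (.s
  245 (.s 247 (.s 257 (.f 405172) (.q 2457)) (.q 2457)) (.s 235 (.s 234 (.s 345 (.q 2345) (.s 156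
  (.s 146 (.s 467 (.f 506174) (.s 468 (.q 4678) (.s 469 (.q 4679) (.s 369 (.q 3469) (.s 236 (.s
  246 (.f 304162) (.s 256 (.f 305162) (.f 625384))) (.s 246 (.q 2346) (.f 629384))))))) (.f
  306142)) (.f 306152))) (.q 2345)) (.f 529384)))) (.q 1459)))) (.q 1579)) (.q 1578)) (.q 1457))
  (.s 145 (.s 458 (.q 4578) (.s 459 (.q 4579) (.s 359 (.q 3459) (.s 245 (.s 235 (.f 304152) (.s
  158 (.s 345 (.s 579 (.f 708195) (.s 578 (.q 5789) (.s 357 (.s 347 (.f 405173) (.q 3457)) (.s 347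
  (.f 405273) (.f 739485))))) (.q 2345)) (.f 408152))) (.s 247 (.q 2457) (.s 257 (.q 2457) (.s 235
  (.s 237 (.s 345 (.q 2345) (.f 725384)) (.f 729384)) (.f 529384)))))))) (.q 1457)))))) (.q 1478))
  (.s 347 (.q 1347) (.s 479 (.s 234 (.f 307142) (.s 349 (.q 3479) (.s 148 (.f 708194) (.f
  814293)))) (.q 1479)))) (.q 1237)) (.q 1379))) (.q 1789)) (.s 127 (.s 137 (.s 237 (.f 308172)
  (.s 379 (.s 157 (.s 359 (.f 507193) (.s 357 (.q 3579) (.s 158 (.f 819375) (.s 235 (.f 308152)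
  (.f 815273))))) (.s 357 (.q 1357) (.s 158 (.q 1578) (.s 235 (.f 307152) (.f 815273))))) (.f
  817293))) (.q 1378)) (.q 1278))) (.q 3589)) (.q 3489)) (.q 1389)) (.s 239 (.q 2389) (.s 349 (.q
  3489) (.s 359 (.q 3589) (.s 369 (.q 3689) (.s 259 (.q 2359) (.s 378 (.s 178 (.s 237 (.q 2378)
  (.s 347 (.q 3478) (.s 478 (.s 357 (.q 3578) (.s 578 (.s 367 (.q 3678) (.s 678 (.s 247 (.q 2347)
  (.s 589 (.s 579 (.s 158 (.f 708195) (.s 569 (.s 235 (.f 308152) (.s 256 (.q 2569) (.s 356 (.q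
  3569) (.s 236 (.q 2356) (.s 168 (.s 567 (.f 608175) (.f 628375)) (.f 815263)))))) (.f 709586)))
  (.q 5789)) (.s 579 (.f 708395) (.s 278 (.f 827395) (.s 457 (.s 569 (.f 839576) (.s 379 (.q 3579)
  (.s 127 (.s 245 (.q 2457) (.s 458 (.s 256 (.s 156 (.s 456 (.s 236 (.f 305162) (.s 235 (.q 2356)
  (.s 157 (.s 167 (.s 147 (.f 507184) (.f 507164)) (.f 507162)) (.s 167 (.q 1567) (.s 137 (.f
  716253) (.f 715293)))))) (.q 2456)) (.q 1256)) (.s 246 (.q 2456) (.s 236 (.s 234 (.s 145 (.s 147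
  (.s 157 (.f 507184) (.q 1457)) (.q 1457)) (.f 305142)) (.q 2346)) (.f 627395)))) (.q 4578))) (.q
  1278)))) (.f 837495)))))) (.q 3678))) (.q 3578))) (.q 3478)))) (.q 1378)) (.s 137 (.s 127 (.s
  236 (.s 246 (.f 304162) (.s 256 (.f 305162) (.s 167 (.s 234 (.s 235 (.s 146 (.s 147 (.s 245 (.f
  304152) (.s 156 (.s 157 (.s 345 (.q 2345) (.s 458 (.s 468 (.f 506184) (.s 478 (.f 507184) (.s
  567 (.s 456 (.s 457 (.s 467 (.f 506174) (.q 4567)) (.q 4578)) (.q 4568)) (.f 628475)))) (.s 468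
  (.s 456 (.q 4568) (.s 568 (.s 478 (.f 607184) (.s 578 (.f 607185) (.s 467 (.s 457 (.f 506174)
  (.f 607485)) (.q 4678)))) (.q 4568))) (.f 625384)))) (.f 307152)) (.f 306152))) (.f 307142)) (.f
  306142)) (.q 2356)) (.q 2346)) (.f 307162)))) (.s 267 (.s 167 (.s 367 (.s 237 (.f 306172) (.s
  146 (.s 147 (.s 247 (.f 406172) (.s 347 (.f 406173) (.s 467 (.s 346 (.q 3467) (.s 478 (.s 468
  (.f 607184) (.q 4678)) (.s 468 (.f 607284) (.f 726384)))) (.q 2467)))) (.q 1467)) (.s 234 (.f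
  306142) (.s 347 (.s 247 (.f 617243) (.s 478 (.q 3478) (.s 468 (.f 607284) (.f 617284)))) (.f
  614273))))) (.q 2367)) (.q 1267)) (.s 237 (.q 2367) (.s 679 (.s 367 (.q 3679) (.s 178 (.s 167
  (.s 168 (.s 169 (.s 689 (.f 708196) (.s 678 (.s 569 (.s 579 (.s 157 (.f 607195) (.s 589 (.s 158
  (.f 708195) (.s 567 (.f 608175) (.q 1567))) (.f 709586))) (.q 5679)) (.s 156 (.s 589 (.q 5689)
  (.s 256 (.s 157 (.s 235 (.q 2356) (.s 568 (.q 2568) (.s 357 (.f 506273) (.s 578 (.f 718596) (.s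
  257 (.q 2357) (.s 579 (.q 5789) (.f 728395))))))) (.q 1567)) (.f 628395))) (.q 1569))) (.q
  6789))) (.q 1679)) (.q 1678)) (.s 678 (.s 147 (.s 467 (.q 1467) (.s 148 (.s 246 (.f 407162) (.s
  346 (.f 407163) (.s 347 (.q 3467) (.s 479 (.s 489 (.f 708194) (.s 469 (.f 709486) (.f 716294)))
  (.s 469 (.q 4679) (.f 627394)))))) (.q 1478))) (.s 234 (.f 307142) (.s 346 (.s 246 (.f 716243)
  (.s 469 (.q 3469) (.s 479 (.s 489 (.f 709486) (.f 628394)) (.f 716294)))) (.f 714263)))) (.q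
  1678))) (.s 168 (.s 167 (.s 678 (.q 1678) (.s 689 (.s 468 (.s 467 (.s 469 (.s 478 (.f 708496)
  (.s 147 (.s 479 (.f 607194) (.q 4679)) (.f 718496))) (.q 4689)) (.q 4678)) (.s 146 (.s 148 (.s
  478 (.q 4678) (.s 147 (.s 347 (.f 408173) (.s 246 (.s 234 (.q 2346) (.s 346 (.s 345 (.s 357 (.q
  3457) (.s 157 (.s 158 (.s 256 (.f 406253) (.s 578 (.q 1578) (.s 567 (.f 608175) (.s 568 (.q
  5678) (.f 627385))))) (.f 408153)) (.f 407153))) (.s 245 (.q 2345) (.s 356 (.s 256 (.s 145 (.f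
  405163) (.f 516243)) (.q 2456)) (.q 3456)))) (.q 2346))) (.f 627384))) (.q 1467))) (.q 1468))
  (.q 1468))) (.q 6789))) (.q 1678)) (.f 816273)))) (.s 689 (.s 678 (.q 6789) (.s 789 (.s 178 (.s
  167 (.s 168 (.s 179 (.s 169 (.s 469 (.s 467 (.s 489 (.s 148 (.f 608194) (.f 608174)) (.q 4689))
  (.q 4679)) (.s 146 (.s 479 (.q 4679) (.s 489 (.s 247 (.s 234 (.q 2347) (.s 347 (.s 246 (.s 367
  (.f 406173) (.f 406273)) (.q 2467)) (.q 2347))) (.f 729486)) (.s 246 (.s 247 (.s 234 (.q 2346)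
  (.s 347 (.s 367 (.f 406173) (.f 406273)) (.q 2347))) (.f 728394)) (.f 628394)))) (.q 1469))) (.q
  1679)) (.q 1789)) (.q 1678)) (.q 1678)) (.s 168 (.f 817296) (.s 367 (.s 156 (.s 357 (.f 506173)
  (.s 356 (.q 3567) (.s 158 (.f 817365) (.s 235 (.f 308152) (.f 815263))))) (.s 356 (.q 1356) (.s
  158 (.q 1568) (.s 235 (.f 306152) (.f 815263))))) (.f 816273)))) (.q 6789))) (.f 728396))))))
  (.q 1237)) (.q 1378))))))))) (.q 1236)) (.q 1235)) (.q 1234))) (.q 1238)) (.q 1238))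

/-- A part of the tree `refutation`. -/
def refutation₃ : Refutation :=
  .s 459 (.s 145 (.q 1459) (.s 245 (.q 2459) (.s 458 (.s 589 (.q 4589) (.s 469 (.s 146 (.q 1469)
  (.s 246 (.q 2469) (.s 468 (.s 689 (.q 4689) (.s 568 (.f 609485) (.s 456 (.s 569 (.q 5689) (.s
  356 (.s 346 (.f 506384) (.s 345 (.q 3456) (.s 156 (.s 126 (.f 614253) (.s 357 (.s 457 (.s 367
  (.s 347 (.s 478 (.f 507384) (.s 479 (.f 507394) (.s 467 (.s 678 (.q 4678) (.s 567 (.f 608475)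
  (.f 947586))) (.f 506174)))) (.f 507364)) (.f 506173)) (.q 3457)) (.s 367 (.q 3567) (.f
  615273)))) (.s 158 (.q 1568) (.s 148 (.q 1458) (.s 248 (.s 124 (.q 1248) (.s 258 (.s 256 (.f
  416253) (.q 2568)) (.q 2458))) (.s 258 (.f 508294) (.s 268 (.f 608294) (.s 126 (.s 125 (.s 347
  (.s 357 (.s 467 (.s 478 (.f 507384) (.s 479 (.f 507394) (.s 678 (.q 4678) (.s 567 (.f 608475)
  (.f 947586))))) (.q 3467)) (.q 3457)) (.s 357 (.s 367 (.f 507364) (.f 614273)) (.f 514273))) (.q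
  1256)) (.f 618295)))))))))) (.q 3568))) (.q 4568)))) (.q 4689)))) (.s 456 (.s 246 (.s 346 (.s
  256 (.s 345 (.f 406253) (.s 124 (.f 416253) (.s 356 (.s 578 (.s 478 (.s 367 (.s 347 (.s 357 (.f
  507384) (.q 3567)) (.q 3467)) (.s 347 (.f 406273) (.s 357 (.f 506273) (.f 415273)))) (.q 4578))
  (.s 357 (.s 367 (.s 347 (.s 478 (.f 507384) (.s 479 (.f 507394) (.s 257 (.s 267 (.f 507263) (.s
  247 (.f 507264) (.f 507284))) (.s 247 (.q 2457) (.f 729485))))) (.f 507364)) (.f 506273)) (.q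
  3578))) (.q 3456)))) (.q 2456)) (.q 2346)) (.s 256 (.f 506294) (.s 568 (.s 468 (.s 148 (.s 158
  (.s 168 (.s 346 (.f 408163) (.s 356 (.f 508163) (.s 369 (.q 3469) (.s 125 (.f 514263) (.s 359
  (.q 3569) (.f 516293)))))) (.q 1468)) (.q 1458)) (.s 146 (.q 1468) (.s 158 (.f 508194) (.s 156
  (.f 506194) (.s 479 (.s 578 (.f 709485) (.f 948576)) (.s 457 (.s 567 (.s 178 (.f 819475) (.s 467
  (.s 578 (.f 607485) (.s 478 (.s 147 (.q 1478) (.s 157 (.f 507194) (.f 719485))) (.f 608475)))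
  (.q 4567))) (.f 619475)) (.q 4579))))))) (.q 4568)) (.f 629485)))) (.q 4569)))) (.q 4589)))) (.s
  159 (.q 1459) (.s 259 (.q 2459) (.s 469 (.s 246 (.q 2469) (.s 456 (.q 4569) (.s 569 (.s 468 (.s
  568 (.s 589 (.f 608395) (.s 458 (.s 467 (.s 567 (.s 478 (.s 479 (.f 609475) (.s 267 (.s 247 (.f
  607284) (.f 607294)) (.s 247 (.q 2467) (.s 678 (.s 578 (.s 579 (.f 709586) (.s 457 (.f 607485)
  (.f 749586))) (.q 5678)) (.f 729486))))) (.f 608475)) (.q 4567)) (.s 678 (.s 479 (.f 709486) (.q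
  4679)) (.q 4678))) (.f 608495))) (.q 4568)) (.q 4689)) (.q 4569)))) (.s 349 (.s 345 (.s 346 (.s
  359 (.s 147 (.s 157 (.f 407153) (.s 167 (.f 407163) (.s 145 (.s 146 (.s 156 (.f 406153) (.s 456
  (.q 1456) (.s 124 (.s 126 (.s 127 (.s 245 (.f 406152) (.f 715264)) (.q 1247)) (.q 1246)) (.s 245
  (.s 247 (.s 126 (.f 406152) (.s 267 (.f 407263) (.f 406172))) (.q 1247)) (.q 1245))))) (.q
  1467)) (.q 1457)))) (.s 248 (.s 258 (.f 408253) (.s 268 (.f 408263) (.s 389 (.s 245 (.s 246 (.s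
  468 (.q 2468) (.s 369 (.s 256 (.f 406253) (.s 456 (.q 2456) (.s 679 (.s 689 (.f 708396) (.s 478
  (.f 708496) (.s 347 (.s 357 (.s 367 (.s 569 (.s 579 (.f 607395) (.q 5679)) (.s 589 (.q 5689) (.f
  826495))) (.f 406273)) (.f 405273)) (.q 3478)))) (.s 367 (.s 347 (.s 278 (.f 408273) (.s 247 (.s
  124 (.q 1247) (.s 267 (.f 407263) (.s 467 (.q 2467) (.s 126 (.s 146 (.s 156 (.f 406153) (.f
  406152)) (.q 1246)) (.s 146 (.f 406172) (.f 618274)))))) (.q 2478))) (.q 3467)) (.q 3679)))))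
  (.q 3689))) (.q 2468)) (.q 2458)) (.f 408293)))) (.s 478 (.s 247 (.q 2478) (.s 789 (.q 4789) (.s
  579 (.s 157 (.q 1579) (.s 257 (.q 2579) (.s 379 (.s 578 (.s 589 (.f 708395) (.s 458 (.s 389 (.s
  245 (.q 2458) (.s 369 (.s 347 (.s 357 (.f 507384) (.s 145 (.f 517384) (.s 479 (.f 517394) (.s
  125 (.s 258 (.f 518294) (.s 127 (.f 715294) (.s 278 (.f 708295) (.f 718294)))) (.f 517294)))))
  (.s 357 (.q 3457) (.s 367 (.q 3467) (.s 479 (.s 124 (.s 246 (.f 416273) (.s 678 (.s 679 (.s 278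
  (.f 708294) (.s 258 (.f 829475) (.s 569 (.f 709586) (.s 567 (.q 5679) (.s 689 (.f 708396) (.s
  568 (.s 256 (.q 2568) (.f 629475)) (.f 708596))))))) (.q 3679)) (.q 3678))) (.f 415273)) (.q
  3479))))) (.q 3689))) (.f 709384)) (.f 708495))) (.q 5789)) (.q 3579)))) (.s 357 (.s 479 (.q
  4579) (.s 589 (.q 5789) (.s 347 (.s 458 (.f 507384) (.s 258 (.q 2458) (.s 457 (.q 4578) (.s 278
  (.f 827495) (.s 157 (.q 1457) (.s 127 (.s 245 (.s 124 (.s 246 (.s 126 (.s 146 (.s 156 (.f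
  406153) (.f 406152)) (.q 1246)) (.q 1246)) (.s 456 (.q 2456) (.s 167 (.s 569 (.f 607195) (.f
  716495)) (.f 716294)))) (.q 1247)) (.f 715294)) (.f 718294))))))) (.q 3457)))) (.q 3579))))) (.s
  278 (.q 2478) (.s 479 (.q 4789) (.s 127 (.s 247 (.q 1247) (.s 467 (.s 146 (.q 1467) (.s 246 (.q
  2467) (.s 678 (.q 4678) (.s 679 (.q 4679) (.s 167 (.s 468 (.f 607184) (.s 268 (.q 2468) (.s 126
  (.s 267 (.f 617284) (.s 689 (.s 789 (.s 589 (.s 569 (.f 608395) (.s 579 (.f 708395) (.s 257 (.s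
  356 (.s 157 (.f 507163) (.q 1257)) (.q 3569)) (.f 729586)))) (.s 568 (.q 5689) (.s 579 (.q 5789)
  (.s 356 (.s 157 (.f 507163) (.s 458 (.f 718465) (.f 718495))) (.q 3568))))) (.q 6789)) (.f
  728496))) (.f 618294)))) (.f 716294)))))) (.s 167 (.q 1467) (.s 468 (.q 4678) (.s 126 (.s 246
  (.s 146 (.s 256 (.f 406253) (.s 156 (.f 406153) (.s 245 (.f 615243) (.q 2456)))) (.q 1246)) (.f
  716284)) (.q 1267)))))) (.f 718294))))))) (.s 389 (.q 3589) (.s 145 (.f 405193) (.s 458 (.s 148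
  (.f 408193) (.s 248 (.f 408293) (.s 158 (.f 819354) (.s 578 (.s 157 (.q 1578) (.s 478 (.s 379
  (.f 709384) (.s 127 (.f 715293) (.s 278 (.f 829374) (.f 718293)))) (.q 4578))) (.s 357 (.s 347
  (.s 379 (.q 3579) (.s 478 (.f 507384) (.s 147 (.f 407193) (.f 719384)))) (.q 3457)) (.q
  3578)))))) (.f 519384))))) (.q 3469)) (.q 3459)) (.s 359 (.q 3459) (.s 369 (.q 3469) (.s 389 (.q
  3489) (.s 589 (.q 3589) (.s 689 (.q 3689) (.s 479 (.s 457 (.q 4579) (.s 579 (.s 467 (.q 4679)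
  (.s 679 (.s 478 (.s 578 (.s 458 (.s 678 (.s 468 (.s 568 (.s 569 (.f 709586) (.s 567 (.q 5679)
  (.s 148 (.s 158 (.s 168 (.s 345 (.f 408153) (.s 346 (.f 408163) (.s 356 (.f 508163) (.s 145 (.q
  1345) (.f 516374))))) (.q 1468)) (.q 1458)) (.s 146 (.q 1468) (.s 178 (.f 708194) (.s 158 (.f
  819475) (.s 156 (.q 1568) (.f 619475)))))))) (.f 708596)) (.f 708496)) (.q 4678)) (.f 708495))
  (.q 4578)) (.q 4789)) (.q 4679))) (.q 4579))) (.s 379 (.q 3479) (.s 268 (.s 126 (.f 618293) (.s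
  146 (.f 614293) (.s 267 (.s 367 (.s 278 (.f 608273) (.s 127 (.s 167 (.s 147 (.s 467 (.s 346 (.f
  407163) (.s 248 (.f 608274) (.f 826394))) (.q 1467)) (.f 714293)) (.q 1267)) (.f 718293))) (.q
  2367)) (.f 617293)))) (.s 126 (.s 146 (.s 156 (.s 346 (.s 345 (.f 406153) (.s 356 (.s 145 (.q
  1345) (.s 245 (.q 2345) (.s 458 (.s 468 (.f 506384) (.s 125 (.f 514293) (.s 124 (.s 256 (.s 246
  (.f 416253) (.f 506284)) (.q 1256)) (.f 415293)))) (.q 3458)))) (.q 1356))) (.q 1346)) (.f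
  615293)) (.f 614293)) (.f 618293))))))))))))))

/-- A part of the tree `refutation`. -/
def refutation₄ : Refutation :=
  .s 378 (.s 137 (.q 1378) (.s 489 (.s 349 (.s 389 (.s 459 (.f 508394) (.s 469 (.f 608394) (.s 479
  (.f 708394) (.s 345 (.s 346 (.s 359 (.s 369 (.s 589 (.s 689 (.s 789 (.s 569 (.f 608395) (.s 579
  (.f 708395) (.s 568 (.q 5689) (.s 679 (.f 708396) (.s 578 (.q 5789) (.s 356 (.s 357 (.s 367 (.s
  256 (.s 236 (.f 506273) (.s 246 (.f 406253) (.s 245 (.q 2456) (.s 257 (.s 457 (.s 467 (.f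
  506374) (.f 506274)) (.q 2457)) (.s 247 (.q 2457) (.f 729485)))))) (.s 235 (.q 2356) (.s 258 (.q
  2568) (.s 246 (.s 238 (.q 2358) (.s 245 (.s 456 (.q 2456) (.s 237 (.q 2378) (.s 247 (.s 257 (.f
  407253) (.s 267 (.f 407263) (.f 726485))) (.s 257 (.q 2457) (.f 729485))))) (.q 2456))) (.f
  629485))))) (.q 3679)) (.q 3579)) (.q 3569))))))) (.q 4789)) (.q 4689)) (.q 4589)) (.q 3689))
  (.q 3589)) (.q 3469)) (.q 3459))))) (.q 3489)) (.q 3489)) (.s 238 (.s 123 (.q 1238) (.s 248 (.s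
  258 (.s 124 (.q 1234) (.s 125 (.q 1235) (.s 349 (.s 389 (.f 408293) (.s 148 (.f 408193) (.s 247
  (.s 237 (.f 407283) (.s 379 (.s 459 (.s 359 (.s 458 (.f 509384) (.q 4589)) (.q 3459)) (.s 345
  (.s 257 (.f 407253) (.s 245 (.s 578 (.s 235 (.f 405283) (.s 359 (.f 709385) (.f 405293))) (.q
  2578)) (.q 2457))) (.q 3459))) (.f 407293))) (.s 147 (.q 1247) (.s 478 (.s 379 (.f 709384) (.s
  347 (.s 479 (.q 3479) (.s 178 (.f 819374) (.s 237 (.q 2347) (.s 457 (.s 357 (.s 458 (.f 507384)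
  (.q 4578)) (.q 3457)) (.s 157 (.q 1457) (.s 257 (.q 2457) (.s 459 (.q 4579) (.s 158 (.q 1578)
  (.s 359 (.s 145 (.s 458 (.q 1458) (.f 938475)) (.f 517294)) (.f 517293)))))))))) (.q 3479))) (.q
  2478)))))) (.s 389 (.q 3489) (.s 689 (.q 3689) (.s 247 (.s 237 (.f 407283) (.s 347 (.s 379 (.q
  3479) (.s 257 (.s 235 (.q 2357) (.s 345 (.f 407253) (.s 359 (.f 507293) (.s 245 (.q 2345) (.f
  415293))))) (.s 359 (.f 729354) (.f 517293)))) (.q 2347))) (.s 478 (.s 237 (.s 234 (.s 257 (.f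
  507283) (.s 267 (.f 607283) (.s 345 (.s 346 (.s 356 (.s 235 (.s 245 (.f 405263) (.q 2345)) (.q
  2345)) (.f 517263)) (.f 417263)) (.f 417253)))) (.q 2347)) (.s 379 (.s 347 (.q 3479) (.s 479 (.s
  178 (.f 708193) (.s 369 (.s 467 (.f 609374) (.s 678 (.f 709386) (.f 937486))) (.s 367 (.q 3679)
  (.s 679 (.s 168 (.f 819376) (.s 678 (.s 468 (.s 146 (.q 1468) (.s 469 (.f 709486) (.s 467 (.q
  4679) (.f 619374)))) (.f 708496)) (.q 3678))) (.q 3679))))) (.q 3479))) (.f 417293))) (.q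
  2478)))))))) (.q 2358)) (.q 2348))) (.s 234 (.q 2348) (.s 235 (.q 2358) (.s 236 (.q 2368) (.s
  237 (.q 2378) (.s 189 (.s 389 (.s 148 (.s 149 (.s 139 (.s 349 (.s 359 (.s 159 (.s 179 (.s 347
  (.s 178 (.f 408173) (.s 147 (.s 789 (.s 579 (.s 589 (.f 708395) (.q 5789)) (.s 157 (.s 357 (.s
  345 (.f 407153) (.s 457 (.s 145 (.q 1345) (.s 158 (.f 508174) (.q 1458))) (.q 3457))) (.q 3579))
  (.q 1579))) (.q 1789)) (.q 1478))) (.s 147 (.q 1347) (.s 247 (.q 2347) (.s 478 (.s 479 (.s 178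
  (.s 128 (.s 129 (.s 248 (.s 278 (.s 124 (.f 418273) (.s 127 (.q 1247) (.s 249 (.s 279 (.s 289
  (.f 408192) (.f 709284)) (.q 1279)) (.q 1249)))) (.q 2478)) (.s 278 (.f 708294) (.s 127 (.s 467
  (.s 146 (.q 1467) (.s 346 (.q 3467) (.s 469 (.s 168 (.s 167 (.f 714263) (.s 678 (.f 709486) (.q
  1678))) (.q 1468)) (.q 4679)))) (.s 167 (.q 1467) (.s 367 (.q 3467) (.s 126 (.s 146 (.s 168 (.s
  346 (.f 408163) (.q 1346)) (.f 816273)) (.f 614273)) (.q 1267))))) (.q 1278)))) (.q 1289)) (.f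
  814273)) (.q 1478)) (.q 3479)) (.q 3478))))) (.q 1379)) (.q 1359)) (.q 3589)) (.q 3489)) (.f
  409183)) (.q 1489)) (.q 1489)) (.q 1389)) (.s 139 (.q 1389) (.s 249 (.s 349 (.s 248 (.s 389 (.s
  359 (.s 459 (.s 259 (.s 589 (.q 4589) (.s 258 (.s 479 (.s 478 (.s 578 (.f 709485) (.s 278 (.s
  357 (.f 508273) (.q 3578)) (.q 2478))) (.q 4789)) (.s 347 (.s 457 (.s 278 (.f 408273) (.f
  508274)) (.q 4579)) (.q 3479))) (.q 2589))) (.q 2459)) (.s 245 (.s 345 (.s 258 (.f 408253) (.s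
  458 (.q 2458) (.s 569 (.s 589 (.f 608395) (.s 468 (.f 608495) (.s 289 (.q 2589) (.s 568 (.s 268
  (.f 608295) (.s 246 (.s 346 (.s 148 (.s 128 (.s 158 (.f 408153) (.f 815243)) (.f 408192)) (.s
  158 (.q 1458) (.s 156 (.q 1568) (.s 347 (.s 357 (.s 367 (.s 278 (.f 408273) (.s 579 (.f 607395)
  (.s 247 (.s 457 (.s 257 (.f 407253) (.q 2457)) (.f 827495)) (.q 2478)))) (.f 406273)) (.f
  405273)) (.s 247 (.q 2347) (.s 357 (.q 3457) (.s 367 (.q 3467) (.s 278 (.s 126 (.f 615273) (.f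
  618273)) (.q 2478))))))))) (.q 3468)) (.q 2468))) (.q 5689))))) (.s 356 (.s 469 (.q 4569) (.s
  346 (.s 246 (.s 268 (.f 408263) (.s 256 (.f 406253) (.s 456 (.q 2456) (.s 259 (.q 2569) (.s 589
  (.s 568 (.q 5689) (.s 579 (.f 708395) (.s 279 (.q 2579) (.s 578 (.q 5789) (.s 247 (.s 257 (.f
  407253) (.s 267 (.f 407263) (.f 726485))) (.q 2479)))))) (.f 826495)))))) (.q 2469)) (.q 3456)))
  (.q 3569))))) (.q 3459)) (.q 2459))) (.q 3589)) (.f 408293)) (.q 2489)) (.q 2349)) (.s 149 (.s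
  129 (.s 148 (.s 159 (.s 345 (.f 409153) (.s 458 (.f 509184) (.f 915384))) (.s 145 (.s 245 (.f
  409152) (.s 458 (.s 345 (.s 158 (.f 408153) (.q 1458)) (.q 1345)) (.f 915284))) (.q 1459))) (.q
  1489)) (.q 1249)) refutation₃))))))))))) (.s 347 (.s 478 (.q 3478) (.s 357 (.s 578 (.q 3578) (.s
  367 (.s 457 (.f 508374) (.s 467 (.f 608374) (.s 567 (.f 608375) (.s 345 (.s 346 (.s 458 (.q
  4578) (.s 356 (.s 568 (.q 5678) (.s 256 (.s 236 (.f 506273) (.s 246 (.f 406253) (.s 245 (.q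
  2456) (.s 456 (.s 247 (.q 2467) (.s 258 (.q 2458) (.s 278 (.q 2478) (.s 469 (.s 459 (.f 506394)
  (.q 4569)) (.s 569 (.q 4569) (.s 167 (.s 146 (.s 156 (.f 406153) (.q 1567)) (.q 1467)) (.s 137
  (.q 1367) (.s 147 (.f 407183) (.s 157 (.f 507183) (.s 127 (.f 715284) (.s 589 (.s 579 (.f
  839576) (.f 718395)) (.s 579 (.q 5789) (.f 718295))))))))))))) (.q 2456))))) (.s 235 (.q 2356)
  (.s 257 (.q 2567) (.s 258 (.q 2568) (.s 246 (.s 237 (.q 2357) (.s 278 (.q 2578) (.s 245 (.s 247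
  (.f 407283) (.s 569 (.s 579 (.f 607395) (.q 5679)) (.s 124 (.s 126 (.s 146 (.s 156 (.f 406153)
  (.f 406152)) (.q 1246)) (.q 1246)) (.s 127 (.q 1247) (.s 137 (.q 1237) (.s 157 (.q 1257) (.s 589
  (.s 579 (.f 839576) (.f 718395)) (.s 579 (.q 5789) (.f 718295))))))))) (.q 2456)))) (.f
  627485))))))) (.q 3567))) (.q 3467)) (.q 3457))))) (.q 3678))) (.q 3578))) (.q 3478))

/-- A part of the tree `refutation`. -/
def refutation₅ : Refutation :=
  .s 259 (.s 127 (.s 157 (.f 507192) (.s 167 (.f 607192) (.s 125 (.s 126 (.s 156 (.f 506192) (.s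
  249 (.s 145 (.f 405192) (.s 135 (.s 239 (.f 305192) (.f 519243)) (.s 123 (.s 235 (.q 1235) (.s
  136 (.q 1356) (.f 615283))) (.q 1235)))) (.s 467 (.f 609274) (.s 146 (.f 619254) (.f 619274)))))
  (.q 1267)) (.q 1257)))) (.s 249 (.s 126 (.s 146 (.f 406192) (.s 156 (.f 506192) (.s 124 (.s 125
  (.s 145 (.f 405192) (.s 239 (.s 134 (.f 304192) (.s 135 (.f 305192) (.s 123 (.s 234 (.q 1234)
  (.f 514283)) (.q 1234)))) (.s 356 (.f 509263) (.s 135 (.f 519243) (.f 519263))))) (.q 1256)) (.q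
  1246)))) (.s 125 (.s 156 (.q 1256) (.s 256 (.q 1256) (.s 157 (.q 1257) (.s 129 (.s 159 (.s 145
  (.f 405192) (.s 146 (.q 1456) (.s 569 (.s 147 (.q 1457) (.s 579 (.s 149 (.s 124 (.s 246 (.q
  1246) (.s 469 (.s 479 (.s 123 (.s 136 (.q 1236) (.s 236 (.q 1236) (.s 237 (.q 1237) (.s 267 (.s
  367 (.s 467 (.s 567 (.s 239 (.s 347 (.f 607394) (.s 357 (.f 607395) (.s 457 (.f 607495) (.s 456
  (.q 4567) (.s 135 (.f 305192) (.f 517364)))))) (.f 609273)) (.q 2567)) (.q 2467)) (.q 2367)) (.f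
  617283))))) (.s 134 (.s 239 (.f 304192) (.q 1239)) (.q 1234))) (.q 1479)) (.q 1469))) (.q 1245))
  (.q 1249)) (.q 1579))) (.q 1569)))) (.q 1259)) (.q 1259))))) (.s 236 (.s 123 (.q 1236) (.s 239
  (.s 256 (.s 568 (.q 2568) (.s 137 (.s 237 (.s 167 (.f 307162) (.s 136 (.s 267 (.s 257 (.s 578
  (.q 2578) (.s 356 (.s 156 (.s 157 (.f 507163) (.s 235 (.f 306152) (.s 135 (.q 1235) (.q 1357))))
  (.q 1356)) (.s 235 (.s 157 (.f 307152) (.f 716385)) (.q 2356)))) (.q 2567)) (.f 306172)) (.q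
  1367))) (.q 1237)) (.s 367 (.s 136 (.q 1367) (.s 678 (.q 3678) (.s 357 (.f 506273) (.s 578 (.q
  5678) (.s 157 (.q 1357) (.s 356 (.q 3567) (.s 567 (.s 156 (.q 1567) (.s 359 (.s 369 (.f 506293)
  (.q 3569)) (.s 369 (.s 379 (.f 629375) (.f 719385)) (.f 619385)))) (.q 3567)))))))) (.s 167 (.q
  1367) (.s 379 (.s 359 (.s 369 (.f 506293) (.s 356 (.s 569 (.q 3569) (.s 678 (.f 709386) (.s 567
  (.q 3567) (.s 578 (.q 5678) (.s 345 (.s 346 (.s 349 (.s 246 (.s 467 (.q 3467) (.s 469 (.q 3469)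
  (.s 456 (.f 509364) (.s 245 (.s 457 (.q 4567) (.s 579 (.s 459 (.q 4569) (.s 479 (.f 947586) (.s
  235 (.f 405263) (.s 357 (.f 739586) (.s 347 (.f 405273) (.f 739485)))))) (.f 749586))) (.q
  2456))))) (.q 2346)) (.q 3459)) (.q 3456)) (.s 456 (.s 349 (.f 509364) (.s 457 (.f 509374) (.s
  467 (.f 937465) (.f 937486)))) (.q 3456))))))) (.q 3569))) (.s 235 (.s 357 (.q 3579) (.s 578 (.f
  709385) (.s 349 (.s 345 (.s 245 (.s 246 (.s 369 (.f 406293) (.s 346 (.s 456 (.s 356 (.f 405263)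
  (.q 3456)) (.f 936485)) (.q 3469))) (.q 2456)) (.q 2345)) (.q 3459)) (.s 347 (.q 3479) (.s 479
  (.s 478 (.f 709384) (.s 457 (.s 458 (.f 938475) (.s 147 (.q 1347) (.s 345 (.q 3457) (.s 459 (.s
  145 (.q 1457) (.s 135 (.s 134 (.s 124 (.f 304192) (.s 245 (.s 247 (.s 257 (.f 507294) (.q 2457))
  (.q 2457)) (.f 304152))) (.q 1345)) (.f 517384))) (.q 4579))))) (.f 937485))) (.q 3479)))))) (.q
  2359))) (.s 237 (.s 369 (.q 3679) (.s 678 (.s 267 (.q 2678) (.s 679 (.s 136 (.f 306172) (.s 347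
  (.s 247 (.s 346 (.f 407263) (.q 3467)) (.q 2347)) (.s 147 (.q 1347) (.s 349 (.q 3479) (.s 478
  (.s 247 (.q 2478) (.s 468 (.f 708496) (.s 146 (.f 617243) (.f 619384)))) (.f 719384)))))) (.q
  6789))) (.f 719386))) (.q 2379))))))) (.s 156 (.q 1256) (.s 235 (.s 356 (.q 2356) (.s 569 (.s
  135 (.f 305162) (.s 136 (.q 1356) (.s 257 (.s 237 (.s 567 (.s 359 (.s 369 (.s 379 (.f 507293)
  (.f 609375)) (.q 3569)) (.s 139 (.q 1359) (.s 369 (.f 516293) (.s 568 (.s 169 (.q 1369) (.s 469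
  (.s 146 (.q 1469) (.s 149 (.q 1469) (.s 349 (.q 3469) (.s 459 (.s 468 (.s 145 (.q 1459) (.s 458
  (.f 608495) (.f 519384))) (.f 619384)) (.f 609485))))) (.s 246 (.s 456 (.q 4569) (.s 459 (.q
  4569) (.s 145 (.f 405162) (.s 345 (.f 406253) (.s 346 (.q 3456) (.f 516394)))))) (.q 2469))))
  (.f 619385))))) (.q 2567)) (.q 2357)) (.s 579 (.s 237 (.s 267 (.s 567 (.s 467 (.s 457 (.f
  607495) (.s 456 (.q 4567) (.s 246 (.s 145 (.f 405162) (.f 516274)) (.s 145 (.f 516243) (.s 247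
  (.s 124 (.q 1247) (.s 345 (.f 407253) (.s 134 (.f 304162) (.f 416253)))) (.f 517264)))))) (.s
  246 (.s 456 (.q 4567) (.s 457 (.q 4567) (.s 145 (.f 405162) (.s 345 (.f 406253) (.s 346 (.q
  3456) (.f 516374)))))) (.q 2467))) (.q 2567)) (.f 517263)) (.f 517283)) (.q 2579))))) (.q
  2569))) (.q 2356)))) (.q 2369))) (.s 136 (.q 1236) (.s 369 (.s 256 (.s 235 (.q 2356) (.s 356 (.s
  135 (.q 1235) (.s 359 (.s 156 (.f 615283) (.s 346 (.s 134 (.q 1346) (.s 234 (.q 2346) (.s 349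
  (.s 146 (.f 614283) (.s 345 (.s 246 (.f 406253) (.s 245 (.q 2456) (.s 469 (.s 459 (.f 506394)
  (.q 2459)) (.q 2469)))) (.s 245 (.q 2345) (.s 459 (.s 124 (.s 469 (.f 506394) (.s 149 (.q 1469)
  (.q 1249))) (.f 415283)) (.q 3459))))) (.q 3469)))) (.s 246 (.q 2346) (.s 345 (.q 3456) (.s 456
  (.s 469 (.s 245 (.q 2456) (.s 459 (.s 257 (.s 357 (.s 457 (.s 367 (.s 347 (.s 479 (.f 507394)
  (.s 579 (.q 4579) (.s 678 (.q 3678) (.s 567 (.f 609475) (.s 569 (.q 5679) (.s 157 (.q 1567) (.s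
  167 (.q 1567) (.f 719586)))))))) (.f 507364)) (.f 506273)) (.q 2457)) (.q 2357)) (.s 237 (.q
  2357) (.f 517283))) (.q 3459))) (.q 3469)) (.q 3456)))))) (.q 2359))) (.q 2356))) (.s 569 (.s
  135 (.s 123 (.q 1235) (.s 235 (.s 239 (.s 237 (.s 267 (.s 367 (.s 257 (.s 579 (.f 607295) (.s
  357 (.s 137 (.s 157 (.f 307152) (.q 1357)) (.q 1357)) (.f 607395))) (.f 305172)) (.q 2367)) (.q
  2367)) (.s 257 (.q 2357) (.s 267 (.s 134 (.s 234 (.s 124 (.f 304192) (.s 246 (.q 2346) (.s 247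
  (.q 2347) (.s 145 (.f 305142) (.s 245 (.s 456 (.q 2456) (.f 517264)) (.f 304152)))))) (.q 1234))
  (.s 124 (.q 1234) (.s 145 (.s 246 (.f 405162) (.f 416283)) (.q 1345)))) (.f 617283)))) (.q
  2359)) (.q 1235))) (.f 516283)) (.q 2569))) (.q 2369)))))) (.s 245 (.q 2459) (.s 246 (.q 2469)
  (.s 247 (.q 2479) (.s 457 (.f 509274) (.s 467 (.f 609274) (.s 468 (.f 609284) (.s 478 (.f
  709284) (.s 267 (.q 2467) (.s 126 (.s 156 (.f 506192) (.s 146 (.f 619254) (.f 615274))) (.s 146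
  (.q 1246) (.f 617284))))))))))))) (.s 256 (.q 2569) (.s 569 (.s 257 (.q 2579) (.s 567 (.f
  609275) (.s 568 (.f 609285) (.s 578 (.f 709285) (.s 267 (.q 2567) (.s 156 (.s 126 (.s 159 (.s
  459 (.s 249 (.q 2459) (.s 469 (.s 146 (.f 506194) (.s 467 (.f 609274) (.f 619274))) (.q 4569)))
  (.s 145 (.s 456 (.q 4569) (.s 146 (.s 249 (.f 406192) (.f 926475)) (.q 1456))) (.q 1459))) (.q
  1569)) (.q 1256)) (.s 126 (.f 619275) (.f 617285)))))))) (.q 2569)))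

/-- A part of the tree `refutation`. -/
def refutation₆ : Refutation :=
  .s 679 (.s 267 (.q 2679) (.s 467 (.q 4679) (.s 469 (.q 4679) (.s 567 (.q 5679) (.s 568 (.q 5678)
  (.s 379 (.s 237 (.q 2379) (.s 347 (.s 349 (.s 357 (.s 234 (.q 2347) (.s 235 (.q 2357) (.s 346
  (.s 149 (.s 147 (.s 137 (.f 407193) (.s 127 (.s 167 (.f 407163) (.s 236 (.s 246 (.f 407162) (.f
  716243)) (.f 716283))) (.f 714283))) (.q 1479)) (.s 139 (.q 1349) (.s 169 (.q 1469) (.s 137 (.q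
  1379) (.s 167 (.q 1679) (.s 127 (.s 147 (.s 236 (.s 246 (.f 407162) (.f 716243)) (.f 716283))
  (.f 714283)) (.s 147 (.f 714283) (.s 157 (.f 715283) (.s 459 (.s 678 (.s 456 (.s 367 (.q 3678)
  (.f 507364)) (.q 4569)) (.f 719486)) (.f 719485)))))))))) (.q 3467)))) (.q 3579)) (.q 3479)) (.q
  3479))) (.s 367 (.q 3679) (.s 357 (.s 356 (.s 345 (.s 347 (.s 456 (.f 507364) (.s 457 (.q 4567)
  (.s 459 (.q 4569) (.s 257 (.s 247 (.s 237 (.f 507263) (.f 407253)) (.q 2457)) (.s 247 (.f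
  726485) (.f 729485)))))) (.q 3457)) (.s 456 (.s 347 (.f 507364) (.s 349 (.q 3479) (.s 237 (.s
  257 (.f 507263) (.q 2357)) (.s 247 (.q 2347) (.f 729384))))) (.q 3456))) (.q 3567)) (.s 359 (.q
  3579) (.s 459 (.s 345 (.q 3459) (.s 456 (.s 457 (.s 347 (.q 3457) (.s 458 (.f 738495) (.s 257
  (.s 247 (.f 507264) (.f 507294)) (.s 247 (.q 2457) (.s 237 (.f 725384) (.f 729385)))))) (.q
  4579)) (.q 4569))) (.s 458 (.q 4589) (.s 347 (.s 345 (.s 457 (.q 3457) (.s 346 (.s 456 (.s 356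
  (.s 349 (.f 937485) (.s 245 (.s 235 (.f 405263) (.f 405273)) (.s 235 (.q 2345) (.f 529384))))
  (.q 3456)) (.f 736485)) (.q 3467))) (.q 3457)) (.f 739485))))))))))))) (.s 678 (.q 6789) (.s 369
  (.s 367 (.s 359 (.s 357 (.s 237 (.s 379 (.q 2379) (.s 567 (.f 609375) (.s 569 (.q 5679) (.s 457
  (.s 456 (.s 349 (.f 509374) (.f 509364)) (.q 4567)) (.s 467 (.q 4567) (.f 749586)))))) (.s 235
  (.q 2357) (.s 236 (.q 2367) (.s 125 (.s 123 (.s 159 (.s 129 (.s 157 (.s 127 (.s 379 (.s 347 (.s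
  137 (.f 507193) (.s 234 (.q 2347) (.s 135 (.q 1357) (.s 147 (.s 145 (.s 345 (.f 407153) (.q
  1345)) (.f 514283)) (.f 714283))))) (.q 3479)) (.s 257 (.f 507293) (.s 267 (.f 607293) (.s 567
  (.f 609375) (.s 569 (.q 5679) (.f 729586)))))) (.q 1279)) (.q 1579)) (.q 1259)) (.s 135 (.q
  1359) (.s 256 (.f 516283) (.s 257 (.f 517283) (.s 145 (.s 134 (.q 1345) (.s 459 (.q 1459) (.s
  234 (.q 1234) (.s 247 (.s 245 (.s 124 (.f 417283) (.s 456 (.q 2456) (.s 246 (.s 346 (.s 356 (.s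
  267 (.f 407263) (.s 568 (.q 3568) (.f 726485))) (.f 405163)) (.q 2346)) (.f 416283)))) (.q
  2457)) (.f 729485))))) (.s 124 (.s 245 (.q 1245) (.s 149 (.q 1459) (.s 234 (.s 134 (.s 247 (.q
  2457) (.s 349 (.q 1349) (.s 379 (.q 3479) (.f 729384)))) (.q 1234)) (.f 514283)))) (.q
  1245))))))) (.q 1235)) (.s 135 (.q 1235) (.s 256 (.s 257 (.s 356 (.s 267 (.f 507263) (.s 379 (.s
  567 (.q 2567) (.s 569 (.q 5679) (.s 157 (.s 137 (.f 507193) (.s 127 (.s 167 (.f 507163) (.f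
  716253)) (.f 715283))) (.s 167 (.q 1567) (.f 719586))))) (.f 507293))) (.q 2356)) (.f 517283))
  (.f 516283))))))) (.q 3579)) (.s 356 (.q 3569) (.s 379 (.q 3579) (.s 568 (.f 609385) (.s 567 (.s
  345 (.s 456 (.q 3456) (.s 349 (.s 467 (.f 609374) (.s 457 (.f 937465) (.f 937485))) (.f
  936485))) (.s 346 (.q 3456) (.s 349 (.q 3459) (.s 469 (.s 456 (.s 459 (.f 609475) (.q 4569)) (.f
  936485)) (.q 3469))))) (.q 3567)))))) (.q 3679)) (.s 379 (.q 3679) (.s 167 (.s 157 (.s 147 (.s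
  349 (.s 346 (.s 347 (.s 467 (.s 359 (.s 457 (.f 509374) (.f 937465)) (.s 345 (.s 457 (.s 357 (.s
  356 (.f 506374) (.s 456 (.q 3456) (.s 235 (.s 245 (.f 405273) (.q 2345)) (.s 245 (.f 405263) (.f
  529364))))) (.q 3457)) (.f 937485)) (.q 3459))) (.f 937486)) (.q 3479)) (.q 3469)) (.s 237 (.s
  136 (.s 267 (.s 126 (.f 306172) (.s 236 (.s 156 (.s 125 (.q 1256) (.s 256 (.s 235 (.f 306152)
  (.s 356 (.s 357 (.s 367 (.f 506173) (.s 567 (.q 3567) (.s 359 (.f 937586) (.s 245 (.s 146 (.f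
  406152) (.f 615243)) (.s 456 (.s 458 (.s 347 (.f 507364) (.f 507384)) (.f 529384)) (.q
  2456)))))) (.q 2357)) (.q 2356))) (.q 1256))) (.s 135 (.s 567 (.s 569 (.s 257 (.s 125 (.f
  305172) (.s 256 (.s 259 (.s 269 (.f 609275) (.q 2569)) (.q 2569)) (.f 305162))) (.f 607295)) (.s
  159 (.q 1569) (.s 568 (.q 5689) (.s 459 (.s 145 (.q 1459) (.s 345 (.q 3459) (.s 469 (.f 609475)
  (.s 146 (.q 1456) (.s 468 (.q 4689) (.s 458 (.f 618495) (.f 615384))))))) (.s 469 (.q 4569) (.s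
  146 (.s 234 (.f 306142) (.s 345 (.f 406153) (.f 614253))) (.f 619485))))))) (.q 1567)) (.q
  1356))) (.q 1236))) (.s 236 (.s 367 (.q 2367) (.s 269 (.q 2679) (.s 357 (.s 257 (.s 356 (.f
  507263) (.q 3567)) (.q 2357)) (.s 359 (.q 3579) (.s 568 (.f 738596) (.s 569 (.s 356 (.q 3569)
  (.s 257 (.s 256 (.q 2569) (.q 2567)) (.f 726385))) (.f 739586))))))) (.q 2367))) (.s 367 (.s 267
  (.s 356 (.s 357 (.s 568 (.q 3568) (.s 257 (.s 156 (.s 126 (.f 506172) (.s 235 (.s 256 (.s 236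
  (.f 506273) (.q 2356)) (.q 1256)) (.f 615283))) (.s 359 (.s 458 (.f 509384) (.s 146 (.f 619354)
  (.s 468 (.f 938465) (.f 619384)))) (.f 619385))) (.q 2357))) (.q 3567)) (.s 156 (.q 1356) (.s
  567 (.s 359 (.q 3569) (.s 568 (.s 569 (.s 357 (.s 459 (.s 469 (.f 609475) (.q 4569)) (.s 469 (.f
  609485) (.s 468 (.q 4689) (.s 146 (.s 134 (.q 1346) (.s 346 (.s 145 (.s 347 (.s 135 (.f 405173)
  (.f 405163)) (.q 1347)) (.q 1456)) (.q 1346))) (.f 619384))))) (.f 607385)) (.q 5689)) (.f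
  619385))) (.q 3567)))) (.q 2367)) (.q 1367))) (.s 247 (.s 267 (.s 234 (.q 2347) (.s 346 (.f
  407263) (.s 236 (.q 2367) (.s 246 (.q 2346) (.s 468 (.s 469 (.s 568 (.s 567 (.s 459 (.f 609475)
  (.f 609485)) (.q 5678)) (.s 458 (.s 567 (.f 608475) (.f 847596)) (.q 4568))) (.q 4689)) (.f
  629384)))))) (.f 729386)) (.f 729384)))) (.s 145 (.q 1457) (.s 146 (.q 1467) (.s 456 (.f 507164)
  (.s 458 (.f 507184) (.s 459 (.f 507194) (.s 468 (.f 607184) (.s 469 (.f 607194) (.s 156 (.q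
  1456) (.s 169 (.q 1469) (.s 568 (.s 356 (.q 3568) (.s 359 (.q 3569) (.s 136 (.s 134 (.s 345 (.q
  1345) (.f 615384)) (.q 1346)) (.s 139 (.q 1369) (.s 349 (.s 134 (.q 1349) (.s 135 (.q 1345) (.f
  519364))) (.f 619384)))))) (.f 619485)))))))))))) (.s 156 (.q 1567) (.s 568 (.f 607185) (.s 569
  (.f 607195) (.s 256 (.s 125 (.q 1256) (.s 126 (.q 1256) (.s 127 (.q 1257) (.s 128 (.q 1258) (.s
  269 (.f 607192) (.s 259 (.f 719265) (.s 289 (.f 719285) (.s 189 (.q 1289) (.s 139 (.q 1389) (.s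
  359 (.s 135 (.q 1359) (.s 137 (.q 1357) (.f 719365))) (.s 136 (.s 137 (.s 123 (.q 1236) (.s 236
  (.f 307162) (.q 1236))) (.f 719385)) (.f 619385)))))))))))) (.s 127 (.s 257 (.q 1257) (.s 267
  (.s 137 (.s 135 (.s 357 (.q 1357) (.s 235 (.f 307152) (.s 356 (.q 1356) (.s 237 (.q 2357) (.f
  726385))))) (.q 1357)) (.s 235 (.s 359 (.f 715293) (.f 719385)) (.f 715283))) (.f 729586))) (.f
  716285))))))) (.s 137 (.s 136 (.s 267 (.s 126 (.q 1267) (.s 127 (.q 1267) (.s 123 (.q 1236) (.s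
  239 (.f 307192) (.s 139 (.q 1239) (.s 157 (.s 235 (.f 307152) (.s 356 (.f 507163) (.f 715263)))
  (.s 135 (.s 568 (.f 718596) (.s 569 (.s 359 (.q 1359) (.s 356 (.q 3569) (.f 716385))) (.f
  719586))) (.q 1357)))))))) (.s 269 (.q 2679) (.s 237 (.s 236 (.s 126 (.s 127 (.f 307162) (.s 289
  (.f 719286) (.s 249 (.q 2489) (.s 246 (.s 469 (.q 2469) (.s 147 (.s 234 (.f 307142) (.s 346 (.f
  407163) (.f 714263))) (.f 719486))) (.s 124 (.s 234 (.s 346 (.q 2346) (.s 247 (.q 2467) (.s 147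
  (.q 1247) (.s 468 (.f 728496) (.f 716384))))) (.q 2346)) (.q 1246)))))) (.f 306172)) (.q 2367))
  (.f 729386)))) (.q 1367)) (.f 719386))))))

/-- A part of the tree `refutation`. -/
def refutation₇ : Refutation :=
  .s 479 (.s 247 (.q 2479) (.s 249 (.q 2479) (.s 469 (.s 246 (.q 2469) (.s 147 (.s 124 (.s 127 (.s
  478 (.q 1478) (.s 167 (.f 607194) (.s 146 (.s 467 (.q 1467) (.s 468 (.q 1468) (.s 234 (.s 134
  (.s 346 (.q 2346) (.s 347 (.q 2347) (.s 137 (.s 367 (.q 3467) (.s 236 (.f 307162) (.f 627384)))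
  (.q 1347)))) (.q 1234)) (.s 236 (.q 2346) (.s 137 (.s 367 (.q 1367) (.s 346 (.f 407163) (.s 347
  (.q 3467) (.f 627384)))) (.f 716283)))))) (.q 1467)))) (.q 1247)) (.q 1247)) (.s 349 (.s 234 (.q
  2349) (.s 369 (.s 379 (.s 236 (.q 2346) (.s 237 (.q 2347) (.s 134 (.s 123 (.s 139 (.s 129 (.s
  127 (.s 137 (.s 167 (.f 607193) (.s 346 (.s 136 (.s 146 (.f 406193) (.q 1346)) (.q 1367)) (.f
  714263))) (.f 714283)) (.q 1279)) (.q 1239)) (.q 1349)) (.q 1234)) (.s 137 (.q 1347) (.s 124 (.s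
  127 (.f 714283) (.s 167 (.f 716283) (.s 129 (.q 1279) (.s 179 (.q 1279) (.s 169 (.q 1679) (.s
  149 (.q 1249) (.s 136 (.q 1369) (.s 146 (.q 1469) (.s 126 (.f 614283) (.s 267 (.s 467 (.s 145
  (.s 456 (.q 1456) (.s 459 (.q 1459) (.s 567 (.f 609475) (.q 4567)))) (.s 245 (.q 1245) (.s 135
  (.q 1345) (.s 125 (.f 514283) (.s 235 (.q 2345) (.s 256 (.s 257 (.s 356 (.f 507263) (.q 2356))
  (.f 517283)) (.f 516283))))))) (.q 2467)) (.f 617283))))))))))) (.f 416283)))))) (.q 3479)) (.q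
  3469))) (.s 346 (.q 3469) (.s 347 (.q 3479) (.s 579 (.s 257 (.q 2579) (.s 259 (.q 2579) (.s 267
  (.s 467 (.s 256 (.q 2567) (.s 567 (.s 679 (.q 2679) (.s 569 (.s 459 (.s 457 (.f 607495) (.s 245
  (.q 2459) (.s 345 (.q 3459) (.s 157 (.q 1457) (.s 357 (.q 3457) (.s 456 (.q 4567) (.s 237 (.f
  725364) (.s 156 (.q 1567) (.s 367 (.s 235 (.s 234 (.s 159 (.s 129 (.s 169 (.s 127 (.s 167 (.f
  715264) (.q 1679)) (.q 1279)) (.q 1569)) (.q 1259)) (.s 145 (.q 1459) (.s 125 (.s 135 (.f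
  305142) (.f 517364)) (.f 517264)))) (.q 2345)) (.f 527364)) (.q 2367)))))))))) (.f 609475)) (.q
  5679))) (.q 2567))) (.q 2467)) (.s 478 (.s 379 (.f 709384) (.s 458 (.f 708495) (.s 457 (.q 4578)
  (.s 578 (.s 459 (.s 345 (.q 3459) (.s 467 (.s 456 (.q 4567) (.s 567 (.s 468 (.f 608475) (.q
  4678)) (.q 4567))) (.s 367 (.q 3467) (.s 678 (.s 679 (.s 369 (.q 3679) (.s 569 (.s 468 (.f
  708496) (.s 236 (.s 256 (.q 2569) (.f 625384)) (.f 629384))) (.f 709586))) (.q 4679)) (.q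
  4678))))) (.f 709485)) (.q 4578))))) (.s 468 (.s 146 (.q 1468) (.s 678 (.q 4678) (.s 167 (.f
  607184) (.s 369 (.f 609384) (.s 379 (.f 938476) (.s 137 (.s 237 (.s 136 (.s 234 (.s 126 (.f
  306142) (.f 306172)) (.q 2347)) (.q 1367)) (.f 729386)) (.f 719386))))))) (.s 237 (.f 726384)
  (.s 379 (.s 137 (.f 719384) (.s 167 (.f 716384) (.s 127 (.f 716284) (.s 129 (.q 1279) (.s 149
  (.q 1249) (.s 146 (.q 1469) (.s 126 (.s 367 (.s 467 (.s 369 (.f 609374) (.q 3679)) (.q 3467))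
  (.s 136 (.s 236 (.s 234 (.f 306142) (.q 2346)) (.f 627384)) (.f 617384))) (.f 617284)))))))) (.f
  729384)))))))) (.s 457 (.s 578 (.q 5789) (.s 145 (.q 1457) (.s 245 (.q 2457) (.s 345 (.q 3457)
  (.s 458 (.s 359 (.f 509384) (.s 379 (.q 3579) (.s 137 (.s 134 (.s 237 (.s 234 (.s 124 (.s 127
  (.f 307142) (.s 123 (.q 1237) (.s 129 (.q 1279) (.s 239 (.f 307192) (.s 149 (.q 1249) (.s 259
  (.q 2359) (.s 146 (.q 1469) (.s 167 (.s 236 (.f 307162) (.s 568 (.s 468 (.s 569 (.f 608495) (.q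
  5689)) (.q 4568)) (.s 456 (.s 157 (.f 507164) (.s 256 (.f 716253) (.f 716285))) (.q 4568)))) (.s
  136 (.s 236 (.s 126 (.f 306142) (.s 267 (.s 678 (.q 2678) (.s 157 (.s 235 (.f 307152) (.s 356
  (.f 507163) (.f 715263))) (.s 135 (.s 569 (.s 125 (.f 305142) (.s 256 (.q 2569) (.f 305162)))
  (.f 719586)) (.q 1357)))) (.f 306172))) (.q 1236)) (.q 1367)))))))))) (.f 304172)) (.q 2347))
  (.s 127 (.s 257 (.s 157 (.s 234 (.f 307142) (.s 167 (.s 235 (.q 2357) (.s 456 (.f 507164) (.s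
  678 (.q 1678) (.s 369 (.f 529364) (.s 267 (.f 725364) (.f 729386)))))) (.f 714263))) (.q 1257))
  (.f 729385)) (.q 1237))) (.q 1347)) (.s 478 (.s 157 (.s 135 (.q 1357) (.s 357 (.s 367 (.s 467
  (.s 456 (.f 507364) (.s 567 (.s 167 (.f 715364) (.q 1567)) (.q 4567))) (.q 3467)) (.s 167 (.q
  1367) (.s 356 (.s 369 (.q 3679) (.s 678 (.s 468 (.s 679 (.f 708496) (.q 6789)) (.f 506384)) (.f
  719386))) (.q 3567)))) (.q 1357))) (.f 719385)) (.f 719384))))) (.s 478 (.q 4578) (.s 127 (.s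
  157 (.s 137 (.s 234 (.f 307142) (.s 379 (.f 714293) (.s 237 (.q 2347) (.f 729384)))) (.f
  715384)) (.f 715284)) (.s 157 (.f 715284) (.s 137 (.f 715384) (.s 379 (.s 359 (.f 509374) (.q
  3579)) (.f 719384))))))))))) (.q 4579)))))))) (.s 269 (.q 2469) (.s 467 (.q 4679) (.s 679 (.s
  468 (.q 4689) (.s 678 (.f 709486) (.s 267 (.q 2679) (.s 478 (.q 4678) (.s 456 (.s 567 (.q 4567)
  (.s 569 (.q 4569) (.s 459 (.s 245 (.q 2459) (.s 157 (.s 156 (.s 147 (.f 507194) (.s 146 (.s 167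
  (.q 1467) (.s 458 (.f 507184) (.s 127 (.s 246 (.s 256 (.f 507162) (.f 716254)) (.f 716284)) (.f
  715284)))) (.f 506194))) (.q 1567)) (.s 167 (.q 1567) (.s 579 (.s 147 (.f 719486) (.s 257 (.q
  2579) (.s 457 (.f 749586) (.s 458 (.q 4578) (.s 127 (.f 715284) (.s 129 (.q 1279) (.s 149 (.q
  1249) (.s 145 (.q 1459) (.s 125 (.s 345 (.s 135 (.q 1345) (.s 234 (.q 2345) (.f 514283))) (.s
  347 (.q 3457) (.s 357 (.q 3457) (.s 135 (.s 235 (.s 234 (.f 305142) (.q 2345)) (.f 527384)) (.f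
  517384))))) (.f 517284)))))))))) (.f 719586))))) (.f 947586)))) (.s 457 (.q 4567) (.s 459 (.q
  4569) (.s 257 (.q 2457) (.s 579 (.s 259 (.q 2459) (.s 578 (.f 709485) (.s 567 (.s 568 (.f
  948576) (.s 256 (.q 2567) (.s 569 (.s 246 (.s 245 (.s 129 (.s 124 (.s 126 (.s 146 (.s 156 (.s
  157 (.s 167 (.f 607195) (.q 1567)) (.q 1567)) (.f 406152)) (.q 1246)) (.q 1269)) (.q 1249)) (.s
  159 (.q 1259) (.s 156 (.q 1569) (.s 126 (.s 146 (.f 406152) (.f 617485)) (.f 617285))))) (.q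
  2456)) (.f 627485)) (.q 5679)))) (.f 947586)))) (.q 4579)))))))))) (.q 4679))))))) (.s 478 (.q
  4789) (.s 579 (.s 257 (.q 2579) (.s 259 (.q 2579) (.s 457 (.q 4579) (.s 459 (.q 4579) (.s 458
  (.q 4578) (.s 569 (.s 456 (.q 4569) (.s 179 (.s 127 (.s 147 (.s 149 (.s 349 (.s 345 (.s 347 (.s
  167 (.s 157 (.f 607195) (.s 245 (.f 407152) (.s 137 (.f 407153) (.s 235 (.f 715243) (.f
  715283))))) (.s 146 (.s 467 (.q 1467) (.s 246 (.f 407162) (.s 346 (.s 236 (.q 2346) (.s 137 (.f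
  407163) (.f 716283))) (.q 3467)))) (.q 1467))) (.q 3479)) (.q 3459)) (.s 134 (.s 359 (.q 3459)
  (.s 137 (.s 167 (.s 157 (.f 607195) (.s 235 (.f 307152) (.s 245 (.f 407152) (.f 529384)))) (.s
  136 (.s 367 (.q 1367) (.s 146 (.s 236 (.f 307162) (.s 246 (.f 407162) (.s 346 (.f 407163) (.s
  347 (.q 3467) (.s 468 (.q 1468) (.f 627384)))))) (.q 1467))) (.q 1367))) (.q 1347))) (.q 1349)))
  (.q 1479)) (.q 1479)) (.q 1279)) (.s 157 (.q 1579) (.s 159 (.q 1579) (.s 156 (.q 1569) (.s 379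
  (.s 137 (.q 1379) (.s 139 (.q 1379) (.s 237 (.q 2379) (.s 347 (.s 234 (.q 2347) (.s 135 (.s 359
  (.q 1359) (.s 578 (.f 709385) (.s 147 (.s 247 (.s 127 (.s 245 (.f 407152) (.q 2457)) (.f
  714283)) (.f 729485)) (.f 719485)))) (.s 136 (.q 1356) (.s 125 (.s 123 (.s 235 (.q 1235) (.s 145
  (.s 236 (.q 1236) (.s 126 (.f 615283) (.s 357 (.s 267 (.s 367 (.f 607395) (.q 2367)) (.f
  617283)) (.f 405173)))) (.f 514283))) (.q 1235)) (.f 517283))))) (.q 3479))))) (.s 357 (.q 3579)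
  (.s 359 (.q 3579) (.s 347 (.s 345 (.s 147 (.s 137 (.f 407153) (.s 349 (.f 407193) (.s 235 (.s
  245 (.s 127 (.f 407152) (.s 247 (.s 234 (.s 237 (.f 407253) (.q 2347)) (.f 714283)) (.q 1247)))
  (.q 2345)) (.s 245 (.f 405273) (.f 529384))))) (.s 137 (.q 1347) (.s 349 (.s 578 (.s 568 (.s 369
  (.f 609385) (.s 679 (.f 708596) (.s 167 (.f 719364) (.s 678 (.q 6789) (.f 719386))))) (.s 369
  (.f 938576) (.f 936485))) (.f 719485)) (.f 719384)))) (.q 3457)) (.s 349 (.q 3479) (.s 578 (.s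
  147 (.s 134 (.s 137 (.s 145 (.s 345 (.f 407153) (.s 167 (.s 567 (.s 678 (.q 1678) (.s 568 (.s
  469 (.f 609485) (.s 367 (.s 124 (.s 127 (.s 235 (.f 307152) (.s 245 (.f 407152) (.f 527364)))
  (.q 1247)) (.s 234 (.s 245 (.s 127 (.f 407152) (.f 307142)) (.q 1245)) (.q 1234))) (.f 739486)))
  (.q 5678))) (.q 1567)) (.f 715364))) (.q 1457)) (.q 1347)) (.q 1347)) (.s 137 (.s 134 (.s 345
  (.s 237 (.s 234 (.s 235 (.s 247 (.f 407253) (.s 124 (.s 245 (.f 304152) (.q 2345)) (.f 417253)))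
  (.q 2357)) (.q 2347)) (.s 247 (.q 2347) (.f 729384))) (.f 715384)) (.q 1347)) (.f 719384))) (.f
  739485)))))))))))) (.s 269 (.q 2569) (.s 469 (.q 4569) (.s 567 (.q 5679) (.s 679 (.s 568 (.q
  5689) (.s 678 (.f 709586) (.s 267 (.q 2679) (.s 247 (.s 578 (.q 5678) (.s 456 (.s 246 (.s 245
  (.s 256 (.s 349 (.s 345 (.s 346 (.s 347 (.s 356 (.s 236 (.s 235 (.f 405263) (.s 357 (.s 367 (.f
  406273) (.f 507364)) (.f 405273))) (.f 406253)) (.q 3456)) (.q 3479)) (.q 3469)) (.q 3459)) (.s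
  359 (.q 3459) (.s 379 (.q 3479) (.s 237 (.s 346 (.f 407263) (.s 356 (.f 726354) (.f 726385)))
  (.f 729385))))) (.q 2456)) (.q 2457)) (.q 2467)) (.f 726485))) (.f 729486))))) (.q
  5679))))))))))) (.s 578 (.q 5789) refutation₆)))

/-- A part of the tree `refutation`. -/
def refutation₈ : Refutation :=
  .s 368 (.s 136 (.q 1368) (.s 356 (.q 3568) (.s 568 (.s 369 (.s 156 (.q 1356) (.s 569 (.s 359 (.s
  367 (.s 567 (.s 378 (.f 608375) (.s 379 (.s 678 (.q 3678) (.s 259 (.s 269 (.s 468 (.s 467 (.s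
  349 (.s 458 (.f 608495) (.s 348 (.f 608374) (.s 489 (.s 478 (.f 608475) (.s 469 (.s 459 (.s 347
  (.s 479 (.f 607394) (.f 609475)) (.f 607384)) (.f 609485)) (.q 4689))) (.q 3489)))) (.f 609384))
  (.q 4678)) (.s 346 (.s 348 (.s 467 (.f 608374) (.s 267 (.s 247 (.s 237 (.f 607293) (.f 407263))
  (.q 2467)) (.s 257 (.q 2567) (.s 268 (.q 2678) (.s 679 (.s 579 (.s 689 (.s 578 (.f 708596) (.s
  357 (.f 607395) (.f 738596))) (.q 2689)) (.q 2579)) (.q 2679)))))) (.q 3468)) (.q 3468))) (.q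
  2569)) (.s 235 (.q 2359) (.s 467 (.s 348 (.f 608374) (.s 349 (.s 346 (.q 3468) (.s 468 (.s 489
  (.s 469 (.s 458 (.f 608495) (.s 459 (.s 456 (.q 4568) (.s 245 (.q 2459) (.f 528364))) (.f
  609485))) (.q 3469)) (.q 3489)) (.q 3468))) (.f 609374))) (.s 346 (.s 457 (.q 4567) (.s 348 (.s
  245 (.f 405263) (.f 528374)) (.q 3468))) (.q 3467)))))) (.f 609375))) (.q 3567)) (.s 357 (.q
  3567) (.s 378 (.s 678 (.s 379 (.s 679 (.s 567 (.f 608375) (.s 689 (.f 708396) (.s 268 (.s 278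
  (.s 238 (.f 608293) (.s 258 (.f 608295) (.f 826375))) (.q 2678)) (.s 236 (.q 2368) (.s 256 (.q
  2568) (.s 269 (.q 2689) (.s 239 (.q 2369) (.s 235 (.q 2359) (.s 126 (.f 615273) (.s 129 (.q
  1269) (.s 169 (.q 1269) (.s 139 (.q 1239) (.s 135 (.q 1359) (.s 125 (.s 346 (.s 234 (.q 2346)
  (.s 456 (.q 3456) (.s 145 (.f 405163) (.s 347 (.f 517364) (.f 514273))))) (.s 146 (.q 1346) (.s
  246 (.q 2346) (.s 347 (.q 3467) (.s 468 (.s 469 (.s 149 (.q 1469) (.s 478 (.s 479 (.s 349 (.s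
  458 (.f 608495) (.s 489 (.s 134 (.q 1349) (.s 457 (.q 4578) (.s 348 (.f 708394) (.s 124 (.s 467
  (.q 4567) (.s 245 (.f 415283) (.f 526374))) (.f 416273))))) (.f 709486))) (.f 609384)) (.q
  3479)) (.q 3478))) (.q 3469)) (.q 3468)))))) (.f 516273))))))))))))))) (.q 3679)) (.q 3679)) (.q
  3678)) (.q 3678)))) (.f 609385)) (.q 3569))) (.q 3689)) (.q 3568)))) (.s 168 (.q 1368) (.s 689
  (.s 378 (.s 357 (.q 3578) (.s 578 (.s 367 (.q 3678) (.s 678 (.s 379 (.s 579 (.s 359 (.s 679 (.s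
  369 (.s 569 (.s 568 (.f 708596) (.s 567 (.q 5678) (.s 256 (.s 259 (.s 269 (.s 236 (.f 506293)
  (.s 279 (.s 289 (.s 235 (.q 2356) (.s 239 (.s 136 (.s 126 (.f 306192) (.q 1236)) (.s 156 (.s 126
  (.f 506192) (.f 615273)) (.f 618375))) (.f 709283))) (.q 2589)) (.q 2579))) (.q 2569)) (.q
  2569)) (.s 236 (.s 269 (.s 469 (.s 479 (.s 489 (.s 348 (.f 708394) (.s 478 (.s 349 (.s 458 (.f
  708495) (.s 468 (.f 708496) (.s 246 (.f 406293) (.f 628475)))) (.f 709384)) (.q 3478))) (.q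
  4689)) (.q 4679)) (.s 246 (.s 349 (.f 406293) (.q 3469)) (.q 2469))) (.q 2369)) (.f 628375)))))
  (.f 709586)) (.f 709386)) (.q 3679)) (.f 709385)) (.q 3579)) (.q 3789)) (.q 3678))) (.q 3578)))
  (.s 238 (.s 123 (.q 1238) (.s 128 (.q 1238) (.s 235 (.s 236 (.s 237 (.s 239 (.s 289 (.s 248 (.s
  124 (.q 1248) (.s 249 (.s 349 (.f 408293) (.s 234 (.s 489 (.s 258 (.s 125 (.q 1258) (.s 259 (.s
  359 (.f 508293) (.s 459 (.f 508294) (.s 245 (.s 458 (.q 4589) (.s 145 (.s 135 (.f 305142) (.s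
  345 (.s 268 (.s 469 (.f 608294) (.s 569 (.f 608295) (.s 568 (.q 5689) (.s 356 (.s 346 (.f
  405263) (.q 3456)) (.s 346 (.f 405163) (.f 639485)))))) (.s 346 (.f 408263) (.s 469 (.f 829465)
  (.f 826394)))) (.q 1345))) (.s 135 (.s 134 (.s 345 (.q 1345) (.s 256 (.s 257 (.s 246 (.s 247 (.s
  457 (.s 478 (.q 4578) (.s 479 (.q 4579) (.s 467 (.f 506274) (.s 278 (.s 468 (.q 4678) (.s 469
  (.q 4679) (.s 456 (.s 127 (.q 1278) (.s 369 (.q 3469) (.s 267 (.s 126 (.q 1267) (.s 146 (.s 136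
  (.f 306142) (.q 1346)) (.s 156 (.f 506174) (.s 136 (.f 615384) (.f 619384))))) (.f 507264))))
  (.q 4567)))) (.f 508274))))) (.s 147 (.q 1457) (.s 157 (.q 1457) (.s 347 (.q 3457) (.s 127 (.q
  1247) (.s 456 (.s 467 (.q 4567) (.s 469 (.q 4569) (.s 268 (.s 167 (.q 1467) (.s 367 (.q 3467)
  (.s 369 (.q 3469) (.s 679 (.s 278 (.f 708296) (.s 137 (.f 307182) (.s 379 (.f 829374) (.f
  718293)))) (.s 379 (.q 3679) (.s 479 (.q 4679) (.s 678 (.q 6789) (.s 137 (.f 715394) (.f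
  719386))))))))) (.f 508264)))) (.s 146 (.q 1456) (.s 156 (.q 1456) (.s 126 (.q 1246) (.s 268 (.s
  469 (.f 608294) (.s 569 (.f 608295) (.s 568 (.q 5689) (.f 619485)))) (.s 136 (.f 306182) (.s 369
  (.f 829364) (.f 618293))))))))))))) (.f 304172)) (.f 304162)) (.f 305172)) (.f 305162))) (.q
  1345)) (.f 519384)))) (.q 2459)))) (.q 2589))) (.s 245 (.s 345 (.f 408253) (.s 459 (.s 359 (.f
  829354) (.s 259 (.s 129 (.s 139 (.s 135 (.s 125 (.f 305192) (.f 305182)) (.q 1359)) (.q 1239))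
  (.s 125 (.q 1259) (.s 135 (.f 305182) (.f 518293)))) (.q 2459))) (.f 825394))) (.q 2458))) (.q
  3489)) (.q 2349))) (.q 2489))) (.s 234 (.s 124 (.s 134 (.s 245 (.f 304152) (.s 246 (.f 304162)
  (.s 247 (.f 304172) (.s 249 (.f 304192) (.s 345 (.q 2345) (.s 346 (.q 2346) (.s 347 (.q 2347)
  (.s 349 (.q 2349) (.s 458 (.s 259 (.f 509284) (.s 269 (.s 468 (.f 609284) (.f 928465)) (.s 468
  (.s 569 (.f 608495) (.s 568 (.q 5689) (.s 356 (.s 256 (.s 279 (.s 478 (.f 709284) (.f 928475))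
  (.s 478 (.s 579 (.f 708495) (.s 679 (.f 708496) (.s 578 (.q 5789) (.s 678 (.q 6789) (.s 357 (.s
  367 (.f 506273) (.f 927386)) (.f 927385)))))) (.f 927384))) (.q 2356)) (.f 926385)))) (.f
  926384)))) (.s 258 (.q 2458) (.s 359 (.f 529384) (.s 259 (.s 135 (.s 125 (.f 305192) (.f
  305182)) (.s 125 (.q 1235) (.f 518293))) (.f 925384))))))))))))) (.q 1234)) (.s 134 (.f 304182)
  (.s 349 (.s 347 (.s 247 (.s 278 (.q 2478) (.s 379 (.f 407293) (.s 346 (.s 246 (.s 267 (.s 268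
  (.q 2468) (.s 367 (.f 406273) (.s 369 (.f 406293) (.s 678 (.q 2678) (.s 467 (.q 3467) (.f
  937486)))))) (.f 407263)) (.q 2346)) (.s 367 (.s 268 (.f 608273) (.f 418263)) (.q 3467))))) (.q
  2347)) (.s 379 (.s 278 (.f 708293) (.f 418273)) (.q 3479))) (.f 418293)))) (.q 2348))) (.q
  2389)) (.q 2389)) (.q 2378)) (.q 2368)) (.q 2358)))) (.s 258 (.q 2358) (.s 268 (.q 2368) (.s 278
  (.q 2378) (.s 348 (.s 134 (.q 1348) (.s 234 (.q 2348) (.s 345 (.s 346 (.s 468 (.q 3468) (.s 347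
  (.s 349 (.s 135 (.s 145 (.s 356 (.f 405163) (.s 357 (.f 405173) (.s 359 (.f 405193) (.s 456 (.q
  3456) (.s 457 (.q 3457) (.s 136 (.s 146 (.s 156 (.s 369 (.f 406193) (.s 568 (.q 1568) (.f
  936485))) (.f 406153)) (.q 1346)) (.s 146 (.f 406183) (.s 467 (.s 367 (.s 567 (.s 678 (.q 4678)
  (.s 369 (.s 379 (.f 609375) (.f 609374)) (.s 379 (.q 3679) (.s 578 (.s 157 (.q 1578) (.s 147 (.s
  167 (.s 137 (.f 407153) (.f 407163)) (.q 1467)) (.s 137 (.q 1347) (.s 167 (.f 718364) (.f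
  719386))))) (.f 937485))))) (.q 4567)) (.q 3467)) (.f 618374))))))))) (.q 1345)) (.s 145 (.f
  405183) (.s 456 (.s 457 (.s 356 (.s 357 (.s 467 (.f 506374) (.s 367 (.s 246 (.s 256 (.s 236 (.f
  406273) (.f 406253)) (.q 2456)) (.s 236 (.q 2346) (.f 628374))) (.f 507364))) (.q 3457)) (.q
  3456)) (.f 518374)) (.f 518364)))) (.q 3489)) (.q 3478))) (.q 3468)) (.q 3458)))) (.s 148 (.q
  1348) (.s 248 (.q 2348) (.s 489 (.s 279 (.s 289 (.s 269 refutation₅ (.s 267 (.q 2679) (.s 678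
  (.f 709286) (.s 249 (.s 246 (.s 469 (.q 2469) (.s 467 (.q 2467) (.s 147 (.s 146 (.s 127 (.f
  407192) (.s 126 (.s 124 (.q 1247) (.s 167 (.q 1267) (.s 245 (.s 156 (.s 157 (.f 407152) (.s 567
  (.q 1567) (.s 568 (.q 1568) (.s 578 (.q 5678) (.s 259 (.s 456 (.f 509264) (.f 716485)) (.f
  927586)))))) (.f 406152)) (.s 145 (.q 1245) (.s 456 (.s 157 (.f 507164) (.q 1457)) (.q
  2456)))))) (.f 406192))) (.q 1467)) (.s 167 (.q 1467) (.s 479 (.s 256 (.s 567 (.q 2567) (.s 569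
  (.q 2569) (.s 259 (.s 459 (.s 456 (.f 509264) (.q 4569)) (.f 947586)) (.f 927586)))) (.s 245 (.s
  456 (.q 2456) (.s 259 (.q 2569) (.s 568 (.s 578 (.f 709285) (.f 928576)) (.f 926485)))) (.q
  2456))) (.f 719486)))))) (.q 2469)) (.s 467 (.s 457 (.s 259 (.f 509274) (.s 579 (.s 567 (.s 569
  (.f 607495) (.q 5679)) (.f 927586)) (.q 2579))) (.s 259 (.f 927465) (.s 578 (.f 709285) (.f
  927485)))) (.f 927486)))))) (.q 2789)) refutation₇) (.q 3489)))))))))) (.q 3689)))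

/-- A part of the tree `refutation`. -/
def refutation₉ : Refutation :=
  .s 126 (.s 136 (.s 268 (.q 1268) (.s 146 (.s 156 (.s 267 (.f 306172) (.s 468 (.q 1468) (.s 469
  (.q 1469) (.s 247 (.s 246 (.s 346 (.f 407263) (.s 134 (.s 124 (.f 304162) (.s 245 (.s 145 (.s
  135 (.s 125 (.s 256 (.f 405162) (.s 257 (.f 405172) (.s 456 (.q 2456) (.s 345 (.f 406253) (.f
  725364))))) (.f 305142)) (.q 1345)) (.s 125 (.q 1245) (.s 456 (.s 257 (.f 507264) (.s 135 (.f
  305172) (.s 356 (.f 726354) (.f 517263)))) (.q 1456)))) (.f 304152))) (.q 1346))) (.q 2467)) (.s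
  347 (.q 2347) (.s 134 (.s 124 (.s 248 (.f 304182) (.s 246 (.f 304162) (.s 346 (.q 2346) (.s 478
  (.s 479 (.s 489 (.s 467 (.q 4678) (.s 678 (.f 709486) (.q 4678))) (.f 826394)) (.f 726394)) (.f
  726384))))) (.f 304172)) (.s 124 (.q 1234) (.s 346 (.s 137 (.q 1347) (.s 248 (.f 408263) (.s 167
  (.q 1367) (.s 278 (.s 567 (.q 1567) (.s 356 (.s 245 (.f 405263) (.s 257 (.f 507263) (.s 345 (.q
  2345) (.f 417253)))) (.s 258 (.f 826354) (.f 826375)))) (.f 418273))))) (.q 1346))))))))) (.f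
  306152)) (.f 306142))) (.q 1236)) (.s 267 (.s 246 (.s 124 (.q 1246) (.s 247 (.s 256 (.s 125 (.q
  1256) (.s 257 (.s 457 (.s 467 (.f 506274) (.s 456 (.s 567 (.q 4567) (.s 156 (.s 136 (.f 306152)
  (.s 146 (.s 245 (.f 406152) (.f 615243)) (.f 506174))) (.s 145 (.q 1456) (.s 146 (.q 1456) (.s
  157 (.q 1567) (.s 147 (.q 1457) (.s 459 (.s 469 (.f 506294) (.s 479 (.f 507294) (.f 619475)))
  (.s 469 (.q 4569) (.s 569 (.q 4569) (.s 479 (.q 4579) (.s 579 (.q 4579) (.s 137 (.s 134 (.s 345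
  (.q 1345) (.f 715394)) (.q 1347)) (.s 489 (.s 589 (.s 568 (.q 5689) (.f 619485)) (.f 718395))
  (.f 718394)))))))))))))) (.q 4567))) (.s 245 (.s 578 (.s 157 (.q 1578) (.s 278 (.s 568 (.f
  607285) (.s 127 (.q 1257) (.s 268 (.s 567 (.q 5678) (.s 678 (.s 167 (.q 1567) (.s 467 (.q 4567)
  (.s 689 (.s 679 (.f 708296) (.q 6789)) (.s 569 (.q 5689) (.s 679 (.f 708596) (.s 137 (.s 579 (.q
  5679) (.s 356 (.s 469 (.q 4679) (.s 479 (.q 4679) (.s 147 (.f 307142) (.s 346 (.f 405263) (.f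
  716394))))) (.f 716395))) (.f 718396))))))) (.q 5678))) (.q 2678)))) (.q 2578))) (.s 458 (.q
  4578) (.s 478 (.q 4578) (.s 347 (.s 345 (.s 357 (.f 405273) (.s 367 (.f 406273) (.s 346 (.s 356
  (.f 405263) (.s 456 (.q 3456) (.s 135 (.s 145 (.f 305142) (.q 1345)) (.s 145 (.f 405163) (.f
  517364))))) (.q 3467)))) (.q 3457)) (.s 357 (.q 3457) (.s 145 (.s 459 (.q 1459) (.s 135 (.f
  305142) (.s 134 (.q 1345) (.s 137 (.q 1357) (.s 157 (.q 1357) (.s 147 (.q 1347) (.s 489 (.s 479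
  (.s 579 (.s 469 (.f 607294) (.s 678 (.f 709486) (.s 567 (.s 569 (.f 607295) (.q 5679)) (.f
  947586)))) (.q 4579)) (.f 719485)) (.s 479 (.q 4789) (.f 718394))))))))) (.s 147 (.q 1457) (.s
  157 (.q 1457) (.s 135 (.s 134 (.s 345 (.q 1345) (.s 258 (.s 248 (.s 137 (.f 715384) (.s 479 (.s
  489 (.s 459 (.f 507294) (.s 278 (.f 708294) (.f 829475))) (.q 4789)) (.s 459 (.q 4579) (.s 489
  (.f 719485) (.f 718394))))) (.f 304182)) (.f 305182))) (.q 1345)) (.f 517384)))))))))) (.q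
  2457))) (.q 2567))) (.s 356 (.q 2356) (.s 245 (.s 456 (.q 2456) (.s 567 (.s 345 (.f 406253) (.s
  346 (.q 3456) (.s 258 (.s 125 (.q 1258) (.s 135 (.f 305162) (.s 145 (.f 405162) (.s 469 (.s 479
  (.f 607294) (.s 459 (.f 609475) (.f 516294))) (.s 459 (.q 4569) (.f 516394)))))) (.s 458 (.q
  2458) (.s 468 (.f 625384) (.s 125 (.s 135 (.s 257 (.f 305172) (.s 134 (.s 457 (.q 2457) (.s 248
  (.s 278 (.s 268 (.f 608275) (.f 825364)) (.f 825374)) (.f 304182))) (.q 1345))) (.q 1235)) (.s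
  135 (.f 305162) (.s 145 (.f 405162) (.f 516384))))))))) (.q 2567))) (.q 2456)))) (.q 2467))) (.s
  146 (.q 1246) (.s 467 (.s 278 (.s 127 (.q 1278) (.s 268 (.s 248 (.s 468 (.s 124 (.q 1248) (.s
  134 (.f 304162) (.s 136 (.q 1346) (.s 279 (.s 269 (.s 469 (.s 489 (.f 608294) (.s 689 (.q 4689)
  (.s 167 (.s 367 (.s 137 (.f 307162) (.s 147 (.f 716243) (.s 347 (.s 478 (.q 3478) (.f 607184))
  (.f 416273)))) (.q 1367)) (.s 137 (.q 1367) (.s 147 (.q 1467) (.s 679 (.s 479 (.s 678 (.f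
  709486) (.q 6789)) (.f 718394)) (.f 718396))))))) (.q 2469)) (.q 2679)) (.s 679 (.q 2679) (.s
  289 (.q 2789) (.s 789 (.q 2789) (.s 689 (.q 6789) (.s 489 (.q 2489) (.s 167 (.s 367 (.s 137 (.f
  307162) (.s 269 (.f 607192) (.s 147 (.f 716243) (.s 249 (.f 719264) (.s 347 (.s 479 (.s 247 (.q
  2479) (.q 2347)) (.f 718394)) (.f 416273)))))) (.q 1367)) (.s 137 (.q 1367) (.f
  718396)))))))))))) (.q 2468)) (.f 608274)) (.q 2678))) (.s 268 (.s 468 (.s 367 (.f 608273) (.s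
  248 (.f 608274) (.s 347 (.f 827364) (.s 136 (.s 134 (.s 156 (.f 306152) (.s 124 (.s 247 (.f
  304172) (.s 135 (.s 245 (.f 304152) (.s 345 (.q 2345) (.s 458 (.s 145 (.q 1458) (.s 125 (.f
  305142) (.s 256 (.s 257 (.s 456 (.f 507264) (.q 2456)) (.f 517243)) (.f 516243)))) (.s 258 (.q
  2458) (.s 456 (.q 4568) (.f 825364)))))) (.q 1356))) (.f 304162))) (.q 1346)) (.s 137 (.q 1367)
  (.s 167 (.q 1367) (.s 127 (.q 1237) (.s 279 (.s 269 (.s 249 (.s 124 (.q 1249) (.s 134 (.f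
  304162) (.f 418273))) (.f 609274)) (.q 2679)) (.s 679 (.q 2679) (.s 689 (.f 718296) (.f
  718396))))))))))) (.q 2468)) (.s 136 (.f 306182) (.s 367 (.s 357 (.s 257 (.s 256 (.f 506273) (.s
  258 (.f 508273) (.s 356 (.q 2356) (.s 125 (.s 135 (.f 305172) (.q 1235)) (.s 135 (.f 305162) (.f
  518263)))))) (.q 2357)) (.s 356 (.q 3567) (.s 567 (.s 258 (.f 827365) (.s 135 (.s 125 (.s 256
  (.q 1256) (.s 145 (.s 257 (.f 305172) (.s 458 (.q 1458) (.s 468 (.s 478 (.f 608475) (.s 247 (.s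
  347 (.s 345 (.f 407253) (.q 3457)) (.f 738465)) (.f 728465))) (.s 478 (.q 4678) (.s 345 (.s 347
  (.s 247 (.f 407253) (.q 2347)) (.f 627384)) (.f 625384)))))) (.f 305142))) (.f 305182)) (.s 125
  (.q 1235) (.f 518263)))) (.q 3567)))) (.f 618273))))) (.q 2467)))) (.s 127 (.q 1267) (.s 367 (.q
  2367) (.s 136 (.f 306172) (.s 247 (.s 246 (.s 467 (.q 2467) (.s 146 (.f 406172) (.s 346 (.f
  407263) (.s 347 (.q 3467) (.s 257 (.s 256 (.s 468 (.s 478 (.s 458 (.f 506284) (.f 728465)) (.q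
  4678)) (.s 478 (.f 617284) (.f 617384))) (.q 2567)) (.s 245 (.s 345 (.f 407253) (.s 156 (.f
  617253) (.s 456 (.s 356 (.f 726354) (.s 256 (.s 125 (.q 1256) (.s 135 (.f 305172) (.f 517263)))
  (.q 2456))) (.f 725364)))) (.q 2457))))))) (.q 2467)) (.s 147 (.q 1247) (.s 146 (.f 617243) (.s
  257 (.s 245 (.q 2457) (.s 457 (.s 356 (.f 507263) (.s 346 (.f 726354) (.s 278 (.s 258 (.s 248
  (.s 124 (.q 1248) (.s 134 (.f 304152) (.f 417263))) (.f 508274)) (.q 2578)) (.s 268 (.q 2678)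
  (.f 618273))))) (.q 2457))) (.s 357 (.q 2357) (.s 156 (.f 617253) (.s 125 (.s 135 (.s 256 (.q
  1256) (.s 145 (.s 456 (.q 1456) (.s 457 (.q 1457) (.s 458 (.q 1458) (.s 134 (.s 124 (.s 246 (.q
  1246) (.s 245 (.f 304152) (.s 345 (.q 2345) (.s 467 (.s 468 (.s 478 (.s 567 (.f 608475) (.q
  4567)) (.f 725384)) (.f 625384)) (.f 625374))))) (.f 304172)) (.s 124 (.q 1234) (.s 345 (.s 346
  (.s 246 (.f 406253) (.q 2346)) (.f 417263)) (.q 1345))))))) (.f 305142))) (.q 1235)) (.s 135 (.f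
  305172) (.s 356 (.s 567 (.q 3567) (.s 568 (.q 3568) (.s 569 (.q 3569) (.s 578 (.s 579 (.s 589
  (.s 678 (.f 709586) (.q 5678)) (.f 618395)) (.f 617295)) (.f 617285))))) (.f
  517263))))))))))))))

/-- A part of the tree `refutation`. -/
def refutation₁₀ : Refutation :=
  .s 136 (.s 137 (.s 134 (.s 348 (.q 1348) (.s 349 (.q 1349) (.s 125 (.s 123 (.s 124 (.s 126 (.s
  127 (.s 157 (.s 578 (.q 1578) (.s 579 (.q 1579) (.s 147 (.s 478 (.q 1478) (.s 479 (.q 1479) (.s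
  146 (.s 468 (.q 1468) (.s 469 (.q 1469) (.s 247 (.s 237 (.f 304172) (.s 267 (.f 406172) (.s 347
  (.s 246 (.s 367 (.f 406173) (.s 236 (.f 304162) (.f 406273))) (.q 2467)) (.q 2347)))) (.s 237
  (.s 234 (.s 267 (.f 306172) (.s 346 (.s 236 (.s 246 (.f 304162) (.q 2346)) (.q 2346)) (.f
  726384))) (.q 2347)) (.s 489 (.s 467 (.s 678 (.q 4678) (.s 267 (.s 236 (.q 2367) (.s 367 (.s 346
  (.s 347 (.f 406173) (.q 3467)) (.f 726384)) (.q 2367))) (.f 729486))) (.s 267 (.q 2467) (.s 678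
  (.s 167 (.q 1678) (.s 367 (.q 3678) (.s 236 (.f 307162) (.s 246 (.f 407162) (.s 346 (.f 407163)
  (.s 347 (.q 3467) (.f 627384))))))) (.f 729486)))) (.f 728394)))))) (.s 246 (.q 1246) (.s 346
  (.q 1346) (.s 167 (.s 234 (.f 306142) (.s 236 (.q 2346) (.s 678 (.q 1678) (.s 156 (.s 145 (.q
  1456) (.s 456 (.s 569 (.q 1569) (.s 245 (.q 1245) (.s 135 (.s 235 (.q 2345) (.s 356 (.f 514263)
  (.s 256 (.q 2356) (.s 589 (.s 469 (.s 459 (.s 567 (.f 609475) (.s 257 (.q 2567) (.s 267 (.q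
  2567) (.f 729586)))) (.q 4569)) (.s 459 (.f 506194) (.f 526394))) (.f 628395))))) (.f 514283))))
  (.q 1456))) (.s 135 (.s 356 (.q 1356) (.s 235 (.f 306152) (.s 345 (.s 245 (.f 615243) (.s 456
  (.q 3456) (.s 458 (.q 3458) (.s 459 (.q 3459) (.s 468 (.s 469 (.s 489 (.s 568 (.f 609485) (.q
  4568)) (.f 528394)) (.f 615294)) (.f 615284)))))) (.f 614253)))) (.q 1356)))))) (.q 1467)))))))
  (.s 347 (.q 1347) (.s 145 (.q 1457) (.s 457 (.s 234 (.f 307142) (.s 345 (.q 3457) (.s 135 (.s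
  357 (.f 514273) (.s 146 (.s 167 (.q 1467) (.s 356 (.f 507163) (.s 346 (.f 716354) (.f 714263))))
  (.s 246 (.q 1246) (.s 346 (.q 1346) (.s 156 (.s 367 (.f 614273) (.s 236 (.q 2346) (.s 356 (.f
  514263) (.s 568 (.q 1568) (.s 256 (.q 2356) (.f 627385)))))) (.f 614253)))))) (.f 514283)))) (.q
  1457))))))) (.s 135 (.s 357 (.q 1357) (.s 235 (.f 307152) (.s 567 (.s 356 (.q 3567) (.s 167 (.s
  147 (.s 145 (.s 457 (.q 1457) (.s 478 (.q 1478) (.s 245 (.f 407152) (.s 345 (.f 407153) (.s 458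
  (.q 1458) (.s 347 (.q 3457) (.f 527384))))))) (.q 1457)) (.s 234 (.f 307142) (.s 345 (.s 245 (.f
  715243) (.s 456 (.f 715364) (.f 715264))) (.f 714253)))) (.f 715263))) (.s 167 (.q 1567) (.s 236
  (.f 307162) (.s 356 (.s 256 (.f 716253) (.s 568 (.q 3568) (.s 569 (.q 3569) (.s 578 (.s 579 (.s
  589 (.s 678 (.f 709586) (.q 5678)) (.f 628395)) (.f 716295)) (.f 716285))))) (.f 715263)))))))
  (.q 1357))) (.q 1237)) (.q 1236)) (.q 1234)) (.s 234 (.s 135 (.s 235 (.s 236 (.s 237 (.s 145 (.s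
  256 (.f 305162) (.s 257 (.f 305172) (.s 356 (.q 2356) (.s 357 (.q 2357) (.s 458 (.q 1458) (.s
  156 (.s 126 (.s 146 (.s 568 (.q 1568) (.s 569 (.q 1569) (.s 267 (.f 306172) (.s 468 (.q 1468)
  (.s 578 (.s 579 (.s 157 (.q 1578) (.s 567 (.q 5678) (.s 678 (.s 589 (.f 709586) (.s 478 (.f
  849576) (.s 167 (.q 1567) (.s 127 (.f 307152) (.s 489 (.q 4589) (.s 346 (.s 479 (.q 4789) (.s
  147 (.f 407163) (.f 718294))) (.f 638495))))))) (.q 5678)))) (.f 726395)) (.f 726385)))))) (.q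
  1456)) (.q 1256)) (.s 456 (.q 1456) (.s 126 (.f 306152) (.s 267 (.s 146 (.f 306142) (.s 678 (.q
  2678) (.s 167 (.s 127 (.s 147 (.s 157 (.s 478 (.q 1478) (.s 578 (.q 1578) (.s 579 (.q 1579) (.s
  568 (.f 607285) (.s 367 (.f 617385) (.s 347 (.f 736485) (.s 569 (.f 607295) (.s 589 (.f 739586)
  (.f 738495))))))))) (.f 307152)) (.f 307142)) (.f 307162)) (.s 147 (.q 1467) (.s 157 (.q 1567)
  (.s 345 (.s 245 (.s 246 (.f 406253) (.s 124 (.f 304152) (.f 416253))) (.q 2345)) (.s 478 (.s 247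
  (.f 725384) (.f 725364)) (.f 715384)))))))) (.f 617253)))))))))) (.f 305142)) (.q 1237)) (.q
  1236)) (.q 1235)) (.q 1235)) (.q 1234))) (.s 135 (.s 123 (.q 1235) (.s 235 (.s 234 (.s 236 (.s
  237 (.s 145 (.f 305142) (.s 256 (.s 257 (.s 568 (.q 2568) (.s 569 (.q 2569) (.s 578 (.q 2578)
  (.s 579 (.q 2579) (.s 146 (.s 156 (.s 456 (.s 468 (.q 1468) (.s 469 (.q 1469) (.s 126 (.s 267
  (.f 506172) (.s 247 (.f 507264) (.s 567 (.q 2567) (.s 356 (.f 507263) (.s 346 (.f 726354) (.s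
  478 (.s 479 (.s 459 (.s 489 (.s 467 (.q 4678) (.s 678 (.f 709486) (.q 4678))) (.f 639485)) (.f
  639475)) (.f 726394)) (.f 726384))))))) (.f 306142)))) (.q 1456)) (.q 1456)) (.s 126 (.f 306142)
  (.s 156 (.f 306152) (.s 267 (.s 589 (.s 356 (.q 1356) (.s 678 (.q 2678) (.s 357 (.s 367 (.f
  506273) (.q 3567)) (.s 367 (.f 617385) (.f 739586))))) (.f 618295)) (.f 306172))))))))) (.f
  305172)) (.f 305162))) (.q 1237)) (.q 1236)) (.q 1234)) (.q 1235))) (.f 518293))))) (.s 146 (.s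
  346 (.s 147 (.s 347 (.s 367 (.f 406173) (.s 467 (.q 3467) (.s 167 (.s 478 (.q 1478) (.s 479 (.q
  1479) (.s 678 (.q 1678) (.s 457 (.s 357 (.s 456 (.f 507364) (.q 4567)) (.q 3457)) (.s 345 (.s
  458 (.q 4578) (.s 459 (.q 4579) (.s 156 (.s 157 (.s 568 (.q 1568) (.s 569 (.q 1569) (.s 578 (.q
  1578) (.s 579 (.q 1579) (.s 589 (.f 749586) (.s 348 (.f 837495) (.s 489 (.q 4589) (.s 349 (.q
  3489) (.s 124 (.s 234 (.q 1234) (.s 235 (.s 245 (.s 356 (.f 405263) (.s 357 (.f 405273) (.s 456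
  (.q 3456) (.f 736485)))) (.q 2345)) (.s 245 (.f 415283) (.f 528394)))) (.f 418293)))))))))) (.f
  407153)) (.f 406153)))) (.q 3457)))))) (.f 407163)))) (.q 1347)) (.q 1347)) (.q 1346)) (.q
  1346))) (.s 167 (.q 1367) (.s 127 (.s 126 (.s 236 (.s 123 (.s 234 (.s 124 (.s 134 (.s 348 (.q
  2348) (.s 146 (.s 246 (.f 304162) (.s 147 (.q 1347) (.s 467 (.q 1467) (.s 468 (.q 1468) (.s 469
  (.q 1469) (.s 346 (.q 2346) (.s 478 (.s 479 (.s 678 (.s 489 (.f 709486) (.s 356 (.s 256 (.s 457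
  (.f 506374) (.s 459 (.f 506394) (.s 245 (.q 2456) (.s 235 (.f 526374) (.f 528394))))) (.q 2356))
  (.s 135 (.s 235 (.s 125 (.s 157 (.q 1357) (.s 145 (.s 256 (.f 305162) (.s 156 (.s 567 (.q 1567)
  (.s 458 (.q 1458) (.f 628475))) (.f 306152))) (.f 305142))) (.q 1235)) (.q 2356)) (.q 1356))))
  (.q 4678)) (.f 716294)) (.f 716284)))))))) (.f 306142))) (.q 1234)) (.q 1234)) (.s 246 (.s 147
  (.f 407162) (.s 348 (.s 349 (.s 478 (.q 3478) (.f 719384)) (.f 714293)) (.f 714283))) (.q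
  2346))) (.q 1237)) (.f 716283)) (.q 1267)) (.f 718293)))) (.s 126 (.s 123 (.s 236 (.q 1236) (.s
  156 (.s 135 (.q 1356) (.s 356 (.s 235 (.q 1235) (.s 125 (.s 345 (.s 234 (.q 2345) (.s 458 (.q
  3458) (.s 146 (.f 406153) (.s 349 (.s 145 (.q 1456) (.f 519384)) (.f 614293))))) (.s 145 (.q
  1345) (.s 456 (.s 348 (.q 3458) (.s 124 (.s 234 (.s 134 (.s 137 (.s 357 (.s 367 (.s 347 (.s 237
  (.s 247 (.f 304172) (.q 2347)) (.q 2347)) (.f 507364)) (.q 1367)) (.q 1357)) (.s 127 (.s 157 (.s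
  167 (.f 507163) (.f 716283)) (.f 715283)) (.f 718293))) (.q 1234)) (.f 514283)) (.q 1245))) (.q
  3456)))) (.f 518293))) (.q 1356))) (.s 125 (.s 235 (.s 135 (.s 137 (.s 127 (.s 367 (.s 234 (.s
  124 (.s 134 (.s 145 (.s 147 (.s 245 (.f 304152) (.s 146 (.q 1346) (.s 458 (.q 1458) (.s 478 (.q
  1478) (.s 345 (.q 2345) (.s 468 (.s 347 (.s 357 (.f 405173) (.q 3457)) (.f 607384)) (.f
  615284))))))) (.f 307142)) (.f 305142)) (.q 1234)) (.q 1234)) (.s 245 (.s 146 (.f 406152) (.s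
  348 (.s 349 (.s 468 (.q 3468) (.f 619384)) (.f 614293)) (.f 614283))) (.q 2345))) (.q 1367)) (.q
  1237)) (.s 237 (.q 1237) (.s 157 (.q 1357) (.s 357 (.q 1357) (.s 127 (.s 167 (.s 367 (.s 347 (.s
  234 (.q 2347) (.s 345 (.s 478 (.q 3478) (.s 245 (.s 458 (.q 3458) (.s 146 (.f 406152) (.s 147
  (.f 407152) (.s 468 (.f 718465) (.s 349 (.f 619384) (.f 614293)))))) (.q 2345))) (.q 3457))) (.s
  147 (.q 1347) (.s 346 (.q 3467) (.s 124 (.s 146 (.q 1467) (.s 234 (.s 134 (.s 245 (.f 304152)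
  (.s 145 (.s 456 (.q 1456) (.f 715264)) (.f 305142))) (.q 1234)) (.f 714263))) (.q 1247))))) (.q
  1367)) (.f 716283)) (.f 718293)))))) (.q 1235)) (.f 615283)) (.q 1256)))) (.q 1236)) (.f
  618293))

/-- A part of the tree `refutation`. -/
def refutation₁₁ : Refutation :=
  .s 238 (.s 123 (.q 1238) (.s 128 (.q 1238) (.s 235 (.s 129 (.q 1239) (.s 348 (.s 134 (.q 1348)
  (.s 248 (.s 345 (.s 458 (.q 3458) (.s 124 (.q 1234) (.s 245 (.s 258 (.s 125 (.q 1258) (.s 368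
  (.s 136 (.q 1368) (.s 268 (.s 356 (.q 3568) (.s 568 (.s 156 (.q 1356) (.s 478 (.s 378 (.s 357
  (.q 3578) (.s 567 (.f 608375) (.s 367 (.q 3567) (.s 256 (.s 236 (.s 246 (.f 406283) (.q 2456))
  (.q 2356)) (.s 236 (.f 628375) (.s 135 (.s 145 (.s 246 (.f 405162) (.s 468 (.s 347 (.s 346 (.f
  638475) (.q 3467)) (.f 416273)) (.q 2468))) (.q 1345)) (.f 516273))))))) (.q 3478)) (.s 347 (.s
  357 (.f 405273) (.s 457 (.q 3457) (.s 589 (.s 569 (.f 608295) (.q 5689)) (.s 569 (.f 608395) (.s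
  369 (.q 3569) (.s 679 (.s 367 (.q 3679) (.s 378 (.s 579 (.f 708395) (.f 617395)) (.q 3678))) (.s
  579 (.q 5679) (.s 367 (.s 378 (.s 567 (.f 608375) (.q 3567)) (.f 837495)) (.f 617395)))))))))
  (.q 3478)))) (.q 3568))) (.q 2368))) (.s 236 (.s 346 (.s 246 (.s 256 (.s 356 (.f 405263) (.s 268
  (.s 456 (.q 3456) (.s 126 (.q 1268) (.s 567 (.s 257 (.s 267 (.s 237 (.s 247 (.s 378 (.f 407283)
  (.s 347 (.s 357 (.f 405273) (.s 367 (.f 406273) (.s 457 (.q 3457) (.s 579 (.s 569 (.f 607295)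
  (.q 5679)) (.s 569 (.s 589 (.f 608295) (.f 837495)) (.f 736495)))))) (.q 3478))) (.q 2457)) (.q
  2357)) (.q 2567)) (.q 2567)) (.s 367 (.q 3567) (.s 467 (.q 4567) (.s 378 (.f 836475) (.s 347 (.s
  136 (.s 146 (.s 156 (.f 306152) (.f 406153)) (.q 1346)) (.s 146 (.f 406173) (.f 618374))) (.q
  3478)))))))) (.f 408263))) (.f 406253)) (.q 2346)) (.q 3468)) (.q 2368)))) (.f 408253)) (.q
  2458)))) (.q 3458)) (.q 2348))) (.s 148 (.q 1348) (.s 234 (.s 349 (.q 3489) (.s 149 (.q 1489)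
  (.s 378 (.s 137 (.q 1378) (.s 278 (.s 347 (.q 3478) (.s 478 (.s 357 (.q 3578) (.s 578 (.s 147
  (.q 1347) (.s 489 (.s 479 (.s 248 (.f 708294) (.s 459 (.s 345 (.q 3459) (.s 579 (.s 589 (.s 458
  (.f 708495) (.s 258 (.f 708295) (.s 457 (.q 4578) (.f 825374)))) (.f 708395)) (.s 379 (.q 3579)
  (.s 457 (.s 589 (.q 5789) (.s 258 (.f 508274) (.s 259 (.q 2589) (.s 257 (.q 2578) (.s 279 (.q
  2579) (.s 237 (.f 728395) (.s 239 (.q 2379) (.s 268 (.s 467 (.f 608274) (.f 827465)) (.s 168 (.q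
  1268) (.s 236 (.s 267 (.q 2678) (.s 678 (.s 169 (.q 1689) (.s 369 (.q 2369) (.s 469 (.s 146 (.q
  1469) (.s 126 (.s 136 (.f 306142) (.q 1236)) (.s 136 (.f 306182) (.f 617293)))) (.f 709486))))
  (.q 2678))) (.q 2368))))))))))) (.q 4579))))) (.f 709485))) (.q 4789)) (.s 479 (.f 708394) (.s
  459 (.f 839475) (.s 379 (.q 3479) (.s 247 (.s 237 (.s 267 (.s 268 (.s 368 (.f 607283) (.s 468
  (.f 607284) (.s 678 (.s 467 (.q 4678) (.s 689 (.s 679 (.f 708296) (.q 6789)) (.s 679 (.f 708396)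
  (.f 837496)))) (.q 3678)))) (.q 2678)) (.s 246 (.s 467 (.q 2467) (.s 346 (.f 407263) (.s 468 (.s
  368 (.f 728364) (.s 469 (.q 4679) (.s 689 (.q 4689) (.s 679 (.f 708396) (.f 728396))))) (.f
  726384)))) (.q 2467))) (.q 2347)) (.s 249 (.q 2479) (.s 237 (.f 728394) (.s 289 (.q 2489) (.s
  257 (.q 2357) (.s 125 (.s 135 (.s 258 (.q 1258) (.s 145 (.s 457 (.q 1457) (.s 458 (.q 1458) (.s
  268 (.s 256 (.q 2568) (.s 568 (.s 689 (.q 2689) (.s 567 (.f 608275) (.s 456 (.q 4568) (.s 368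
  (.f 836475) (.s 679 (.f 708396) (.f 837596)))))) (.q 2568))) (.s 236 (.s 256 (.f 305162) (.s 356
  (.q 2356) (.s 567 (.s 456 (.q 4567) (.s 468 (.f 608475) (.s 467 (.q 4678) (.s 346 (.s 246 (.s
  345 (.f 406253) (.q 3456)) (.q 2346)) (.s 248 (.s 345 (.f 408253) (.f 825364)) (.f 826374))))))
  (.f 826375)))) (.q 2368))))) (.f 305142))) (.q 1235)) (.s 135 (.s 145 (.f 305142) (.f 517294))
  (.f 517293))))))))))))) (.q 3578))) (.q 3478))) (.q 2378))) (.s 237 (.s 379 (.q 3789) (.s 368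
  (.s 268 (.s 346 (.q 3468) (.s 468 (.s 356 (.q 3568) (.s 568 (.s 367 (.s 678 (.q 3678) (.s 267
  (.s 278 (.s 467 (.s 567 (.s 248 (.s 124 (.q 1248) (.s 478 (.s 147 (.q 1478) (.s 347 (.q 3478)
  (.s 247 (.f 607284) (.s 246 (.q 2467) (.s 134 (.f 304172) (.s 236 (.f 416273) (.s 369 (.s 137
  (.q 1347) (.s 167 (.f 607193) (.f 719386))) (.f 416293)))))))) (.s 247 (.s 347 (.s 458 (.f
  608475) (.s 245 (.s 357 (.f 405273) (.s 345 (.s 578 (.s 257 (.f 607285) (.f 407253)) (.f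
  607385)) (.q 3457))) (.q 2458))) (.f 607384)) (.q 2478)))) (.f 608274)) (.q 3567)) (.q 3467))
  (.f 608273)) (.q 2678))) (.q 3678)) (.q 3568))) (.q 3468))) (.q 2368)) (.s 236 refutation₉ (.q
  2368)))) (.q 2378))))) (.q 2348))))) (.q 2358)))) (.s 258 (.q 2358) (.s 239 (.q 2389) (.s 289
  (.q 2389) (.s 259 (.q 2589) (.s 368 (.s 136 (.q 1368) (.s 236 (.q 2368) (.s 356 (.q 3568) (.s
  568 (.s 689 (.q 3689) (.s 156 (.q 1356) (.s 256 (.q 2356) (.s 367 (.s 567 (.s 378 (.f 608375)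
  (.s 278 (.q 2378) (.s 678 (.q 3678) (.s 379 (.q 3789) (.s 467 (.s 348 (.f 608374) (.s 148 (.q
  1348) (.s 248 (.q 2348) (.s 346 (.q 3468) (.s 468 (.s 349 (.q 3489) (.s 146 (.q 1468) (.s 589
  (.s 569 (.s 458 (.f 608495) (.s 456 (.q 4568) (.s 478 (.f 608475) (.s 347 (.s 479 (.q 3479) (.s
  469 (.s 489 (.s 459 (.f 609475) (.f 609485)) (.f 608394)) (.s 369 (.q 3469) (.s 459 (.q 4569)
  (.s 489 (.q 4689) (.s 268 (.f 826394) (.s 126 (.s 245 (.s 123 (.s 124 (.s 234 (.s 235 (.s 134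
  (.f 304152) (.q 1234)) (.f 615293)) (.f 614293)) (.q 1246)) (.q 1236)) (.f 615294)) (.f
  618293)))))))) (.f 607384))))) (.q 5689)) (.s 569 (.f 608395) (.s 268 (.f 826395) (.s 456 (.s
  369 (.q 3569) (.s 126 (.s 145 (.q 1456) (.s 234 (.s 235 (.s 123 (.s 125 (.s 135 (.f 305142) (.q
  1235)) (.q 1256)) (.q 1236)) (.f 615293)) (.f 614293))) (.f 618295))) (.f 836495))))))) (.q
  3468)))))) (.s 346 (.s 347 (.s 457 (.q 4567) (.s 478 (.q 4678) (.s 134 (.q 1346) (.s 234 (.q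
  2346) (.s 345 (.s 348 (.s 137 (.s 147 (.s 167 (.s 157 (.s 145 (.s 578 (.f 607185) (.s 135 (.s
  357 (.f 405173) (.f 607385)) (.f 405163))) (.q 1457)) (.f 407153)) (.q 1367)) (.q 1347)) (.s 147
  (.f 407183) (.s 127 (.s 349 (.f 719384) (.f 714293)) (.f 718293)))) (.q 3468)) (.q 3456))))))
  (.q 3467)) (.q 3467))))))) (.q 3567)) (.s 137 (.q 1367) (.s 167 (.q 1367) (.s 237 (.q 2367) (.s
  267 (.q 2367) (.s 378 (.s 678 (.s 567 (.f 608375) (.s 349 (.s 345 (.s 348 (.s 489 (.q 3489) (.s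
  248 (.f 408293) (.s 456 (.q 3456) (.s 467 (.q 4567) (.s 347 (.s 146 (.f 406173) (.s 246 (.f
  406273) (.s 147 (.q 1467) (.s 479 (.s 469 (.f 709486) (.f 617394)) (.s 469 (.q 4679) (.s 127 (.f
  716294) (.s 278 (.s 379 (.f 708293) (.f 829374)) (.f 718294)))))))) (.s 478 (.s 379 (.f 709384)
  (.q 3479)) (.q 3478))))))) (.q 3489)) (.q 3459)) (.s 348 (.s 134 (.q 1348) (.s 234 (.q 2348) (.s
  345 (.s 456 (.q 3456) (.s 467 (.q 4567) (.s 346 (.s 369 (.q 3469) (.s 379 (.f 619375) (.s 126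
  (.s 127 (.f 716293) (.s 278 (.s 268 (.f 618273) (.s 679 (.f 708296) (.f 827396))) (.f 718293)))
  (.f 617293)))) (.s 146 (.q 1346) (.s 347 (.q 3467) (.s 126 (.f 614273) (.s 379 (.s 369 (.f
  709386) (.f 619374)) (.s 369 (.q 3679) (.f 617293))))))))) (.q 3458)))) (.s 148 (.q 1348) (.s
  248 (.q 2348) (.s 346 (.q 3468) (.s 468 (.s 467 (.f 608374) (.s 456 (.s 457 (.f 837465) (.s 146
  (.q 1468) (.s 246 (.q 2468) (.s 345 (.q 3456) (.s 145 (.q 1456) (.s 245 (.q 2456) (.s 125 (.s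
  135 (.s 235 (.s 234 (.f 305142) (.q 2345)) (.f 526374)) (.f 516374)) (.f 516274)))))))) (.f
  836475))) (.q 3468)))))))) (.q 3678)) (.q 3678)))))))))) (.q 3568))))) (.s 168 (.q 1368) (.s 268
  (.q 2368) (.s 369 (.q 3689) (.s 379 (.s 237 (.q 2379) (.s 357 (.q 3579) (.s 579 (.s 367 (.q
  3679) (.s 679 (.s 378 (.s 578 (.s 589 (.s 678 (.s 689 (.s 568 (.f 708596) (.s 567 (.q 5678) (.s
  569 (.s 156 (.q 1569) (.s 256 (.q 2569) (.s 356 (.q 3569) (.s 136 (.s 236 (.s 135 (.s 235 (.s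
  126 (.f 306152) (.s 123 (.q 1236) (.s 125 (.s 128 (.q 1268) (.s 234 (.s 347 (.q 2347) (.s 248
  (.q 2348) (.s 145 (.s 146 (.f 306142) (.s 478 (.s 148 (.q 1248) (.s 458 (.q 1458) (.s 468 (.f
  708496) (.f 618475)))) (.q 3478))) (.f 305142)))) (.s 134 (.q 1234) (.s 345 (.s 146 (.f 406153)
  (.q 1346)) (.q 2345))))) (.f 305162)))) (.q 2356)) (.q 1356)) (.f 628375)) (.f 618375))))) (.f
  709586)))) (.f 708396)) (.q 3678)) (.f 708395)) (.q 3578)) (.q 3789)) (.q 3679))) (.q 3579))))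
  (.s 248 (.s 234 (.q 2348) (.s 348 (.s 245 (.s 246 (.s 345 (.s 346 (.s 235 (.s 236 (.s 356 (.f
  405263) (.s 256 (.s 456 (.q 3456) (.s 568 (.q 2568) (.s 267 (.s 237 (.s 257 (.s 347 (.s 578 (.q
  2578) (.s 357 (.f 405273) (.s 367 (.f 406273) (.f 736485)))) (.q 2347)) (.q 2567)) (.q 2367))
  (.s 567 (.q 2567) (.s 278 (.f 826475) (.s 378 (.f 836475) (.s 247 (.s 237 (.f 407263) (.f
  407283)) (.q 2478)))))))) (.f 406253))) (.f 406283)) (.f 405283)) (.q 2346)) (.q 2345)) (.q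
  2468)) (.q 2458)) (.q 2348))) (.s 128 (.s 123 (.s 125 (.s 126 (.s 235 (.s 236 (.s 135 (.s 136
  (.s 256 (.f 305162) (.s 156 (.s 356 (.q 2356) (.s 568 (.q 1568) (.s 237 (.s 127 (.s 137 (.s 257
  (.f 305172) (.s 267 (.f 306172) (.s 578 (.s 157 (.q 1578) (.f 307152)) (.f 726385)))) (.q 1237))
  (.q 1237)) (.s 178 (.s 157 (.q 1578) (.s 567 (.q 1567) (.f 816275))) (.f 817293))))) (.f
  306152))) (.q 1236)) (.q 1235)) (.f 816293)) (.f 815293)) (.q 1268)) (.q 1258)) (.q 1238)) (.s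
  148 (.q 1248) (.s 149 (.q 1489) (.s 378 (.s 137 (.q 1378) (.s 357 (.q 3578) (.s 578 (.s 367 (.q
  3678) (.s 678 (.s 157 (.q 1357) (.s 167 (.q 1367) (.s 589 (.s 579 (.s 569 (.s 156 (.q 1569) (.s
  256 (.q 2569) (.s 679 (.s 689 (.s 568 (.f 708596) (.s 567 (.q 5678) (.s 136 (.s 236 (.s 235 (.s
  126 (.f 306152) (.s 127 (.q 1267) (.s 278 (.f 618275) (.f 718293)))) (.q 2356)) (.f 628375)) (.f
  618375)))) (.f 708396)) (.s 689 (.q 6789) (.s 278 (.f 827396) (.s 127 (.s 123 (.s 126 (.s 235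
  (.s 236 (.s 136 (.f 306152) (.q 1236)) (.f 716293)) (.f 715293)) (.q 1267)) (.q 1237)) (.f
  718296))))))) (.f 709586)) (.q 5789)) (.s 579 (.f 708395) (.s 278 (.f 827395) (.s 569 (.f
  839576) (.s 127 (.s 256 (.s 123 (.s 125 (.s 235 (.s 236 (.s 135 (.f 305162) (.q 1235)) (.f
  716293)) (.f 715293)) (.q 1257)) (.q 1237)) (.f 716295)) (.f 718295)))))))) (.q 3678))) (.q
  3578)))) (.s 278 (.q 2378) refutation₁₀)))))))))))))))

/-- A refutation of all sign vectors. -/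
def refutation : Refutation :=
  .s 138 (.s 368 (.s 168 (.s 378 (.s 178 refutation₁ (.q 1378)) (.s 137 (.s 367 (.s 678 (.q 3678)
  (.s 167 (.s 178 (.s 358 (.s 158 (.s 357 (.s 578 (.q 3578) (.s 567 (.f 608375) (.s 157 (.s 568
  (.q 5678) (.s 156 (.s 136 (.f 506173) (.s 458 (.s 456 (.s 457 (.s 348 (.f 508374) (.f 508364))
  (.q 4578)) (.q 4568)) (.s 145 (.s 345 (.s 146 (.f 406153) (.q 1456)) (.q 3458)) (.q 1458)))) (.q
  1567))) (.q 1578)))) (.q 3578)) (.q 1358)) (.s 135 (.s 356 (.q 3568) (.s 568 (.s 567 (.s 158 (.s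
  347 (.s 147 (.s 478 (.q 3478) (.s 148 (.s 267 (.s 128 (.s 237 (.s 247 (.s 257 (.s 125 (.f
  305172) (.s 578 (.f 607285) (.s 123 (.q 1235) (.s 235 (.s 258 (.s 157 (.s 357 (.s 238 (.s 127
  (.s 278 (.f 507182) (.f 508273)) (.f 307152)) (.q 1238)) (.f 607385)) (.q 1578)) (.q 1258)) (.q
  1235))))) (.s 235 (.s 357 (.q 2357) (.s 345 (.f 407253) (.q 3457))) (.q 2357))) (.q 2347)) (.f
  607283)) (.f 608172)) (.s 237 (.q 2367) (.s 349 (.s 379 (.f 407193) (.s 389 (.f 408193) (.s 247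
  (.f 407293) (.f 729384)))) (.s 379 (.q 3479) (.s 479 (.q 3479) (.s 679 (.q 3679) (.s 689 (.f
  728396) (.s 348 (.s 247 (.f 407283) (.s 467 (.f 608374) (.s 468 (.q 4678) (.f 728496)))) (.s 468
  (.s 247 (.f 728364) (.s 489 (.s 469 (.f 608194) (.q 4689)) (.f 728394))) (.q 3468)))))))))) (.q
  1478))) (.q 1347)) (.s 346 (.q 3467) (.s 467 (.s 348 (.q 3478) (.s 468 (.s 478 (.s 458 (.s 147
  (.f 607184) (.s 345 (.q 3458) (.s 258 (.s 235 (.s 238 (.s 268 (.s 125 (.f 305182) (.s 278 (.s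
  237 (.s 127 (.f 307182) (.s 267 (.s 257 (.s 157 (.f 307152) (.s 578 (.f 607285) (.q 1578))) (.f
  305172)) (.q 2678))) (.q 2378)) (.f 608275))) (.q 2568)) (.q 2358)) (.q 2358)) (.s 125 (.s 457
  (.s 145 (.q 1457) (.s 578 (.f 607485) (.s 234 (.f 305142) (.s 357 (.f 514273) (.f 607385)))))
  (.s 157 (.q 1457) (.s 456 (.q 4567) (.f 715364)))) (.q 1258))))) (.f 608475)) (.f 607384)) (.q
  3468))) (.q 3467)))) (.f 608175)) (.q 3567)) (.q 3568))) (.q 1358))) (.f 608173)) (.q 1367)))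
  (.q 3678)) (.q 1378))) (.q 1368)) (.s 136 (.s 358 (.s 158 (.s 356 (.s 568 (.q 3568) (.s 156 (.s
  168 (.s 348 (.s 148 (.s 346 (.s 468 (.q 3468) (.s 456 (.f 508364) (.s 146 (.s 345 (.s 458 (.q
  4568) (.s 145 (.s 135 (.f 405163) (.s 134 (.q 1345) (.s 147 (.s 347 (.s 357 (.s 367 (.f 406173)
  (.s 178 (.s 578 (.f 736485) (.s 567 (.q 3567) (.s 157 (.s 378 (.s 137 (.f 507183) (.f 407153))
  (.f 836475)) (.q 1578)))) (.f 408173))) (.f 405173)) (.q 1347)) (.s 137 (.q 1347) (.s 157 (.q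
  1457) (.s 178 (.s 478 (.s 367 (.q 1367) (.s 378 (.s 567 (.q 1567) (.s 379 (.s 679 (.s 689 (.f
  708196) (.f 708396)) (.q 3679)) (.s 139 (.q 1379) (.s 169 (.q 1369) (.s 689 (.q 1689) (.s 679
  (.f 708396) (.f 847596))))))) (.q 1378))) (.q 1478)) (.q 1478))))))) (.q 1456))) (.q 3456)) (.q
  1468)))) (.q 3468)) (.q 1348)) (.s 345 (.q 3458) (.s 458 (.s 456 (.s 148 (.s 457 (.s 178 (.s 378
  (.f 508374) (.s 137 (.s 357 (.s 157 (.s 167 (.s 367 (.f 506173) (.s 347 (.f 507364) (.s 478 (.s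
  147 (.f 507184) (.f 507164)) (.f 507384)))) (.f 507163)) (.q 1357)) (.q 3578)) (.q 1378))) (.f
  508174)) (.s 357 (.q 3457) (.s 467 (.q 4567) (.s 478 (.s 378 (.s 678 (.s 178 (.s 689 (.s 679 (.f
  708196) (.q 6789)) (.s 679 (.f 708396) (.f 837496))) (.q 1478)) (.q 4678)) (.q 3578)) (.q
  4578))))) (.f 508164)) (.q 3456)) (.q 3458)))) (.f 508163)) (.q 1568))) (.q 3568)) (.q 1358))
  (.s 135 (.s 348 (.s 148 (.s 345 (.s 458 (.q 3458) (.s 346 (.s 468 (.q 3468) (.s 145 (.s 146 (.s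
  168 (.s 156 (.s 356 (.f 405163) (.s 456 (.q 3456) (.s 567 (.s 157 (.s 137 (.s 147 (.s 378 (.f
  407183) (.s 347 (.s 367 (.f 406173) (.s 467 (.q 3467) (.s 267 (.s 236 (.s 237 (.s 126 (.f
  306172) (.s 235 (.f 306152) (.q 2356))) (.q 2367)) (.q 2367)) (.s 256 (.q 2567) (.s 236 (.s 246
  (.f 406253) (.q 2346)) (.s 246 (.f 406273) (.f 628374))))))) (.q 3478))) (.q 1457)) (.q 1357))
  (.q 1567)) (.s 357 (.q 3567) (.s 367 (.q 3567) (.s 467 (.q 4567) (.s 378 (.f 836475) (.s 137 (.s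
  347 (.s 147 (.s 167 (.s 178 (.s 679 (.s 689 (.f 708196) (.s 678 (.s 268 (.s 236 (.s 278 (.s 127
  (.f 607182) (.f 307162)) (.q 2678)) (.q 2368)) (.s 246 (.s 236 (.s 256 (.s 568 (.q 2568) (.s 578
  (.f 708596) (.f 736485))) (.f 406253)) (.f 406273)) (.s 236 (.q 2346) (.f 628374)))) (.q 6789)))
  (.s 569 (.q 5679) (.s 579 (.q 5679) (.f 736495)))) (.f 408173)) (.f 407163)) (.q 1347)) (.q
  3478)) (.q 1378))))))))) (.f 406153)) (.f 408163)) (.q 1468)) (.q 1458))) (.q 3468))) (.q 3458))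
  (.q 1348)) (.s 134 refutation₂ (.q 1348))) (.q 1358))) (.q 1368))) (.s 358 (.s 135 (.q 1358) (.s
  348 (.s 134 (.q 1348) (.s 368 (.s 136 (.q 1368) refutation₄) (.s 346 (.s 468 (.q 3468) (.s 356
  (.s 568 (.q 3568) (.s 456 (.f 508364) (.s 345 (.s 458 (.q 4568) (.s 367 (.s 357 (.s 378 (.q
  3678) (.s 578 (.q 3578) (.s 457 (.f 508374) (.s 467 (.f 837465) (.s 256 (.s 246 (.s 236 (.f
  506273) (.f 406253)) (.q 2456)) (.s 236 (.q 2356) (.s 246 (.f 406283) (.f 627485)))))))) (.q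
  3567)) (.s 467 (.q 3467) (.s 567 (.q 3567) (.s 457 (.q 4567) (.s 378 (.s 137 (.q 1378) (.s 678
  (.s 167 (.q 1367) (.s 258 (.s 245 (.s 248 (.s 238 (.s 268 (.s 235 (.f 405263) (.s 278 (.s 234
  (.q 2345) (.s 379 (.s 679 (.s 689 (.f 708296) (.f 708396)) (.q 3679)) (.s 369 (.q 3679) (.s 569
  (.q 3569) (.s 279 (.s 237 (.s 247 (.f 407283) (.q 2347)) (.q 2379)) (.s 289 (.q 2789) (.s 689
  (.q 2689) (.s 679 (.f 708396) (.s 578 (.s 478 (.f 847596) (.s 579 (.q 5679) (.s 147 (.s 157 (.f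
  718596) (.f 716495)) (.f 718496)))) (.f 748596)))))))))) (.q 2378))) (.f 508263)) (.f 408253))
  (.q 2458)) (.q 2458)) (.s 268 (.q 2568) (.s 579 (.s 589 (.f 708395) (.s 478 (.f 708495) (.s 569
  (.f 709586) (.s 347 (.s 357 (.f 736495) (.s 145 (.f 405173) (.f 517364))) (.q 3478))))) (.s 459
  (.q 4579) (.s 479 (.q 4579) (.s 569 (.q 5679) (.s 469 (.q 4569) (.s 589 (.f 836495) (.s 248 (.f
  826495) (.s 278 (.f 827495) (.s 157 (.s 147 (.f 407153) (.q 1457)) (.s 127 (.s 147 (.f 716495)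
  (.s 124 (.s 125 (.s 245 (.s 246 (.s 256 (.s 145 (.f 405162) (.q 1245)) (.f 716295)) (.f 716294))
  (.f 715294)) (.q 1257)) (.q 1247))) (.f 718295)))))))))))))) (.q 3678))) (.f 836475))))))) (.q
  3456)))) (.q 3568))) (.q 3468)))) (.s 148 (.q 1348) (.s 345 (.q 3458) (.s 458 (.s 145 (.q 1458)
  (.s 578 (.s 378 (.s 478 (.s 347 (.q 3478) (.s 457 (.f 508374) (.s 357 (.q 3457) (.s 456 (.s 467
  (.q 4567) (.s 368 (.f 508364) (.s 678 (.s 356 (.s 479 (.s 679 (.s 489 (.s 459 (.s 469 (.s 689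
  (.s 468 (.f 708496) (.s 346 (.f 506394) (.f 506384))) (.f 708396)) (.f 709486)) (.f 709485)) (.f
  708394)) (.q 4679)) (.s 459 (.q 4579) (.f 517394))) (.q 3568)) (.q 4678)))) (.s 346 (.q 3456)
  (.s 356 (.q 3456) (.s 467 (.s 368 (.f 608374) (.q 3568)) (.f 516374)))))))) (.q 4578)) (.q
  3578)) (.s 357 (.s 457 (.s 378 (.f 508374) (.s 389 (.s 489 (.s 359 (.s 349 (.s 459 (.s 379 (.s
  468 (.s 346 (.q 3468) (.s 369 (.s 567 (.s 367 (.s 368 (.f 608375) (.s 478 (.s 347 (.f 607384)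
  (.s 356 (.s 456 (.f 507364) (.q 3456)) (.q 3568))) (.f 608475))) (.q 3567)) (.s 356 (.s 456 (.s
  368 (.f 508364) (.s 236 (.s 256 (.f 506293) (.q 2356)) (.s 256 (.f 506283) (.f 628375)))) (.q
  4567)) (.q 3567))) (.q 3469))) (.s 368 (.q 3468) (.s 456 (.s 356 (.s 346 (.s 469 (.f 506394) (.s
  467 (.f 506374) (.s 237 (.s 257 (.f 507293) (.q 2357)) (.s 257 (.f 507283) (.s 247 (.f 728354)
  (.s 267 (.f 728365) (.s 347 (.s 367 (.s 479 (.f 507394) (.s 678 (.q 3678) (.f 729486))) (.f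
  507364)) (.s 479 (.s 478 (.s 678 (.f 709486) (.q 4678)) (.f 507384)) (.q 3479))))))))) (.f
  506384)) (.q 3568)) (.q 4568)))) (.f 509374)) (.q 4589)) (.f 509384)) (.q 3589)) (.q 3489)) (.s
  349 (.q 3489) (.s 379 (.q 3789) (.s 238 (.s 258 (.s 237 (.s 257 (.s 368 (.s 456 (.f 508364) (.s
  567 (.f 608375) (.f 836475))) (.s 236 (.s 356 (.s 256 (.s 367 (.f 506273) (.s 456 (.s 267 (.s
  347 (.f 507364) (.s 247 (.s 478 (.f 507284) (.f 507384)) (.f 507264))) (.f 507263)) (.q 3456)))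
  (.q 2356)) (.q 3568)) (.q 2368))) (.q 2578)) (.q 2378)) (.q 2358)) (.s 248 (.q 2348) (.s 235 (.q
  2358) (.s 156 (.s 356 (.s 456 (.s 368 (.f 508364) (.s 136 (.s 367 (.f 506173) (.s 347 (.f
  507364) (.s 478 (.s 147 (.q 1478) (.s 247 (.q 2478) (.s 257 (.s 237 (.s 267 (.f 507264) (.f
  507263)) (.f 507283)) (.s 237 (.q 2357) (.s 359 (.f 729385) (.s 125 (.s 234 (.s 123 (.s 124 (.s
  126 (.s 134 (.s 146 (.s 467 (.q 1467) (.s 346 (.s 236 (.s 246 (.f 304162) (.q 2346)) (.q 2346))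
  (.f 506374))) (.f 306142)) (.q 1234)) (.q 1256)) (.q 1245)) (.q 1235)) (.f 514293)) (.f
  517293))))))) (.f 507384)))) (.f 506183))) (.q 1456)) (.q 1356)) (.s 136 (.q 1356) (.s 456 (.s
  368 (.f 508364) (.s 268 (.q 2368) (.s 356 (.s 568 (.q 3568) (.s 369 (.q 3689) (.s 126 (.s 359
  (.f 619385) (.f 615293)) (.f 618293)))) (.q 3568)))) (.s 356 (.q 3456) (.s 567 (.s 368 (.f
  608375) (.q 3568)) (.q 4567))))))))))))) (.q 4578)) (.q 3578)))) (.q 3458)))))) (.s 158 (.q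
  1358) (.s 389 (.s 589 refutation₈ (.q 3589)) (.s 139 (.q 1389) (.s 189 (.q 1389) (.s 359 (.q
  3589) (.s 159 (.q 1359) refutation₁₁)))))))


/-- The bit set of the codes of the triples `0 < j < k < 10`. -/
def zeroTriples : ℕ :=
  (List.range 10).foldr (fun k T => (List.range k).foldr
    (fun j T => if j = 0 then T else T ||| 1 <<< code 0 j k) T) 0

theorem check_refutation : refutation.check zeroTriples 0 = true := by
  decide +kernel

theorem extends_zeroTriples {χ : ℕ → Bool}
    (h : ∀ j k, 0 < j → j < k → k < 10 → χ (code 0 j k) = true) : Extends χ zeroTriples 0 := by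
  intro n
  refine ⟨fun hn => ?_, by simp⟩
  have inner : ∀ k (L : List ℕ) (T : ℕ), (∀ j ∈ L, j < k) → k < 10 →
      (L.foldr (fun j T => if j = 0 then T else T ||| 1 <<< code 0 j k) T).testBit n = true →
      T.testBit n = true ∨ χ n = true := by
    intro k L T hL hk
    induction L with
    | nil => exact Or.inl
    | cons j L ih =>
      intro hn
      have ih' := ih fun i hi => hL i (List.mem_cons_of_mem _ hi)
      simp only [List.foldr_cons] at hn
      split_ifs at hn with hj
      · exact ih' hn
      · rcases (testBit_or_one_shiftLeft _ _ _).mp hn with hn | rfl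
        · exact ih' hn
        · exact Or.inr (h j k (Nat.pos_of_ne_zero hj) (hL j List.mem_cons_self) hk)
  have outer : ∀ L : List ℕ, (∀ k ∈ L, k < 10) →
      (L.foldr (fun k T => (List.range k).foldr
        (fun j T => if j = 0 then T else T ||| 1 <<< code 0 j k) T) 0).testBit n = true →
      χ n = true := by
    intro L hL
    induction L with
    | nil => simp
    | cons k L ih =>
      intro hn
      rcases inner k _ _ (fun j => List.mem_range.mp) (hL k List.mem_cons_self) hn with hn | hn
      · exact ih (fun i hi => hL i (List.mem_cons_of_mem _ hi)) hn
      · exact hn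
  exact outer _ (fun k => List.mem_range.mp) hn

/-! ### Ten points with three pairwise crossing segments -/

/-- Ten points in general position can be numbered such that the first one is extreme and
sees the others in counterclockwise order. -/
theorem exists_radial_order {S : Finset (ℝ × ℝ)} (hcard : S.card = 10) (hS : GenPos S) :
    ∃ P : ℕ → ℝ × ℝ, (∀ i < 10, P i ∈ S) ∧ (∀ i < 10, ∀ j < 10, P i = P j → i = j) ∧
      ∀ j k, 0 < j → j < k → k < 10 → 0 < orient (P 0) (P j) (P k) := by
  classical
  obtain ⟨o, ho, hmin⟩ := S.exists_min_image (fun p => toLex p)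
    (Finset.card_pos.mp (by omega))
  have hlex : ∀ p ∈ S.erase o, o.1 < p.1 ∨ (o.1 = p.1 ∧ o.2 < p.2) := by
    intro p hp
    obtain ⟨hpo, hp⟩ := Finset.mem_erase.mp hp
    have h := lt_of_le_of_ne (hmin p hp) fun h => hpo (toLex.injective h).symm
    exact Prod.Lex.toLex_lt_toLex.mp h
  let key : ℝ × ℝ → WithTop ℝ := fun p =>
    if o.1 < p.1 then ((p.2 - o.2) / (p.1 - o.1) : ℝ) else ⊤
  have hkey : ∀ p ∈ S.erase o, ∀ q ∈ S.erase o, key p < key q → 0 < orient o p q := by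
    intro p hp q hq h
    simp only [key] at h
    rcases hlex p hp with hp | ⟨hp, hp'⟩
    · rcases hlex q hq with hq | ⟨hq, hq'⟩
      · rw [if_pos hp, if_pos hq, WithTop.coe_lt_coe, div_lt_div_iff₀ (by linarith)
          (by linarith)] at h
        unfold orient
        linarith
      · have h₁ := mul_pos (sub_pos.mpr hp) (sub_pos.mpr hq')
        unfold orient
        rw [← hq, sub_self]
        linarith
    · rw [if_neg (by rw [hp]; exact lt_irrefl _)] at h
      exact absurd h not_top_lt
  have hinj : Set.InjOn key (S.erase o) := by
    intro p hp q hq h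
    by_contra hpq
    obtain ⟨hpo, hpS⟩ := Finset.mem_erase.mp hp
    obtain ⟨hqo, hqS⟩ := Finset.mem_erase.mp hq
    apply hS.orient_ne_zero ho hpS hqS (Ne.symm hpo) (Ne.symm hqo) hpq
    simp only [key] at h
    rcases hlex p hp with hp | ⟨hp, hp'⟩ <;> rcases hlex q hq with hq | ⟨hq, hq'⟩
    · rw [if_pos hp, if_pos hq, WithTop.coe_inj, div_eq_div_iff (by linarith)
        (by linarith)] at h
      unfold orient
      linarith
    · rw [if_pos hp, if_neg (by rw [hq]; exact lt_irrefl _)] at h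
      exact absurd h (WithTop.coe_ne_top)
    · rw [if_pos hq, if_neg (by rw [hp]; exact lt_irrefl _)] at h
      exact absurd h.symm (WithTop.coe_ne_top)
    · unfold orient
      rw [← hp, ← hq]
      ring
  have hK : ((S.erase o).image key).card = 9 := by
    rw [Finset.card_image_of_injOn hinj, Finset.card_erase_of_mem ho, hcard]
  let φ := ((S.erase o).image key).orderEmbOfFin hK
  have hφ : ∀ i, ∃ p ∈ S.erase o, key p = φ i := fun i =>
    Finset.mem_image.mp (Finset.orderEmbOfFin_mem _ hK i)
  choose g hg hgφ using hφ
  have hgpos : ∀ i j, i < j → 0 < orient o (g i) (g j) := fun i j hij =>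
    hkey _ (hg i) _ (hg j) (by rw [hgφ, hgφ]; exact φ.strictMono hij)
  have hginj : Function.Injective g := fun i j h =>
    φ.injective (by rw [← hgφ, ← hgφ, h])
  refine ⟨fun i => if h : 0 < i ∧ i < 10 then g ⟨i - 1, by omega⟩ else o, ?_, ?_, ?_⟩
  · intro i _
    dsimp only
    split_ifs
    · exact Finset.mem_of_mem_erase (hg _)
    · exact ho
  · intro i hi j hj h
    dsimp only at h
    split_ifs at h with h₁ h₂ h₂
    · have := congrArg Fin.val (hginj h)
      simp only at this
      omega
    · exact absurd h (Finset.ne_of_mem_erase (hg _))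
    · exact absurd h.symm (Finset.ne_of_mem_erase (hg _))
    · omega
  · intro j k hj hjk hk
    have hj' : 0 < j ∧ j < 10 := by omega
    have hk' : 0 < k ∧ k < 10 := by omega
    simp only [hj', hk', lt_irrefl, false_and, and_self, dite_true, dite_false]
    exact hgpos _ _ (Fin.mk_lt_mk.mpr (by omega))

theorem hasCrossingFamily_three {S : Finset (ℝ × ℝ)} (hcard : S.card = 10) (hS : GenPos S) :
    HasCrossingFamily S 3 := by
  classical
  obtain ⟨P, hPS, hP, hpos⟩ := exists_radial_order hcard hS
  by_contra hno
  let χ : ℕ → Bool := fun n =>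
    decide (0 < orient (P (digit n 2)) (P (digit n 1)) (P (digit n 0)))
  have hχ : ∀ i j k, i < 10 → j < 10 → k < 10 →
      χ (code i j k) = decide (0 < orient (P i) (P j) (P k)) := by
    intro i j k hi hj hk
    have h₂ : digit (code i j k) 2 = i := by unfold digit code; omega
    have h₁ : digit (code i j k) 1 = j := by unfold digit code; omega
    have h₀ : digit (code i j k) 0 = k := by unfold digit code; omega
    simp only [χ, h₀, h₁, h₂]
  have hne : ∀ i j k, i < j → j < k → k < 10 → orient (P i) (P j) (P k) ≠ 0 := by
    intro i j k hij hjk hk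
    exact hS.orient_ne_zero (hPS _ (by omega)) (hPS _ (by omega)) (hPS _ hk)
      (fun h => by have := hP _ (by omega) _ (by omega) h; omega)
      (fun h => by have := hP _ (by omega) _ (by omega) h; omega)
      (fun h => by have := hP _ (by omega) _ (by omega) h; omega)
  have hmono : ∀ i j k l, i < j → j < k → k < l → l < 10 → IsMonotoneAt χ i j k l := by
    intro i j k l hij hjk hkl hl
    have ha := hne i j k hij hjk (by omega)
    have hb := hne i j l hij (by omega) hl
    have hc := hne i k l (by omega) hkl hl
    have hd := hne j k l hjk hkl hl
    simp only [IsMonotoneAt]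
    rw [hχ i j k (by omega) (by omega) (by omega), hχ i j l (by omega) (by omega) hl,
      hχ i k l (by omega) (by omega) hl, hχ j k l (by omega) (by omega) hl]
    rcases Nat.eq_zero_or_pos i with rfl | hi
    · have ha' := hpos j k hij hjk (by omega)
      have hb' := hpos j l hij (by omega) hl
      have hc' := hpos k l (by omega) hkl hl
      simp [ha', hb', hc']
    · have hij' := hpos i j hi hij (by omega)
      have hik' := hpos i k hi (by omega) (by omega)
      have hil' := hpos i l hi (by omega) hl
      have hjk' := hpos j k (by omega) hjk (by omega)
      have hjl' := hpos j l (by omega) (by omega) hl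
      have hkl' := hpos k l (by omega) hkl hl
      have e₁ : orient (P i) (P j) (P k) * orient (P 0) (P i) (P l)
          - orient (P i) (P j) (P l) * orient (P 0) (P i) (P k)
          + orient (P i) (P k) (P l) * orient (P 0) (P i) (P j) = 0 := by
        unfold orient; ring
      have e₂ : orient (P i) (P j) (P k) * orient (P 0) (P j) (P l)
          - orient (P i) (P j) (P l) * orient (P 0) (P j) (P k)
          + orient (P j) (P k) (P l) * orient (P 0) (P i) (P j) = 0 := by
        unfold orient; ring
      have e₃ : orient (P i) (P j) (P k) * orient (P 0) (P k) (P l)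
          - orient (P i) (P k) (P l) * orient (P 0) (P j) (P k)
          + orient (P j) (P k) (P l) * orient (P 0) (P i) (P k) = 0 := by
        unfold orient; ring
      have e₄ : orient (P i) (P j) (P l) * orient (P 0) (P k) (P l)
          - orient (P i) (P k) (P l) * orient (P 0) (P j) (P l)
          + orient (P j) (P k) (P l) * orient (P 0) (P i) (P l) = 0 := by
        unfold orient; ring
      have key : ∀ x y z u v w : ℝ, x ≠ 0 → y ≠ 0 → z ≠ 0 → 0 < u → 0 < v → 0 < w →
          x * u - y * v + z * w = 0 →
          ¬(decide (0 < x) ≠ decide (0 < y) ∧ decide (0 < y) ≠ decide (0 < z)) := by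
        rintro x y z u v w hx hy hz hu hv hw h ⟨h₁, h₂⟩
        rcases hy.lt_or_gt with hy | hy
        · have hx : 0 < x := by simpa [hy.not_gt] using h₁
          have hz : 0 < z := by simpa [hy.not_gt] using h₂
          nlinarith [mul_pos hx hu, mul_pos hz hw, mul_pos (neg_pos.mpr hy) hv]
        · have hx : x < 0 := lt_of_le_of_ne (by simpa [hy] using h₁) hx
          have hz : z < 0 := lt_of_le_of_ne (by simpa [hy] using h₂) hz
          nlinarith [mul_pos (neg_pos.mpr hx) hu, mul_pos (neg_pos.mpr hz) hw, mul_pos hy hv]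
      exact ⟨key _ _ _ _ _ _ ha hb hc hil' hik' hij' e₁,
        key _ _ _ _ _ _ ha hb hd hjl' hjk' hij' e₂,
        key _ _ _ _ _ _ ha hc hd hkl' hjk' hik' e₃,
        key _ _ _ _ _ _ hb hc hd hkl' hjl' hil' e₄⟩
  have opposite : ∀ x y : ℝ, x ≠ 0 → y ≠ 0 → decide (0 < x) ≠ decide (0 < y) → x * y < 0 := by
    intro x y hx hy h
    rcases hx.lt_or_gt with hx | hx
    · exact mul_neg_of_neg_of_pos hx (by simpa [hx.not_gt] using h)
    · exact mul_neg_of_pos_of_neg hx (lt_of_le_of_ne (by simpa [hx] using h) hy)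
  have same : ∀ x y : ℝ, x ≠ 0 → y ≠ 0 → decide (0 < x) = decide (0 < y) → 0 < x * y := by
    intro x y hx hy h
    rcases hx.lt_or_gt with hx | hx
    · exact mul_pos_of_neg_of_neg hx (lt_of_le_of_ne (by simpa [hx.not_gt] using h) hy)
    · exact mul_pos hx (by simpa [hx] using h)
  have hcross : ∀ a b c d, b < 10 → d < 10 → SignCross χ a b c d →
      Crosses (P a) (P b) (P c) (P d) := by
    intro a b c d hb hd h
    rcases h with ⟨hac, hcb, hbd, h⟩ | ⟨hac, hcd, hdb, h⟩
    · obtain ⟨h₁, h₂, h₃, h₄⟩ := hmono a c b d hac hcb hbd hd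
      have e₁ : χ (code a c b) = χ (code a b d) := by grind
      have e₂ : χ (code a c d) = χ (code c b d) := by grind
      rw [hχ _ _ _ (by omega) (by omega) (by omega),
        hχ _ _ _ (by omega) (by omega) (by omega)] at e₁ e₂
      have s₁ := same _ _ (hne _ _ _ hac hcb hb) (hne _ _ _ (by omega) hbd hd) e₁
      have s₂ := same _ _ (hne _ _ _ hac (by omega) hd) (hne _ _ _ hcb hbd hd) e₂
      apply crosses_of_orient
      · rw [orient_swap (P a) (P c) (P b)]
        linarith
      · rw [orient_rotate (P a) (P c) (P d), orient_swap (P c) (P b) (P d)]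
        linarith
    · obtain ⟨h₁, h₂, h₃, h₄⟩ := hmono a c d b hac hcd hdb hb
      have e₁ : χ (code a c d) ≠ χ (code c d b) := by grind
      rw [hχ _ _ _ (by omega) (by omega) (by omega),
        hχ _ _ _ (by omega) (by omega) (by omega)] at h e₁
      have s₁ := opposite _ _ (hne _ _ _ hac (by omega) hb) (hne _ _ _ (by omega) hdb hb) h
      have s₂ := opposite _ _ (hne _ _ _ hac hcd (by omega)) (hne _ _ _ hcd hdb hb) e₁
      apply crosses_of_orient
      · rw [orient_swap (P a) (P c) (P b), orient_swap (P a) (P d) (P b)]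
        linarith
      · rw [orient_rotate (P a) (P c) (P d)]
        exact s₂
  refine Refutation.check_sound hmono ?_ refutation zeroTriples 0 check_refutation
    (extends_zeroTriples fun j k hj hjk hk => ?_)
  · intro a b c d e f hb hd hf hef h₁ h₂ h₃
    have hab : a < b := by rcases h₁ with h | h <;> omega
    have hac : a < c := by rcases h₁ with h | h <;> omega
    have hce : c < e := by rcases h₃ with h | h <;> omega
    have hcd : c < d := by rcases h₁ with h | h <;> omega
    have c₁ := hcross _ _ _ _ hb hd h₁
    have c₂ := hcross _ _ _ _ hb hf h₂
    have c₃ := hcross _ _ _ _ hd hf h₃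
    have ne : ∀ i j, i < j → j < 10 → P i ≠ P j := fun i j hij hj h =>
      hij.ne (hP i (by omega) j hj h)
    apply hno
    refine ⟨{(P a, P b), (P c, P d), (P e, P f)}, ⟨?_, ?_⟩, ?_⟩
    · simp only [Finset.mem_insert, Finset.mem_singleton]
      rintro _ (rfl | rfl | rfl)
      · exact ⟨hPS _ (by omega), hPS _ hb, ne _ _ hab hb⟩
      · exact ⟨hPS _ (by omega), hPS _ hd, ne _ _ hcd hd⟩
      · exact ⟨hPS _ (by omega), hPS _ hf, ne _ _ hef hf⟩
    · simp only [Finset.mem_insert, Finset.mem_singleton]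
      rintro _ (rfl | rfl | rfl) _ (rfl | rfl | rfl) h
      exacts [absurd rfl h, c₁, c₂, c₁.symm, absurd rfl h, c₃, c₂.symm, c₃.symm, absurd rfl h]
    · apply Finset.card_eq_three.mpr
      exact ⟨_, _, _, fun h => ne a c hac (by omega) (congrArg Prod.fst h),
        fun h => ne a e (by omega) (by omega) (congrArg Prod.fst h),
        fun h => ne c e hce (by omega) (congrArg Prod.fst h), rfl⟩
  · rw [hχ _ _ _ (by omega) (by omega) hk]
    exact decide_eq_true (hpos j k hj hjk hk)

/-- For every `n` with `10 ≤ n ≤ 14`, `cf(n) = 3`: every set of `n` points in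
general position contains a 3-crossing family, and there exists a set of `n`
points in general position containing no 4-crossing family. -/
theorem cf_eq_three_of_between_10_and_14 (n : ℕ) (h1 : 10 ≤ n) (h2 : n ≤ 14) :
    cfNat n = 3 ∧
    (∀ S : Finset (ℝ × ℝ), S.card = n → GenPos S → HasCrossingFamily S 3) ∧
    (∃ S : Finset (ℝ × ℝ), S.card = n ∧ GenPos S ∧ ¬ HasCrossingFamily S 4) := by
  have lower : ∀ S : Finset (ℝ × ℝ), S.card = n → GenPos S → HasCrossingFamily S 3 := by
    intro S hcard hS
    obtain ⟨T, hTS, hT⟩ := Finset.exists_subset_card_eq (h1.trans hcard.ge)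
    exact (hasCrossingFamily_three hT (hS.mono hTS)).mono hTS le_rfl
  have upper : ¬ HasCrossingFamily (firstPts n) 4 := fun h =>
    not_hasCrossingFamily_firstPts
      (h.mono (Finset.image_subset_image (Finset.range_subset_range.mpr h2)) le_rfl)
  refine ⟨le_antisymm (Nat.sInf_le ⟨firstPts n, card_firstPts h2, genPos_firstPts h2, ?_⟩) ?_,
    lower, firstPts n, card_firstPts h2, genPos_firstPts h2, upper⟩
  · exact le_antisymm (cf_le upper)
      (le_cf (lower _ (card_firstPts h2) (genPos_firstPts h2)))
  · refine le_csInf ⟨_, firstPts n, card_firstPts h2, genPos_firstPts h2, rfl⟩ ?_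
    rintro _ ⟨S, hcard, hS, rfl⟩
    exact le_cf (lower S hcard hS)
end

section
/- There exists a set of 9 points in the plane in general position that contains no 3-crossing family (while containing a 2-crossing family), i.e., a set S of 9 points with cf(S) = 2. -/
/-- Twice the signed area of the triangle `pqr`. -/
def orientation {R : Type*} [CommRing R] (p q r : R × R) : R :=
  (q.1 - p.1) * (r.2 - p.2) - (q.2 - p.2) * (r.1 - p.1)

theorem orientation_eq_zero_of_collinear {p q r : ℝ × ℝ}
    (h : Collinear ℝ ({p, q, r} : Set (ℝ × ℝ))) : orientation p q r = 0 := by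
  obtain ⟨v, hv⟩ := (collinear_iff_of_mem (p₀ := p) (by simp)).1 h
  obtain ⟨a, rfl⟩ := hv q (by simp)
  obtain ⟨b, rfl⟩ := hv r (by simp)
  simp [orientation]
  ring

theorem orientation_combination {p q r s x : ℝ × ℝ} (hx : x ∈ openSegment ℝ p q)
    (hx' : x ∈ openSegment ℝ r s) :
    ∃ a b : ℝ, 0 < a ∧ 0 < b ∧ a * orientation p q r + b * orientation p q s = 0 := by
  obtain ⟨c, d, -, -, hcd, rfl⟩ := hx
  obtain ⟨a, b, ha, hb, hab, h⟩ := hx'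
  refine ⟨a, b, ha, hb, ?_⟩
  obtain ⟨h1, h2⟩ := Prod.ext_iff.1 h
  simp only [Prod.fst_add, Prod.smul_fst, Prod.snd_add, Prod.smul_snd, smul_eq_mul] at h1 h2
  obtain rfl : a = 1 - b := by linarith
  obtain rfl : c = 1 - d := by linarith
  simp only [orientation]
  linear_combination (q.1 - p.1) * h2 - (q.2 - p.2) * h1

theorem mul_neg_of_combination_eq_zero {a b u v : ℝ} (ha : 0 < a) (hb : 0 < b)
    (h : a * u + b * v = 0) (hu : u ≠ 0) : u * v < 0 := by
  have h1 : b * (u * v) = -(a * u ^ 2) := by linear_combination u * h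
  have h2 : 0 < a * u ^ 2 := by positivity
  by_contra! h3
  nlinarith [mul_nonneg hb.le h3]

theorem not_crosses_swap {p q : ℝ × ℝ} (hpq : p ≠ q) : ¬ Crosses p q q p := by
  rintro ⟨x, h1, h2, h3⟩
  exact not_crosses_self hpq ⟨x, h1, h1, by rwa [segment_symm ℝ q p] at h3⟩

/-- Nine points in general position without three pairwise crossing segments. -/
def ninePoints : Fin 9 → ℤ × ℤ :=
  ![(3, 5), (8, 8), (13, 2), (10, 12), (11, 3), (6, 7), (1, 4), (9, 5), (10, 13)]

/-- The points `ninePoints`, in the real plane. -/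
def ninePointsReal (i : Fin 9) : ℝ × ℝ := ((ninePoints i).1, (ninePoints i).2)

theorem orientation_ninePointsReal (i j k : Fin 9) :
    orientation (ninePointsReal i) (ninePointsReal j) (ninePointsReal k) =
      (orientation (ninePoints i) (ninePoints j) (ninePoints k) : ℤ) := by
  simp [orientation, ninePointsReal]

theorem orientation_ninePoints_ne_zero : ∀ i j k : Fin 9, i ≠ j → i ≠ k → j ≠ k →
    orientation (ninePoints i) (ninePoints j) (ninePoints k) ≠ 0 := by
  unfold orientation
  decide +kernel

theorem ninePoints_injective : Function.Injective ninePoints := by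
  unfold Function.Injective
  decide +kernel

theorem ninePointsReal_injective : Function.Injective ninePointsReal := by
  intro i j h
  simp only [ninePointsReal, Prod.mk.injEq, Int.cast_inj] at h
  exact ninePoints_injective (Prod.ext h.1 h.2)

/-- Each of the segments `ij` and `kl` separates the endpoints of the other one. -/
def SeparatesNine (i j k l : Fin 9) : Prop :=
  orientation (ninePoints i) (ninePoints j) (ninePoints k) *
      orientation (ninePoints i) (ninePoints j) (ninePoints l) < 0 ∧
    orientation (ninePoints k) (ninePoints l) (ninePoints i) *
      orientation (ninePoints k) (ninePoints l) (ninePoints j) < 0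

instance (i j k l : Fin 9) : Decidable (SeparatesNine i j k l) := by
  unfold SeparatesNine
  infer_instance

theorem not_separatesNine_triple : ∀ i j k l : Fin 9, SeparatesNine i j k l →
    ∀ m n : Fin 9, SeparatesNine i j m n → ¬ SeparatesNine k l m n := by
  decide +kernel

theorem orientation_mul_neg_of_crosses {i j k l : Fin 9} (hij : i ≠ j) (hkl : k ≠ l)
    (h : Crosses (ninePointsReal i) (ninePointsReal j) (ninePointsReal k) (ninePointsReal l)) :
    orientation (ninePoints i) (ninePoints j) (ninePoints k) *
      orientation (ninePoints i) (ninePoints j) (ninePoints l) < 0 := by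
  obtain ⟨x, h1, h2, -⟩ := id h
  obtain ⟨a, b, ha, hb, hab⟩ := orientation_combination h1 h2
  by_cases hk : orientation (ninePoints i) (ninePoints j) (ninePoints k) = 0
  · have hl : orientation (ninePoints i) (ninePoints j) (ninePoints l) = 0 := by
      rw [orientation_ninePointsReal, orientation_ninePointsReal, hk] at hab
      simpa [hb.ne'] using hab
    have hk' : k = i ∨ k = j := by
      by_contra! hne
      exact orientation_ninePoints_ne_zero i j k hij hne.1.symm hne.2.symm hk
    have hl' : l = i ∨ l = j := by
      by_contra! hne
      exact orientation_ninePoints_ne_zero i j l hij hne.1.symm hne.2.symm hl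
    have hne := ninePointsReal_injective.ne hij
    rcases hk' with rfl | rfl <;> rcases hl' with rfl | rfl
    · exact absurd rfl hkl
    · exact absurd h (not_crosses_self hne)
    · exact absurd h (not_crosses_swap hne)
    · exact absurd rfl hkl
  · rw [orientation_ninePointsReal, orientation_ninePointsReal] at hab
    exact_mod_cast mul_neg_of_combination_eq_zero ha hb hab (Int.cast_ne_zero.2 hk)

theorem separatesNine_of_crosses {i j k l : Fin 9} (hij : i ≠ j) (hkl : k ≠ l)
    (h : Crosses (ninePointsReal i) (ninePointsReal j) (ninePointsReal k) (ninePointsReal l)) :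
    SeparatesNine i j k l :=
  ⟨orientation_mul_neg_of_crosses hij hkl h, orientation_mul_neg_of_crosses hkl hij h.symm⟩

/-- The points `ninePointsReal` as a finite set. -/
noncomputable def nineSet : Finset (ℝ × ℝ) := Finset.univ.image ninePointsReal

theorem mem_nineSet {p : ℝ × ℝ} : p ∈ nineSet ↔ ∃ i, ninePointsReal i = p := by
  simp [nineSet]

theorem genPos_nineSet : GenPos nineSet := by
  intro p hp q hq r hr hpq hpr hqr h
  obtain ⟨i, rfl⟩ := mem_nineSet.1 hp
  obtain ⟨j, rfl⟩ := mem_nineSet.1 hq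
  obtain ⟨k, rfl⟩ := mem_nineSet.1 hr
  have h0 := orientation_eq_zero_of_collinear h
  rw [orientation_ninePointsReal, Int.cast_eq_zero] at h0
  exact orientation_ninePoints_ne_zero i j k (fun e => hpq (congrArg _ e))
    (fun e => hpr (congrArg _ e)) (fun e => hqr (congrArg _ e)) h0

theorem IsCrossingFamily.subset {S : Finset (ℝ × ℝ)} {F G : Finset ((ℝ × ℝ) × (ℝ × ℝ))}
    (hF : IsCrossingFamily S F) (hGF : G ⊆ F) : IsCrossingFamily S G :=
  ⟨fun e he => hF.1 e (hGF he), fun e he f hf => hF.2 e (hGF he) f (hGF hf)⟩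

theorem HasCrossingFamily.mono_s4 {S : Finset (ℝ × ℝ)} {k m : ℕ} (h : HasCrossingFamily S m)
    (hkm : k ≤ m) : HasCrossingFamily S k := by
  obtain ⟨F, hF, rfl⟩ := h
  obtain ⟨G, hGF, hG⟩ := Finset.exists_subset_card_eq hkm
  exact ⟨G, hF.subset hGF, hG⟩

theorem not_hasCrossingFamily_three_nineSet : ¬ HasCrossingFamily nineSet 3 := by
  rintro ⟨F, ⟨hmem, hcross⟩, hcard⟩
  obtain ⟨e, f, g, hef, heg, hfg, rfl⟩ := Finset.card_eq_three.1 hcard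
  have hindex : ∀ d ∈ ({e, f, g} : Finset ((ℝ × ℝ) × (ℝ × ℝ))), ∃ i j : Fin 9, i ≠ j ∧
      ninePointsReal i = d.1 ∧ ninePointsReal j = d.2 := by
    intro d hd
    obtain ⟨h1, h2, hne⟩ := hmem d hd
    obtain ⟨i, hi⟩ := mem_nineSet.1 h1
    obtain ⟨j, hj⟩ := mem_nineSet.1 h2
    exact ⟨i, j, fun hij => hne (by rw [← hi, ← hj, hij]), hi, hj⟩
  obtain ⟨i, j, hij, hi, hj⟩ := hindex e (by simp)
  obtain ⟨k, l, hkl, hk, hl⟩ := hindex f (by simp)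
  obtain ⟨m, n, hmn, hm, hn⟩ := hindex g (by simp)
  have cef := hcross e (by simp) f (by simp) hef
  have ceg := hcross e (by simp) g (by simp) heg
  have cfg := hcross f (by simp) g (by simp) hfg
  rw [← hi, ← hj, ← hk, ← hl] at cef
  rw [← hi, ← hj, ← hm, ← hn] at ceg
  rw [← hk, ← hl, ← hm, ← hn] at cfg
  exact not_separatesNine_triple i j k l (separatesNine_of_crosses hij hkl cef) m n
    (separatesNine_of_crosses hij hmn ceg) (separatesNine_of_crosses hkl hmn cfg)

theorem crosses_ninePointsReal :
    Crosses (ninePointsReal 0) (ninePointsReal 5) (ninePointsReal 1) (ninePointsReal 6) := by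
  have h0 : ninePointsReal 0 = (3, 5) := by simp [ninePointsReal, ninePoints]
  have h5 : ninePointsReal 5 = (6, 7) := by simp [ninePointsReal, ninePoints]
  have h1 : ninePointsReal 1 = (8, 8) := by simp [ninePointsReal, ninePoints]
  have h6 : ninePointsReal 6 = (1, 4) := by simp [ninePointsReal, ninePoints]
  rw [h0, h5, h1, h6]
  have hx : ((9 / 2, 6) : ℝ × ℝ) ∈ openSegment ℝ (3, 5) (6, 7) :=
    ⟨1 / 2, 1 / 2, by norm_num, by norm_num, by norm_num, by ext <;> norm_num⟩
  have hx' : ((9 / 2, 6) : ℝ × ℝ) ∈ openSegment ℝ (8, 8) (1, 4) :=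
    ⟨1 / 2, 1 / 2, by norm_num, by norm_num, by norm_num, by ext <;> norm_num⟩
  refine ⟨(9 / 2, 6), hx, hx', Set.Subset.antisymm ?_ ?_⟩
  · rintro y ⟨⟨a, b, -, -, hab, rfl⟩, ⟨c, d, -, -, hcd, h⟩⟩
    simp only [Prod.smul_mk, smul_eq_mul, Prod.mk_add_mk, Prod.mk.injEq] at h
    obtain ⟨h1, h2⟩ := h
    simp only [Prod.smul_mk, smul_eq_mul, Prod.mk_add_mk, Set.mem_singleton_iff, Prod.mk.injEq]
    constructor <;> linarith
  · rintro y rfl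
    exact ⟨openSegment_subset_segment ℝ _ _ hx, openSegment_subset_segment ℝ _ _ hx'⟩

theorem hasCrossingFamily_two_nineSet : HasCrossingFamily nineSet 2 := by
  have hmem : ∀ i, ninePointsReal i ∈ nineSet := fun i => mem_nineSet.2 ⟨i, rfl⟩
  have hne : ∀ i j : Fin 9, i ≠ j → ninePointsReal i ≠ ninePointsReal j :=
    fun _ _ => ninePointsReal_injective.ne
  refine ⟨{(ninePointsReal 0, ninePointsReal 5), (ninePointsReal 1, ninePointsReal 6)},
    ⟨?_, ?_⟩, Finset.card_pair fun h => hne 0 1 (by decide) (Prod.ext_iff.1 h).1⟩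
  · intro e he
    rw [Finset.mem_insert, Finset.mem_singleton] at he
    rcases he with rfl | rfl
    · exact ⟨hmem _, hmem _, hne _ _ (by decide)⟩
    · exact ⟨hmem _, hmem _, hne _ _ (by decide)⟩
  · intro e he f hf hef
    rw [Finset.mem_insert, Finset.mem_singleton] at he hf
    rcases he with rfl | rfl <;> rcases hf with rfl | rfl
    · exact absurd rfl hef
    · exact crosses_ninePointsReal
    · exact crosses_ninePointsReal.symm
    · exact absurd rfl hef

theorem cf_eq_of_hasCrossingFamily {S : Finset (ℝ × ℝ)} {k : ℕ} (h : HasCrossingFamily S k)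
    (h' : ¬ HasCrossingFamily S (k + 1)) : cf S = k := by
  refine IsGreatest.csSup_eq ⟨h, fun m hm => ?_⟩
  by_contra! hlt
  exact h' (HasCrossingFamily.mono_s4 hm hlt)

/-- There exists a set of 9 points in the plane in general position containing
a 2-crossing family but no 3-crossing family, i.e. with `cf S = 2`. -/
theorem exists_9_points_without_3_crossing_family :
    ∃ S : Finset (ℝ × ℝ), S.card = 9 ∧ GenPos S ∧
      HasCrossingFamily S 2 ∧ ¬ HasCrossingFamily S 3 ∧ cf S = 2 := by
  exact ⟨nineSet,
    by rw [nineSet, Finset.card_image_of_injective _ ninePointsReal_injective, Finset.card_univ,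
      Fintype.card_fin],
    genPos_nineSet, hasCrossingFamily_two_nineSet, not_hasCrossingFamily_three_nineSet,
    cf_eq_of_hasCrossingFamily hasCrossingFamily_two_nineSet not_hasCrossingFamily_three_nineSet⟩
end
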